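/- arXiv:1910.04217 — 8 statements merged into one kernel-verified Lean document; each statement's English description precedes it below -/
import Mathlib

section
/- Let d > 0, let R : (0,∞) → ℝ be bounded and Lipschitz continuous off a finite set of points, and let c_b ∈ (0,∞]. A function ρ : (0,c_b) → ℝ is a viscosity sub-solution (respectively, viscosity super-solution) of min{ρ − s·ρ′ + d·(ρ′)² + R(s), ρ} = 0 on (0,c_b) if and only if the function w(t,x) := t·ρ(x/t) is a viscosity sub-solution (respectively, viscosity super-solution) of min{∂ₜw + d·(∂ₓw)² + R(x/t), w} = 0 on the cone {(t,x) : t > 0, 0 < x < c_b·t} (for c_b = ∞ the cone is {(t,x) : t > 0, x > 0}). -/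
open Filter Set Topology

noncomputable section

/-- `ρ - φ` attains a strict local minimum at `s₀`. -/
def StrictLocMin (f : ℝ → ℝ) (s₀ : ℝ) : Prop :=
  ∀ᶠ s in 𝓝[≠] s₀, f s₀ < f s

/-- `ρ - φ` attains a strict local maximum at `s₀`. -/
def StrictLocMax (f : ℝ → ℝ) (s₀ : ℝ) : Prop :=
  ∀ᶠ s in 𝓝[≠] s₀, f s < f s₀

/-- `limsup_{s' → s₀} R s'`: the upper semicontinuous envelope of `R` at `s₀`. -/
def uscEnv (R : ℝ → ℝ) (s₀ : ℝ) : ℝ := Filter.limsup R (𝓝 s₀)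

/-- `liminf_{s' → s₀} R s'`: the lower semicontinuous envelope of `R` at `s₀`. -/
def lscEnv (R : ℝ → ℝ) (s₀ : ℝ) : ℝ := Filter.liminf R (𝓝 s₀)

/-- Viscosity super-solution of `min {ρ - s·ρ' + d·(ρ')² + R s, ρ} = 0` on `I`. -/
def IsViscSuper (d : ℝ) (R : ℝ → ℝ) (I : Set ℝ) (ρ : ℝ → ℝ) : Prop :=
  LowerSemicontinuousOn ρ I ∧ (∀ s ∈ I, 0 ≤ ρ s) ∧
    ∀ φ : ℝ → ℝ, ContDiff ℝ 1 φ → ∀ s₀ ∈ I,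
      StrictLocMin (fun s => ρ s - φ s) s₀ →
        0 ≤ ρ s₀ - s₀ * deriv φ s₀ + d * deriv φ s₀ ^ 2 + uscEnv R s₀

/-- Viscosity sub-solution of `min {ρ - s·ρ' + d·(ρ')² + R s, ρ} = 0` on `I`. -/
def IsViscSub (d : ℝ) (R : ℝ → ℝ) (I : Set ℝ) (ρ : ℝ → ℝ) : Prop :=
  UpperSemicontinuousOn ρ I ∧
    ∀ φ : ℝ → ℝ, ContDiff ℝ 1 φ → ∀ s₀ ∈ I,
      StrictLocMax (fun s => ρ s - φ s) s₀ → 0 < ρ s₀ →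
        ρ s₀ - s₀ * deriv φ s₀ + d * deriv φ s₀ ^ 2 + lscEnv R s₀ ≤ 0

/-- Viscosity solution: both a super- and a sub-solution. -/
def IsViscSol (d : ℝ) (R : ℝ → ℝ) (I : Set ℝ) (ρ : ℝ → ℝ) : Prop :=
  IsViscSuper d R I ρ ∧ IsViscSub d R I ρ

def StrictLocMin2 (f : ℝ × ℝ → ℝ) (p : ℝ × ℝ) : Prop :=
  ∀ᶠ q in 𝓝[≠] p, f p < f q

def StrictLocMax2 (f : ℝ × ℝ → ℝ) (p : ℝ × ℝ) : Prop :=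
  ∀ᶠ q in 𝓝[≠] p, f q < f p

/-- Viscosity super-solution of `min {∂ₜ w + d·(∂ₓ w)² + R (x/t), w} = 0` on `D`. -/
def IsViscSuper2 (d : ℝ) (R : ℝ → ℝ) (D : Set (ℝ × ℝ)) (w : ℝ × ℝ → ℝ) : Prop :=
  LowerSemicontinuousOn w D ∧ (∀ p ∈ D, 0 ≤ w p) ∧
    ∀ φ : ℝ × ℝ → ℝ, ContDiff ℝ 1 φ → ∀ p ∈ D,
      StrictLocMin2 (fun q => w q - φ q) p →
        0 ≤ fderiv ℝ φ p (1, 0) + d * fderiv ℝ φ p (0, 1) ^ 2 + uscEnv R (p.2 / p.1)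

/-- Viscosity sub-solution of `min {∂ₜ w + d·(∂ₓ w)² + R (x/t), w} = 0` on `D`. -/
def IsViscSub2 (d : ℝ) (R : ℝ → ℝ) (D : Set (ℝ × ℝ)) (w : ℝ × ℝ → ℝ) : Prop :=
  UpperSemicontinuousOn w D ∧
    ∀ φ : ℝ × ℝ → ℝ, ContDiff ℝ 1 φ → ∀ p ∈ D,
      StrictLocMax2 (fun q => w q - φ q) p → 0 < w p →
        fderiv ℝ φ p (1, 0) + d * fderiv ℝ φ p (0, 1) ^ 2 + lscEnv R (p.2 / p.1) ≤ 0

/-- `R` is bounded on `(0,∞)` and Lipschitz continuous off a finite set of points. -/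
def BddPiecewiseLipschitz (R : ℝ → ℝ) : Prop :=
  (∃ M, ∀ s, 0 < s → |R s| ≤ M) ∧
    ∃ (F : Finset ℝ) (K : NNReal), ∀ x ∈ Set.Ioi (0 : ℝ) \ (F : Set ℝ),
      ∃ ε > 0, LipschitzOnWith K R (Metric.ball x ε)

theorem aux_A (ρ : ℝ → ℝ) (φ : ℝ × ℝ → ℝ) (hφ : ContDiff ℝ 1 φ) (p : ℝ × ℝ) (hp : 0 < p.1)
    (h : StrictLocMax2 (fun q => q.1 * ρ (q.2 / q.1) - φ q) p) :
    ∃ ψ : ℝ → ℝ, ContDiff ℝ 1 ψ ∧ StrictLocMax (fun s => ρ s - ψ s) (p.2 / p.1) ∧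
      deriv ψ (p.2 / p.1) = fderiv ℝ φ p (0, 1) ∧
      fderiv ℝ φ p (1, 0) = ρ (p.2 / p.1) - p.2 / p.1 * fderiv ℝ φ p (0, 1) := by
  obtain ⟨t₀, x₀⟩ := p
  simp only at hp h ⊢
  have hne : t₀ ≠ 0 := hp.ne'
  have hx : t₀ * (x₀ / t₀) = x₀ := by field_simp
  have hfd : HasFDerivAt φ (fderiv ℝ φ (t₀, x₀)) (t₀, x₀) :=
    (hφ.differentiable (by norm_num) _).hasFDerivAt
  set L := fderiv ℝ φ (t₀, x₀) with hL
  have hLlin : ∀ a b : ℝ, L (a, b) = a * L (1, 0) + b * L (0, 1) := by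
    intro a b
    have : ((a, b) : ℝ × ℝ) = a • (1, 0) + b • (0, 1) := by simp
    rw [this, map_add, map_smul, map_smul]; simp
  have h' := (eventually_nhdsWithin_iff.1 h)
  refine ⟨fun s => φ (t₀, t₀ * s) / t₀, ?_, ?_, ?_, ?_⟩
  · have : ContDiff ℝ 1 (fun s : ℝ => ((t₀, t₀ * s) : ℝ × ℝ)) := by fun_prop
    exact (hφ.comp this).div_const _
  · have ht : Tendsto (fun s : ℝ => ((t₀, t₀ * s) : ℝ × ℝ)) (𝓝 (x₀ / t₀)) (𝓝 (t₀, x₀)) := by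
      have : Continuous (fun s : ℝ => ((t₀, t₀ * s) : ℝ × ℝ)) := by fun_prop
      have h2 := this.tendsto (x₀ / t₀)
      rwa [hx] at h2
    refine eventually_nhdsWithin_iff.2 ((ht.eventually h').mono ?_)
    intro s hs hsne
    have hne2 : ((t₀, t₀ * s) : ℝ × ℝ) ∈ ({(t₀, x₀)}ᶜ : Set (ℝ × ℝ)) := by
      intro hh
      apply hsne
      have : t₀ * s = x₀ := (Prod.ext_iff.1 hh).2
      simp only [mem_singleton_iff]
      rw [← this]; field_simp
    have h3 := hs hne2
    have e : t₀ * s / t₀ = s := by field_simp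
    simp only [e] at h3
    simp only [hx]
    have e1 : ρ s - φ (t₀, t₀ * s) / t₀ = (t₀ * ρ s - φ (t₀, t₀ * s)) / t₀ := by field_simp
    have e2 : ρ (x₀ / t₀) - φ (t₀, x₀) / t₀ = (t₀ * ρ (x₀ / t₀) - φ (t₀, x₀)) / t₀ := by
      field_simp
    rw [e1, e2]
    exact div_lt_div_of_pos_right h3 hp
  · have hc : HasDerivAt (fun s : ℝ => ((t₀, t₀ * s) : ℝ × ℝ)) (0, t₀) (x₀ / t₀) := by
      have := (hasDerivAt_const (x₀ / t₀) t₀).prodMk ((hasDerivAt_id (x₀ / t₀)).const_mul t₀)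
      simpa using this
    have hfd' : HasFDerivAt φ L (t₀, t₀ * (x₀ / t₀)) := by rw [hx]; exact hfd
    have := ((hfd'.comp_hasDerivAt (x₀ / t₀) hc).div_const t₀).deriv
    rw [hLlin 0 t₀] at this
    simp only [Function.comp_def] at this
    rw [this]; field_simp; ring
  · have hc : HasDerivAt (fun t : ℝ => ((t, t * (x₀ / t₀)) : ℝ × ℝ)) (1, x₀ / t₀) t₀ := by
      have := (hasDerivAt_id t₀).prodMk ((hasDerivAt_id t₀).mul_const (x₀ / t₀))
      simpa using this
    have hfd' : HasFDerivAt φ L (t₀, t₀ * (x₀ / t₀)) := by rw [hx]; exact hfd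
    have hd := ((hasDerivAt_id t₀).mul_const (ρ (x₀ / t₀))).sub (hfd'.comp_hasDerivAt t₀ hc)
    have ht : Tendsto (fun t : ℝ => ((t, t * (x₀ / t₀)) : ℝ × ℝ)) (𝓝 t₀) (𝓝 (t₀, x₀)) := by
      have h2 := hc.continuousAt.tendsto
      rwa [hx] at h2
    have hmax : IsLocalMax (fun t : ℝ => t * ρ (x₀ / t₀) - φ (t, t * (x₀ / t₀))) t₀ := by
      filter_upwards [ht.eventually h', lt_mem_nhds hp] with t h1 ht0
      by_cases hte : t = t₀
      · rw [hte]
      · have h3 := h1 (by intro hh; exact hte (Prod.ext_iff.1 hh).1)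
        have e : t * (x₀ / t₀) / t = x₀ / t₀ := by field_simp
        simp only [e] at h3
        simp only [hx]
        exact h3.le
    have := hmax.hasDerivAt_eq_zero hd
    rw [hLlin] at this
    linarith

theorem aux_B (ρ ψ : ℝ → ℝ) (hψ : ContDiff ℝ 1 ψ) (s₀ : ℝ)
    (h : StrictLocMax (fun s => ρ s - ψ s) s₀) :
    ∃ φ : ℝ × ℝ → ℝ, ContDiff ℝ 1 φ ∧
      StrictLocMax2 (fun q => q.1 * ρ (q.2 / q.1) - φ q) (1, s₀) ∧
      fderiv ℝ φ (1, s₀) (0, 1) = deriv ψ s₀ ∧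
      fderiv ℝ φ (1, s₀) (1, 0) = ρ s₀ - s₀ * deriv ψ s₀ := by
  let f : ContDiffBump (1 : ℝ) := ⟨1/4, 1/2, by norm_num, by norm_num⟩
  obtain ⟨g, hgC, hgpos, hgeq⟩ : ∃ g : ℝ → ℝ, ContDiff ℝ 1 g ∧ (∀ t, g t ≠ 0) ∧
      g =ᶠ[𝓝 1] id := by
    refine ⟨fun t => 1 + f t * (t - 1), ?_, ?_, ?_⟩
    · have : ContDiff ℝ 1 f := f.contDiff
      fun_prop
    · intro t
      by_cases ht : t ∈ Metric.ball (1:ℝ) (1/2)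
      · rw [Metric.mem_ball, Real.dist_eq, abs_lt] at ht
        have h0 : 0 ≤ f t := f.nonneg
        have h1 : f t ≤ 1 := f.le_one
        have : 0 < 1 + f t * (t - 1) := by nlinarith [ht.1]
        exact this.ne'
      · have : f t = 0 := by
          apply f.zero_of_le_dist
          simpa [Metric.mem_ball, f] using ht
        simp [this]
    · filter_upwards [f.eventuallyEq_one] with t ht
      simp [ht]
  have hg1 : g 1 = 1 := hgeq.eq_of_nhds
  have hgd : HasDerivAt g 1 1 := (hasDerivAt_id (1:ℝ)).congr_of_eventuallyEq hgeq
  set c := ρ s₀ - ψ s₀ with hc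
  let φ : ℝ × ℝ → ℝ := fun q => q.1 * ψ (q.2 / g q.1) + c * q.1 + (q.1 - 1) ^ 2
  have hφ : ContDiff ℝ 1 φ := by
    have h1 : ContDiff ℝ 1 (fun q : ℝ × ℝ => q.2 / g q.1) :=
      contDiff_snd.div (hgC.comp contDiff_fst) (fun q => hgpos _)
    have h2 : ContDiff ℝ 1 (fun q : ℝ × ℝ => ψ (q.2 / g q.1)) := hψ.comp h1
    simp only [φ]
    fun_prop
  have hfd : HasFDerivAt φ (fderiv ℝ φ (1, s₀)) (1, s₀) :=
    (hφ.differentiable (by norm_num) _).hasFDerivAt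
  have hψd : HasDerivAt ψ (deriv ψ s₀) (s₀ / g 1) := by
    rw [hg1, div_one]; exact (hψ.differentiable (by norm_num) _).hasDerivAt
  refine ⟨φ, hφ, ?_, ?_, ?_⟩
  · have ht : Tendsto (fun q : ℝ × ℝ => q.2 / q.1) (𝓝 (1, s₀)) (𝓝 s₀) := by
      have : ContinuousAt (fun q : ℝ × ℝ => q.2 / q.1) (1, s₀) :=
        continuousAt_snd.div continuousAt_fst (by simp)
      simpa [ContinuousAt] using this
    have ht1 : Tendsto (fun q : ℝ × ℝ => q.1) (𝓝 (1, s₀)) (𝓝 1) := continuousAt_fst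
    refine eventually_nhdsWithin_iff.2 ?_
    filter_upwards [ht.eventually (eventually_nhdsWithin_iff.1 h), ht1.eventually hgeq,
      ht1.eventually (lt_mem_nhds one_pos)] with q h1 h2 h3 hq
    simp only [φ, h2, hg1, id, div_one]
    have hsq := sq_nonneg (q.1 - 1)
    by_cases hs : q.2 / q.1 = s₀
    · rw [hs]
      have hq1 : q.1 - 1 ≠ 0 := by
        intro h4
        apply hq
        have h5 : q.1 = 1 := by linarith
        rw [h5, div_one] at hs
        exact Prod.ext h5 hs
      have : 0 < (q.1 - 1) ^ 2 := by positivity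
      rw [hc]; nlinarith
    · have h4 := h1 hs
      have := mul_pos h3 (sub_pos.2 h4)
      rw [hc]; nlinarith
  · have hcur : HasDerivAt (fun x : ℝ => ((1, x) : ℝ × ℝ)) (0, 1) s₀ :=
      (hasDerivAt_const s₀ (1:ℝ)).prodMk (hasDerivAt_id s₀)
    have h1 := hfd.comp_hasDerivAt s₀ hcur
    have h2 : HasDerivAt (fun x : ℝ => 1 * ψ (x / g 1) + c * 1 + (1 - 1) ^ 2)
        (1 * (deriv ψ s₀ * (1 / g 1))) s₀ :=
      (((hψd.comp s₀ ((hasDerivAt_id s₀).div_const (g 1))).const_mul 1).add_const _).add_const _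
    have := h1.unique h2
    rw [this, hg1]; ring
  · have hcur : HasDerivAt (fun t : ℝ => ((t, s₀) : ℝ × ℝ)) (1, 0) 1 :=
      (hasDerivAt_id (1:ℝ)).prodMk (hasDerivAt_const (1:ℝ) s₀)
    have h1 := hfd.comp_hasDerivAt 1 hcur
    have hq : HasDerivAt (fun t : ℝ => s₀ / g t) ((0 * g 1 - s₀ * 1) / g 1 ^ 2) 1 :=
      (hasDerivAt_const (1:ℝ) s₀).div hgd (hgpos 1)
    have h2 := (((hasDerivAt_id (1:ℝ)).mul (hψd.comp 1 hq)).add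
      ((hasDerivAt_id (1:ℝ)).const_mul c)).add (((hasDerivAt_id (1:ℝ)).sub_const 1).pow 2)
    have := h1.unique h2
    rw [this]; simp [hg1, hc]; ring

theorem max_neg_iff (f : ℝ → ℝ) (s : ℝ) : StrictLocMax (fun x => - f x) s ↔ StrictLocMin f s := by
  simp [StrictLocMax, StrictLocMin]

theorem max2_neg_iff (f : ℝ × ℝ → ℝ) (s : ℝ × ℝ) :
    StrictLocMax2 (fun x => - f x) s ↔ StrictLocMin2 f s := by
  simp [StrictLocMax2, StrictLocMin2]

theorem aux_A' (ρ : ℝ → ℝ) (φ : ℝ × ℝ → ℝ) (hφ : ContDiff ℝ 1 φ) (p : ℝ × ℝ) (hp : 0 < p.1)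
    (h : StrictLocMin2 (fun q => q.1 * ρ (q.2 / q.1) - φ q) p) :
    ∃ ψ : ℝ → ℝ, ContDiff ℝ 1 ψ ∧ StrictLocMin (fun s => ρ s - ψ s) (p.2 / p.1) ∧
      deriv ψ (p.2 / p.1) = fderiv ℝ φ p (0, 1) ∧
      fderiv ℝ φ p (1, 0) = ρ (p.2 / p.1) - p.2 / p.1 * fderiv ℝ φ p (0, 1) := by
  rw [← max2_neg_iff] at h
  obtain ⟨ψ, h1, h2, h3, h4⟩ := aux_A (fun s => - ρ s) (fun q => - φ q) hφ.neg p hp (by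
    convert h using 2; ring)
  rw [fderiv_fun_neg] at h3 h4
  simp only [ContinuousLinearMap.neg_apply] at h3 h4
  refine ⟨fun s => - ψ s, h1.neg, ?_, ?_, ?_⟩
  · rw [← max_neg_iff]; convert h2 using 2; ring
  · rw [deriv.fun_neg, h3]; ring
  · linarith

theorem aux_B' (ρ ψ : ℝ → ℝ) (hψ : ContDiff ℝ 1 ψ) (s₀ : ℝ)
    (h : StrictLocMin (fun s => ρ s - ψ s) s₀) :
    ∃ φ : ℝ × ℝ → ℝ, ContDiff ℝ 1 φ ∧
      StrictLocMin2 (fun q => q.1 * ρ (q.2 / q.1) - φ q) (1, s₀) ∧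
      fderiv ℝ φ (1, s₀) (0, 1) = deriv ψ s₀ ∧
      fderiv ℝ φ (1, s₀) (1, 0) = ρ s₀ - s₀ * deriv ψ s₀ := by
  rw [← max_neg_iff] at h
  obtain ⟨φ, h1, h2, h3, h4⟩ := aux_B (fun s => - ρ s) (fun q => - ψ q) hψ.neg s₀ (by
    convert h using 2; ring)
  rw [deriv.fun_neg] at h3 h4
  refine ⟨fun s => - φ s, h1.neg, ?_, ?_, ?_⟩
  · rw [← max2_neg_iff]; convert h2 using 2; ring
  · rw [fderiv_fun_neg, ContinuousLinearMap.neg_apply, h3]; ring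
  · rw [fderiv_fun_neg, ContinuousLinearMap.neg_apply, h4]; ring

theorem aux_lsc (cb : EReal) (ρ : ℝ → ℝ) :
    LowerSemicontinuousOn ρ {s : ℝ | 0 < s ∧ (s : EReal) < cb} ↔
    LowerSemicontinuousOn (fun p : ℝ × ℝ => p.1 * ρ (p.2 / p.1))
      {p : ℝ × ℝ | 0 < p.1 ∧ 0 < p.2 ∧ ((p.2 / p.1 : ℝ) : EReal) < cb} := by
  constructor
  · rintro h ⟨t, x⟩ ⟨ht, hx, hc⟩ y hy
    simp only at ht hx hc hy
    have hy' : y / t < ρ (x / t) := by rw [div_lt_iff₀ ht]; linarith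
    obtain ⟨z, hz1, hz2⟩ := exists_between hy'
    have h1 := h (x / t) ⟨div_pos hx ht, hc⟩ z hz2
    have hcont : ContinuousAt (fun q : ℝ × ℝ => q.2 / q.1) (t, x) :=
      continuousAt_snd.div continuousAt_fst ht.ne'
    have hcont2 : ContinuousAt (fun q : ℝ × ℝ => y / q.1) (t, x) :=
      continuousAt_const.div continuousAt_fst ht.ne'
    rw [eventually_nhdsWithin_iff] at h1 ⊢
    filter_upwards [hcont.tendsto.eventually h1, hcont2.tendsto.eventually (gt_mem_nhds hz1)]
      with q hq1 hq2 hq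
    have h3 := hq1 ⟨div_pos hq.2.1 hq.1, hq.2.2⟩
    have h4 := hq2.trans h3
    rw [div_lt_iff₀ hq.1] at h4
    linarith
  · rintro h s ⟨hs, hc⟩ y hy
    have h1 := h (1, s) ⟨one_pos, hs, by simpa using hc⟩ y (by simpa using hy)
    have hcont : Continuous (fun s : ℝ => ((1, s) : ℝ × ℝ)) := by fun_prop
    rw [eventually_nhdsWithin_iff] at h1 ⊢
    filter_upwards [(hcont.tendsto s).eventually h1] with q hq1 hq
    have := hq1 ⟨one_pos, hq.1, by simpa using hq.2⟩
    simpa using this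

theorem aux_usc (cb : EReal) (ρ : ℝ → ℝ) :
    UpperSemicontinuousOn ρ {s : ℝ | 0 < s ∧ (s : EReal) < cb} ↔
    UpperSemicontinuousOn (fun p : ℝ × ℝ => p.1 * ρ (p.2 / p.1))
      {p : ℝ × ℝ | 0 < p.1 ∧ 0 < p.2 ∧ ((p.2 / p.1 : ℝ) : EReal) < cb} := by
  constructor
  · rintro h ⟨t, x⟩ ⟨ht, hx, hc⟩ y hy
    simp only at ht hx hc hy
    have hy' : ρ (x / t) < y / t := by rw [lt_div_iff₀ ht]; linarith
    obtain ⟨z, hz1, hz2⟩ := exists_between hy'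
    have h1 := h (x / t) ⟨div_pos hx ht, hc⟩ z hz1
    have hcont : ContinuousAt (fun q : ℝ × ℝ => q.2 / q.1) (t, x) :=
      continuousAt_snd.div continuousAt_fst ht.ne'
    have hcont2 : ContinuousAt (fun q : ℝ × ℝ => y / q.1) (t, x) :=
      continuousAt_const.div continuousAt_fst ht.ne'
    rw [eventually_nhdsWithin_iff] at h1 ⊢
    filter_upwards [hcont.tendsto.eventually h1, hcont2.tendsto.eventually (lt_mem_nhds hz2)]
      with q hq1 hq2 hq
    have h3 := hq1 ⟨div_pos hq.2.1 hq.1, hq.2.2⟩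
    have h4 := h3.trans hq2
    rw [lt_div_iff₀ hq.1] at h4
    linarith
  · rintro h s ⟨hs, hc⟩ y hy
    have h1 := h (1, s) ⟨one_pos, hs, by simpa using hc⟩ y (by simpa using hy)
    have hcont : Continuous (fun s : ℝ => ((1, s) : ℝ × ℝ)) := by fun_prop
    rw [eventually_nhdsWithin_iff] at h1 ⊢
    filter_upwards [(hcont.tendsto s).eventually h1] with q hq1 hq
    have := hq1 ⟨one_pos, hq.1, by simpa using hq.2⟩
    simpa using this

theorem cone_reduction_equivalence (d : ℝ) (hd : 0 < d)
    (R : ℝ → ℝ) (hR : BddPiecewiseLipschitz R)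
    (cb : EReal) (hcb : 0 < cb) (ρ : ℝ → ℝ) :
    (IsViscSub d R {s : ℝ | 0 < s ∧ (s : EReal) < cb} ρ ↔
      IsViscSub2 d R {p : ℝ × ℝ | 0 < p.1 ∧ 0 < p.2 ∧ ((p.2 / p.1 : ℝ) : EReal) < cb}
        (fun p => p.1 * ρ (p.2 / p.1))) ∧
    (IsViscSuper d R {s : ℝ | 0 < s ∧ (s : EReal) < cb} ρ ↔
      IsViscSuper2 d R {p : ℝ × ℝ | 0 < p.1 ∧ 0 < p.2 ∧ ((p.2 / p.1 : ℝ) : EReal) < cb}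
        (fun p => p.1 * ρ (p.2 / p.1))) := by
  refine ⟨and_congr (aux_usc cb ρ) ⟨?_, ?_⟩, and_congr (aux_lsc cb ρ) (and_congr ⟨?_, ?_⟩ ⟨?_, ?_⟩)⟩
  · intro H φ hφ p hp hmax hpos
    obtain ⟨ψ, h1, h2, h3, h4⟩ := aux_A ρ φ hφ p hp.1 hmax
    have := H ψ h1 (p.2 / p.1) ⟨div_pos hp.2.1 hp.1, hp.2.2⟩ h2
      ((mul_pos_iff_of_pos_left hp.1).1 hpos)
    rw [h3] at this
    rw [h4]; exact this
  · intro H ψ hψ s hs hmax hpos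
    obtain ⟨φ, h1, h2, h3, h4⟩ := aux_B ρ ψ hψ s hmax
    have := H φ h1 (1, s) ⟨one_pos, hs.1, by simpa using hs.2⟩ h2 (by simpa using hpos)
    rw [h3, h4] at this
    simpa using this
  · intro H p hp
    exact mul_nonneg hp.1.le (H _ ⟨div_pos hp.2.1 hp.1, hp.2.2⟩)
  · intro H s hs
    simpa using H (1, s) ⟨one_pos, hs.1, by simpa using hs.2⟩
  · intro H φ hφ p hp hmax
    obtain ⟨ψ, h1, h2, h3, h4⟩ := aux_A' ρ φ hφ p hp.1 hmax
    have := H ψ h1 (p.2 / p.1) ⟨div_pos hp.2.1 hp.1, hp.2.2⟩ h2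
    rw [h3] at this
    rw [h4]; exact this
  · intro H ψ hψ s hs hmax
    obtain ⟨φ, h1, h2, h3, h4⟩ := aux_B' ρ ψ hψ s hmax
    have := H φ h1 (1, s) ⟨one_pos, hs.1, by simpa using hs.2⟩ h2
    rw [h3, h4] at this
    simpa using this
end
end

section
/- In the setting of the μ-problem: (i) if 0 ≤ μ₁ ≤ μ₂ ≤ 1 and ρ^{μ₁}, ρ^{μ₂} are solutions of the μ₁- and μ₂-problems respectively (with the same λ), then 0 ≤ ρ^{μ₂}(s) − ρ^{μ₁}(s) ≤ r₃·a₃₁·(μ₂ − μ₁) for every s ≥ 0; (ii) every solution ρ^μ of a μ-problem is non-decreasing on [0,∞); (iii) for every μ ∈ [0,1] and every solution ρ^μ of the μ-problem, the zero set {s ≥ 0 : ρ^μ(s) = 0} equals the interval [0, s₀] for some s₀ ≥ 2√(d₃r₃(1 − a₃₁ − a₃₂)). -/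
open Filter Set Topology

noncomputable section

/-- A solution of the `μ`-problem: continuous viscosity solution on `(0,∞)` of the
variational inequality with `R^μ(s) = r₃(1 - μ·a₃₁·1_{(c₂,c₁]}(s) - a₃₂·1_{(0,c₂]}(s))`,
vanishing at `0` with linear growth rate `lam` at infinity. -/
def MuSol (d3 r3 a31 a32 c1 c2 lam mu : ℝ) (ρ : ℝ → ℝ) : Prop :=
  ContinuousOn ρ (Set.Ici 0) ∧
    IsViscSol d3
      (fun s => r3 * (1 - mu * a31 * (if c2 < s ∧ s ≤ c1 then 1 else 0)
        - a32 * (if 0 < s ∧ s ≤ c2 then 1 else 0))) (Set.Ioi 0) ρ ∧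
    ρ 0 = 0 ∧ Filter.Tendsto (fun s => ρ s / s) Filter.atTop (𝓝 lam)

lemma sub_test {d : ℝ} {R : ℝ → ℝ} {ρ φ : ℝ → ℝ} {s p : ℝ}
    (h : IsViscSub d R (Set.Ioi 0) ρ) (hs : 0 < s) (hφ : ContDiff ℝ 1 φ)
    (hp : HasDerivAt φ p s) (hmax : ∀ᶠ x in 𝓝 s, ρ x - φ x ≤ ρ s - φ s) (hpos : 0 < ρ s) :
    ρ s - s * p + d * p ^ 2 + lscEnv R s ≤ 0 := by
  have hd : HasDerivAt (fun x => φ x + (x - s) ^ 2) p s := by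
    have h1 : HasDerivAt (fun x : ℝ => (x - s) ^ 2) (2 * (s - s)) s := by
      exact (((hasDerivAt_id s).sub_const s).pow 2).congr_deriv (by simp)
    exact (hp.add h1).congr_deriv (by simp)
  have := h.2 (fun x => φ x + (x - s) ^ 2) (by fun_prop) s hs ?_ hpos
  · rw [hd.deriv] at this
    exact this
  · unfold StrictLocMax
    filter_upwards [nhdsWithin_le_nhds hmax, self_mem_nhdsWithin] with x hx hne
    have : 0 < (x - s) ^ 2 := by
      have : x - s ≠ 0 := sub_ne_zero.2 hne
      positivity
    simp only [sub_self]
    nlinarith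

lemma super_test {d : ℝ} {R : ℝ → ℝ} {ρ φ : ℝ → ℝ} {s p : ℝ}
    (h : IsViscSuper d R (Set.Ioi 0) ρ) (hs : 0 < s) (hφ : ContDiff ℝ 1 φ)
    (hp : HasDerivAt φ p s) (hmin : ∀ᶠ x in 𝓝 s, ρ s - φ s ≤ ρ x - φ x) :
    0 ≤ ρ s - s * p + d * p ^ 2 + uscEnv R s := by
  have hd : HasDerivAt (fun x => φ x - (x - s) ^ 2) p s := by
    have h1 : HasDerivAt (fun x : ℝ => (x - s) ^ 2) (2 * (s - s)) s := by
      exact (((hasDerivAt_id s).sub_const s).pow 2).congr_deriv (by simp)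
    exact (hp.sub h1).congr_deriv (by simp)
  have := h.2.2 (fun x => φ x - (x - s) ^ 2) (by fun_prop) s hs ?_
  · rw [hd.deriv] at this
    exact this
  · unfold StrictLocMin
    filter_upwards [nhdsWithin_le_nhds hmin, self_mem_nhdsWithin] with x hx hne
    have : 0 < (x - s) ^ 2 := by
      have : x - s ≠ 0 := sub_ne_zero.2 hne
      positivity
    simp only [sub_self]
    nlinarith

lemma usc_le {R : ℝ → ℝ} {r m : ℝ} (h : ∀ s, R s ≤ r) (h' : ∀ s, m ≤ R s) (s : ℝ) :
    uscEnv R s ≤ r :=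
  Filter.limsup_le_of_le (Filter.IsBoundedUnder.isCoboundedUnder_le ⟨m, by simp [h']⟩) (by simp [h])

lemma le_lsc {R : ℝ → ℝ} {r m : ℝ} (h : ∀ s, R s ≤ r) (h' : ∀ s, m ≤ R s) (s : ℝ) :
    m ≤ lscEnv R s :=
  Filter.le_liminf_of_le (Filter.IsBoundedUnder.isCoboundedUnder_ge ⟨r, by simp [h]⟩) (by simp [h'])

lemma env_le {R1 R2 : ℝ → ℝ} {r m K x y : ℝ}
    (h1 : ∀ s, R1 s ≤ r) (h2 : ∀ s, m ≤ R2 s)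
    {U V : Set ℝ} (hU : U ∈ 𝓝 x) (hV : V ∈ 𝓝 y) (h : ∀ a ∈ U, ∀ b ∈ V, R2 b ≤ R1 a + K) :
    uscEnv R2 y ≤ lscEnv R1 x + K := by
  have : uscEnv R2 y - K ≤ lscEnv R1 x := by
    refine Filter.le_liminf_of_le (Filter.IsBoundedUnder.isCoboundedUnder_ge ⟨r, by simp [h1]⟩) ?_
    filter_upwards [hU] with a ha
    have : uscEnv R2 y ≤ R1 a + K := by
      refine Filter.limsup_le_of_le (Filter.IsBoundedUnder.isCoboundedUnder_le ⟨m, by simp [h2]⟩) ?_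
      filter_upwards [hV] with b hb using h a ha b hb
    linarith
  linarith

/-- The one-sided compatibility at jump points. -/
def Compat (R1 R2 : ℝ → ℝ) (K : ℝ) : Prop :=
  ∀ c : ℝ, 0 < c → ∃ σ : ℝ, σ ^ 2 = 1 ∧ ∃ U ∈ 𝓝 c, ∀ x ∈ U, ∀ y ∈ U, 0 < σ * (x - y) →
    uscEnv R2 y ≤ lscEnv R1 x + K

lemma compat_of_mono {R1 R2 : ℝ → ℝ} {r m K : ℝ} (h1 : ∀ s, R1 s ≤ r) (h2 : ∀ s, m ≤ R2 s)
    (h12 : ∀ s, R2 s ≤ R1 s + K)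
    (hm : ∀ c : ℝ, 0 < c → ∃ U : Set ℝ, IsOpen U ∧ c ∈ U ∧ (MonotoneOn R1 U ∨ AntitoneOn R1 U)) :
    Compat R1 R2 K := by
  intro c hc
  obtain ⟨U, hUo, hcU, hU⟩ := hm c hc
  rcases hU with hU | hU
  · refine ⟨1, by norm_num, U, hUo.mem_nhds hcU, fun x hx y hy hxy => ?_⟩
    have hxy : y < x := by linarith
    have hq : (x + y) / 2 < x ∧ y < (x + y) / 2 := by constructor <;> linarith
    refine env_le h1 h2 (inter_mem (hUo.mem_nhds hx) (Ioi_mem_nhds hq.1))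
      (inter_mem (hUo.mem_nhds hy) (Iio_mem_nhds hq.2)) ?_
    rintro a ⟨haU, ha⟩ b ⟨hbU, hb⟩
    have := hU hbU haU (le_of_lt (lt_trans hb ha))
    linarith [h12 b]
  · refine ⟨-1, by norm_num, U, hUo.mem_nhds hcU, fun x hx y hy hxy => ?_⟩
    have hxy : x < y := by linarith
    have hq : x < (x + y) / 2 ∧ (x + y) / 2 < y := by constructor <;> linarith
    refine env_le h1 h2 (inter_mem (hUo.mem_nhds hx) (Iio_mem_nhds hq.1))
      (inter_mem (hUo.mem_nhds hy) (Ioi_mem_nhds hq.2)) ?_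
    rintro a ⟨haU, ha⟩ b ⟨hbU, hb⟩
    have := hU haU hbU (le_of_lt (lt_trans ha hb))
    linarith [h12 b]

/-- Key inequality at a doubled maximum point. -/
lemma doubled {d r K α sb σ ε η x y : ℝ} {R1 R2 ρ1 ρ2 : ℝ → ℝ} (hd : 0 < d) (hα : 1 < α)
    (hε : 0 < ε)
    (h1 : IsViscSub d R1 (Set.Ioi 0) ρ1) (h2 : IsViscSuper d R2 (Set.Ioi 0) ρ2)
    (hx0 : 0 < x) (hy0 : 0 < y) (hpos : 0 < ρ1 x)
    (hx : x ∈ Ioo (sb - η) (sb + η)) (hy : y ∈ Ioo (sb - η) (sb + η))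
    (hmax : ∀ a ∈ Icc (sb - η) (sb + η), ∀ b ∈ Icc (sb - η) (sb + η),
      ρ1 a - α * ρ2 b - ((a - b) / ε - σ) ^ 2 - (a - sb) ^ 2 ≤
      ρ1 x - α * ρ2 y - ((x - y) / ε - σ) ^ 2 - (x - sb) ^ 2)
    (hr : uscEnv R2 y ≤ r) (hR : uscEnv R2 y ≤ lscEnv R1 x + K) :
    ρ1 x - α * ρ2 y ≤ ((x - y) / ε) * (2 * ((x - y) / ε - σ)) + x * (2 * (x - sb))
      + d * (2 * (x - sb)) ^ 2 / (α - 1) + (α - 1) * r + K := by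
  have hxI := Ioo_subset_Icc_self hx
  have hyI := Ioo_subset_Icc_self hy
  set p := 2 * ((x - y) / ε - σ) / ε with hp
  set e := 2 * (x - sb) with he
  have A := sub_test (φ := fun a => ((a - y) / ε - σ) ^ 2 + (a - sb) ^ 2) (p := p + e) h1 hx0
    (by fun_prop) (by
      have h1 := ((((hasDerivAt_id x).sub_const y).div_const ε).sub_const σ).pow 2
      have h2 := ((hasDerivAt_id x).sub_const sb).pow 2
      exact (h1.add h2).congr_deriv (by simp [hp, he]; ring)) (by
      filter_upwards [Ioo_mem_nhds hx.1 hx.2] with a ha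
      have := hmax a (Ioo_subset_Icc_self ha) y hyI
      linarith) hpos
  have B := super_test (φ := fun b => -(((x - b) / ε - σ) ^ 2) / α) (p := p / α) h2 hy0
    (by fun_prop) (by
      have h1 := (((((hasDerivAt_id y).const_sub x).div_const ε).sub_const σ).pow 2).neg.div_const α
      exact h1.congr_deriv (by simp [hp]; ring)) (by
      filter_upwards [Ioo_mem_nhds hy.1 hy.2] with b hb
      have := hmax x hxI b (Ioo_subset_Icc_self hb)
      have hα0 : 0 < α := by linarith
      have h3 : α * (ρ2 y - -(((x - y) / ε - σ) ^ 2) / α) ≤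
          α * (ρ2 b - -(((x - b) / ε - σ) ^ 2) / α) := by
        field_simp
        field_simp at this
        linarith
      exact le_of_mul_le_mul_left h3 hα0)
  have hα0 : 0 < α := by linarith
  have B' : 0 ≤ α * ρ2 y - y * p + d * (p ^ 2 / α) + α * uscEnv R2 y := by
    have := mul_nonneg hα0.le B
    have e1 : α * (ρ2 y - y * (p / α) + d * (p / α) ^ 2 + uscEnv R2 y) =
      α * ρ2 y - y * p + d * (p ^ 2 / α) + α * uscEnv R2 y := by
      field_simp
    linarith
  have hα1 : 0 < α - 1 := by linarith
  have C : p ^ 2 / α - (p + e) ^ 2 ≤ e ^ 2 / (α - 1) := by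
    have : e ^ 2 / (α - 1) - (p ^ 2 / α - (p + e) ^ 2) =
        ((α - 1) * p + α * e) ^ 2 / (α * (α - 1)) := by
      field_simp; ring
    have h0 : 0 ≤ ((α - 1) * p + α * e) ^ 2 / (α * (α - 1)) := by positivity
    linarith
  have D : (α - 1) * uscEnv R2 y ≤ (α - 1) * r := mul_le_mul_of_nonneg_left hr hα1.le
  have E : (x - y) * p = ((x - y) / ε) * (2 * ((x - y) / ε - σ)) := by
    rw [hp]; field_simp
  have C' := mul_le_mul_of_nonneg_left C hd.le
  have F : d * e ^ 2 / (α - 1) = d * (e ^ 2 / (α - 1)) := by ring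
  rw [← E, F]
  nlinarith

lemma compare_max {d r K α sb : ℝ} {R1 R2 ρ1 ρ2 : ℝ → ℝ} (hd : 0 < d) (hα : 1 < α)
    (hsb : 0 < sb)
    (h1 : IsViscSub d R1 (Set.Ioi 0) ρ1) (h2 : IsViscSuper d R2 (Set.Ioi 0) ρ2)
    (hc1 : ContinuousOn ρ1 (Ici 0)) (hc2 : ContinuousOn ρ2 (Ici 0))
    (hr : ∀ s, uscEnv R2 s ≤ r) (hR : Compat R1 R2 K) (hpos : 0 < ρ1 sb)
    (hmax : ∀ s, 0 ≤ s → ρ1 s - α * ρ2 s ≤ ρ1 sb - α * ρ2 sb) :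
    ρ1 sb - α * ρ2 sb ≤ (α - 1) * r + K := by
  obtain ⟨σ, hσ, U, hU, hcomp⟩ := hR sb hsb
  set η := sb / 2 with hη
  have hη0 : 0 < η := by positivity
  have hσ1 : |σ| = 1 := by
    have := sq_abs σ
    rw [hσ] at this
    have h0 := abs_nonneg σ
    nlinarith
  set B := Icc (sb - η) (sb + η) with hB
  have hB0 : B ⊆ Ici 0 := fun x hx => by
    have := hx.1
    simp only [mem_Ici]
    linarith
  have hsbB : sb ∈ B := ⟨by linarith, by linarith⟩
  have hc1B := hc1.mono hB0
  have hc2B := hc2.mono hB0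
  let ε : ℕ → ℝ := fun n => η / ((n : ℝ) + 1)
  have hε0 : ∀ n, 0 < ε n := fun n => by positivity
  have hεη : ∀ n, ε n ≤ η := fun n => by
    apply div_le_self hη0.le
    have : (0 : ℝ) ≤ n := Nat.cast_nonneg n
    linarith
  have hεt : Tendsto ε atTop (𝓝 0) := by
    have := (tendsto_one_div_add_atTop_nhds_zero_nat (𝕜 := ℝ)).const_mul η
    simpa [ε, div_eq_mul_inv] using this
  have hex : ∀ n : ℕ, ∃ z : ℝ × ℝ, z ∈ B ×ˢ B ∧ ∀ a ∈ B, ∀ b ∈ B,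
      ρ1 a - α * ρ2 b - ((a - b) / ε n - σ) ^ 2 - (a - sb) ^ 2 ≤
      ρ1 z.1 - α * ρ2 z.2 - ((z.1 - z.2) / ε n - σ) ^ 2 - (z.1 - sb) ^ 2 := by
    intro n
    have hcont : ContinuousOn (fun z : ℝ × ℝ =>
        ρ1 z.1 - α * ρ2 z.2 - ((z.1 - z.2) / ε n - σ) ^ 2 - (z.1 - sb) ^ 2) (B ×ˢ B) := by
      have e1 : ContinuousOn (fun z : ℝ × ℝ => ρ1 z.1) (B ×ˢ B) :=
        hc1B.comp continuousOn_fst (fun z hz => hz.1)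
      have e2 : ContinuousOn (fun z : ℝ × ℝ => ρ2 z.2) (B ×ˢ B) :=
        hc2B.comp continuousOn_snd (fun z hz => hz.2)
      have e3 : Continuous (fun z : ℝ × ℝ => ((z.1 - z.2) / ε n - σ) ^ 2) := by fun_prop
      have e4 : Continuous (fun z : ℝ × ℝ => (z.1 - sb) ^ 2) := by fun_prop
      exact ((e1.sub (continuousOn_const.mul e2)).sub e3.continuousOn).sub e4.continuousOn
    obtain ⟨z, hz, hzm⟩ := (isCompact_Icc.prod isCompact_Icc).exists_isMaxOn
      ⟨(sb, sb), hsbB, hsbB⟩ hcont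
    exact ⟨z, hz, fun a ha b hb => hzm (show (a, b) ∈ B ×ˢ B from ⟨ha, hb⟩)⟩
  choose z hzB hz using hex
  let x : ℕ → ℝ := fun n => (z n).1
  let y : ℕ → ℝ := fun n => (z n).2
  let t : ℕ → ℝ := fun n => (x n - y n) / ε n
  have hxB : ∀ n, x n ∈ B := fun n => (hzB n).1
  have hyB : ∀ n, y n ∈ B := fun n => (hzB n).2
  have hshift : ∀ n, sb + σ * ε n ∈ B := fun n => by
    have : |σ * ε n| ≤ η := by rw [abs_mul, hσ1, abs_of_pos (hε0 n), one_mul]; exact hεη n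
    have := abs_le.1 this
    exact ⟨by linarith, by linarith⟩
  -- the basic estimate
  have hbase : ∀ n, (t n - σ) ^ 2 + (x n - sb) ^ 2 ≤
      (ρ1 (x n) - ρ1 (sb + σ * ε n)) - α * (ρ2 (y n) - ρ2 sb) + (ε n) ^ 2 := fun n => by
    have := hz n (sb + σ * ε n) (hshift n) sb hsbB
    have e1 : (sb + σ * ε n - sb) / ε n - σ = 0 := by
      have := (hε0 n).ne'
      field_simp; ring
    have e2 : (sb + σ * ε n - sb) ^ 2 = (ε n) ^ 2 := by
      have : (sb + σ * ε n - sb) ^ 2 = σ ^ 2 * ε n ^ 2 := by ring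
      rw [this, hσ, one_mul]
    rw [e1, e2] at this
    simp only [t, x, y]
    linarith
  obtain ⟨M1, hM1⟩ := (isCompact_Icc.exists_bound_of_continuousOn hc1B)
  obtain ⟨M2, hM2⟩ := (isCompact_Icc.exists_bound_of_continuousOn hc2B)
  simp only [Real.norm_eq_abs] at hM1 hM2
  have htb : ∃ T, ∀ n, |t n| ≤ T := by
    refine ⟨2 * M1 + α * (2 * M2) + η ^ 2 + 2, fun n => ?_⟩
    have b1 := abs_le.1 (hM1 _ (hxB n))
    have b2 := abs_le.1 (hM1 _ (hshift n))
    have b3 := abs_le.1 (hM2 _ (hyB n))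
    have b4 := abs_le.1 (hM2 _ hsbB)
    have b5 : ε n ^ 2 ≤ η ^ 2 := by
      have := hε0 n; have := hεη n; gcongr
    have b6 : -(α * (ρ2 (y n) - ρ2 sb)) ≤ α * (2 * M2) := by
      have : α * (-(ρ2 (y n) - ρ2 sb)) ≤ α * (2 * M2) :=
        mul_le_mul_of_nonneg_left (by linarith) (by linarith)
      linarith
    have b7 : (t n - σ) ^ 2 ≤ 2 * M1 + α * (2 * M2) + η ^ 2 := by
      have := hbase n
      nlinarith [sq_nonneg (x n - sb)]
    have b8 : |t n - σ| ≤ (t n - σ) ^ 2 + 1 := by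
      rw [← sq_abs]; nlinarith [sq_nonneg (|t n - σ| - 1)]
    have b9 : |t n| ≤ |t n - σ| + |σ| := by
      have := abs_add_le (t n - σ) σ
      simpa using this
    linarith
  obtain ⟨T, hT⟩ := htb
  have hxyt : ∀ n, x n - y n = t n * ε n := fun n => by
    have := (hε0 n).ne'
    simp only [t]; field_simp
  have hxy0 : Tendsto (fun n => x n - y n) atTop (𝓝 0) := by
    apply squeeze_zero_norm (a := fun n => T * ε n)
    · intro n
      rw [hxyt, Real.norm_eq_abs, abs_mul, abs_of_pos (hε0 n)]
      exact mul_le_mul_of_nonneg_right (hT n) (hε0 n).le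
    · simpa using hεt.const_mul T
  have huc : Tendsto (fun n => ρ1 (x n) - ρ1 (y n)) atTop (𝓝 0) := by
    have hu := isCompact_Icc.uniformContinuousOn_of_continuous hc1B
    rw [Metric.uniformContinuousOn_iff] at hu
    rw [Metric.tendsto_atTop] at hxy0 ⊢
    intro e he
    obtain ⟨δ, hδ, hu⟩ := hu e he
    obtain ⟨N, hN⟩ := hxy0 δ hδ
    refine ⟨N, fun n hn => ?_⟩
    have := hN n hn
    have := hu (x n) (hxB n) (y n) (hyB n) (by simpa [Real.dist_eq] using this)
    simpa [Real.dist_eq] using this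
  have hc1sb : ContinuousAt ρ1 sb := hc1.continuousAt (Ici_mem_nhds hsb)
  have hc2sb : ContinuousAt ρ2 sb := hc2.continuousAt (Ici_mem_nhds hsb)
  have hsh : Tendsto (fun n => ρ1 (sb + σ * ε n)) atTop (𝓝 (ρ1 sb)) := by
    apply hc1sb.tendsto.comp
    have := (hεt.const_mul σ).const_add sb
    simpa using this
  have hbase2 : ∀ n, (t n - σ) ^ 2 + (x n - sb) ^ 2 ≤
      (ρ1 (x n) - ρ1 (y n)) + (ρ1 sb - ρ1 (sb + σ * ε n)) + (ε n) ^ 2 := fun n => by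
    have := hbase n
    have := hmax (y n) (hB0 (hyB n))
    linarith
  have hlim : Tendsto (fun n => (ρ1 (x n) - ρ1 (y n)) + (ρ1 sb - ρ1 (sb + σ * ε n)) + (ε n) ^ 2)
      atTop (𝓝 0) := by
    have := (huc.add (hsh.const_sub (ρ1 sb))).add (hεt.pow 2)
    simpa using this
  have hsq : ∀ u : ℕ → ℝ, Tendsto (fun n => (u n) ^ 2) atTop (𝓝 0) → Tendsto u atTop (𝓝 0) := by
    intro u hu
    have := (Real.continuous_sqrt.tendsto 0).comp hu
    simp only [Function.comp_def, Real.sqrt_sq_eq_abs, Real.sqrt_zero] at this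
    exact (tendsto_zero_iff_abs_tendsto_zero u).2 this
  have htσ : Tendsto (fun n => t n - σ) atTop (𝓝 0) := hsq _ <|
    squeeze_zero (fun n => sq_nonneg _) (fun n => by
      have := hbase2 n
      nlinarith [sq_nonneg (x n - sb)]) hlim
  have hxs : Tendsto (fun n => x n - sb) atTop (𝓝 0) := hsq _ <|
    squeeze_zero (fun n => sq_nonneg _) (fun n => by
      have := hbase2 n
      nlinarith [sq_nonneg (t n - σ)]) hlim
  have hx : Tendsto x atTop (𝓝 sb) := by simpa using hxs.add_const sb
  have hy : Tendsto y atTop (𝓝 sb) := by simpa using hx.sub hxy0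
  have ht : Tendsto t atTop (𝓝 σ) := by simpa using htσ.add_const σ
  have hL : Tendsto (fun n => ρ1 (x n) - α * ρ2 (y n)) atTop (𝓝 (ρ1 sb - α * ρ2 sb)) :=
    (hc1sb.tendsto.comp hx).sub ((hc2sb.tendsto.comp hy).const_mul α)
  have hRt : Tendsto (fun n => t n * (2 * (t n - σ)) + x n * (2 * (x n - sb))
      + d * (2 * (x n - sb)) ^ 2 / (α - 1) + (α - 1) * r + K) atTop (𝓝 ((α - 1) * r + K)) := by
    have a1 := ht.mul (htσ.const_mul 2)
    have a2 := hx.mul (hxs.const_mul 2)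
    have a3 := ((((hxs.const_mul 2).pow 2).const_mul d).div_const (α - 1))
    have := (((a1.add a2).add a3).add_const ((α - 1) * r)).add_const K
    simpa using this
  refine le_of_tendsto_of_tendsto hL hRt ?_
  have hIoo : Ioo (sb - η) (sb + η) ∈ 𝓝 sb := Ioo_mem_nhds (by linarith) (by linarith)
  have hst : Tendsto (fun n => σ * t n) atTop (𝓝 1) := by
    have := ht.const_mul σ
    rwa [← sq, hσ] at this
  filter_upwards [hx.eventually hIoo, hy.eventually hIoo, hx.eventually hU, hy.eventually hU,
    (hc1sb.tendsto.comp hx).eventually (Ioi_mem_nhds hpos),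
    hst.eventually (Ioi_mem_nhds one_pos)] with n n1 n2 n3 n4 n5 n6
  refine doubled hd hα (hε0 n) h1 h2 ?_ ?_ n5 n1 n2 (hz n) (hr _) (hcomp _ n3 _ n4 ?_)
  · have := n1.1
    linarith
  · have := n2.1
    linarith
  · rw [hxyt, ← mul_assoc]
    exact mul_pos n6 (hε0 n)

lemma compare {d r K lam : ℝ} {R1 R2 ρ1 ρ2 : ℝ → ℝ} (hd : 0 < d) (hr0 : 0 ≤ r) (hK : 0 ≤ K)
    (hlam : 0 < lam)
    (h1 : IsViscSub d R1 (Set.Ioi 0) ρ1) (h2 : IsViscSuper d R2 (Set.Ioi 0) ρ2)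
    (hc1 : ContinuousOn ρ1 (Ici 0)) (hc2 : ContinuousOn ρ2 (Ici 0))
    (h10 : ρ1 0 = 0) (h20 : ρ2 0 = 0)
    (hl1 : Tendsto (fun s => ρ1 s / s) atTop (𝓝 lam))
    (hl2 : Tendsto (fun s => ρ2 s / s) atTop (𝓝 lam))
    (hr : ∀ s, uscEnv R2 s ≤ r) (hR : Compat R1 R2 K) (s : ℝ) (hs : 0 ≤ s) :
    ρ1 s ≤ ρ2 s + K := by
  have key : ∀ α : ℝ, 1 < α → ρ1 s - α * ρ2 s ≤ (α - 1) * r + K := by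
    intro α hα
    by_contra! hcon
    have hRHS : 0 ≤ (α - 1) * r + K := by
      have : 0 ≤ (α - 1) * r := mul_nonneg (by linarith) hr0
      linarith
    have hlim := hl1.sub (hl2.const_mul α)
    have hneg : lam - α * lam < 0 := by nlinarith
    obtain ⟨N, hN⟩ := eventually_atTop.1
      ((hlim.eventually (Iio_mem_nhds hneg)).and (eventually_gt_atTop 0))
    have hfar : ∀ q, N ≤ q → ρ1 q - α * ρ2 q < 0 := fun q hq => by
      obtain ⟨a, b⟩ := hN q hq
      have e : ρ1 q - α * ρ2 q = (ρ1 q / q - α * (ρ2 q / q)) * q := by field_simp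
      rw [e]
      exact mul_neg_of_neg_of_pos a b
    have hcont : ContinuousOn (fun q => ρ1 q - α * ρ2 q) (Icc 0 (max N s)) :=
      (hc1.sub (continuousOn_const.mul hc2)).mono Icc_subset_Ici_self
    obtain ⟨sb, hsbI, hsbm⟩ := isCompact_Icc.exists_isMaxOn
      ⟨s, hs, le_max_right _ _⟩ hcont
    have hge : ρ1 s - α * ρ2 s ≤ ρ1 sb - α * ρ2 sb := hsbm ⟨hs, le_max_right _ _⟩
    have hsb0 : 0 < sb := by
      rcases hsbI.1.lt_or_eq with h | h
      · exact h
      · rw [← h, h10, h20] at hge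
        linarith
    have hglob : ∀ q, 0 ≤ q → ρ1 q - α * ρ2 q ≤ ρ1 sb - α * ρ2 sb := fun q hq => by
      by_cases h : q ≤ max N s
      · exact hsbm ⟨hq, h⟩
      · have := hfar q ((le_max_left _ _).trans (not_le.1 h).le)
        linarith
    have hpos : 0 < ρ1 sb := by
      have := mul_nonneg (by linarith : 0 ≤ α) (h2.2.1 sb hsb0)
      linarith
    have := compare_max hd hα hsb0 h1 h2 hc1 hc2 hr hR hpos hglob
    linarith
  have ht : Tendsto (fun α : ℝ => (α - 1) * r + K + α * ρ2 s) (𝓝[>] 1) (𝓝 (ρ2 s + K)) := by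
    have : Continuous (fun α : ℝ => (α - 1) * r + K + α * ρ2 s) := by fun_prop
    have := (this.tendsto 1).mono_left (nhdsWithin_le_nhds (s := Ioi 1))
    convert this using 2
    ring
  refine ge_of_tendsto ht ?_
  filter_upwards [self_mem_nhdsWithin] with α hα
  have := key α hα
  linarith

lemma mono_of_sub {d m : ℝ} {R ρ : ℝ → ℝ} (hm : 0 < m) (hl : ∀ s, m ≤ lscEnv R s)
    (h : IsViscSub d R (Ioi 0) ρ) (hc : ContinuousOn ρ (Ici 0)) (h0 : ρ 0 = 0)
    (hnn : ∀ s, 0 ≤ s → 0 ≤ ρ s) : MonotoneOn ρ (Ici 0) := by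
  intro a ha b hb hab
  by_contra! hcon
  obtain ⟨c, hcI, hcm⟩ := isCompact_Icc.exists_isMaxOn ⟨a, ha, hab⟩
    (hc.mono (Icc_subset_Ici_self : Icc 0 b ⊆ Ici 0))
  have h1 : ρ a ≤ ρ c := hcm ⟨ha, hab⟩
  have hbn := hnn b hb
  have hc0 : 0 < c := by
    rcases hcI.1.lt_or_eq with h | h
    · exact h
    · rw [← h, h0] at h1; linarith
  have hcb : c < b := by
    rcases hcI.2.lt_or_eq with h | h
    · exact h
    · rw [h] at h1; linarith
  have := sub_test (φ := fun _ => 0) (p := 0) h hc0 contDiff_const (hasDerivAt_const _ _) (by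
    filter_upwards [Icc_mem_nhds hc0 hcb] with q hq
    have : ρ q ≤ ρ c := hcm hq
    linarith) (by linarith)
  have := hl c
  simp at *
  linarith

lemma zero_of_sub {d m : ℝ} {R ρ : ℝ → ℝ} (hd : 0 < d) (hl : ∀ s, m ≤ lscEnv R s)
    (h : IsViscSub d R (Ioi 0) ρ) (hc : ContinuousOn ρ (Ici 0)) (b : ℝ) (hb : 0 < b)
    (hbm : b ^ 2 < 4 * d * m) : ρ b ≤ 0 := by
  by_contra! hpos
  have hopen : ∀ᶠ q in 𝓝 b, q ^ 2 < 4 * d * m :=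
    (continuous_pow 2).continuousAt.eventually (Iio_mem_nhds hbm)
  obtain ⟨η, hη, hball⟩ := Metric.eventually_nhds_iff.1 (hopen.and (Ioi_mem_nhds hb))
  set θ := η / 2 with hθ
  have hθ0 : 0 < θ := by positivity
  have hin : ∀ q ∈ Icc (b - θ) (b + θ), q ^ 2 < 4 * d * m ∧ 0 < q := fun q hq => by
    apply hball
    rw [Real.dist_eq, abs_lt]
    constructor <;> linarith [hq.1, hq.2]
  have hcB : ContinuousOn ρ (Icc (b - θ) (b + θ)) := hc.mono fun q hq => (hin q hq).2.le
  obtain ⟨M, hM⟩ := isCompact_Icc.exists_bound_of_continuousOn hcB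
  have hbI : b ∈ Icc (b - θ) (b + θ) := ⟨by linarith, by linarith⟩
  have hM0 : 0 ≤ M := (norm_nonneg _).trans (hM b hbI)
  set k := (M + 1) / θ ^ 2 with hk
  have hk0 : 0 < k := by positivity
  obtain ⟨x, hxI, hxm⟩ := isCompact_Icc.exists_isMaxOn ⟨b, hbI⟩
    (hcB.sub (by fun_prop : Continuous fun q : ℝ => k * (q - b) ^ 2).continuousOn)
  have hxm : ∀ q ∈ Icc (b - θ) (b + θ), ρ q - k * (q - b) ^ 2 ≤ ρ x - k * (x - b) ^ 2 :=
    fun q hq => hxm hq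
  have hxb := hxm b hbI
  have hxM := (abs_le.1 (hM x hxI)).2
  have hkx : 0 ≤ k * (x - b) ^ 2 := by positivity
  simp only [sub_self, ne_eq, OfNat.ofNat_ne_zero, not_false_eq_true, zero_pow, mul_zero,
    sub_zero] at hxb
  have hkθ : k * θ ^ 2 = M + 1 := by rw [hk]; field_simp
  have hne1 : x ≠ b - θ := by
    rintro rfl
    have : k * (b - θ - b) ^ 2 = k * θ ^ 2 := by ring
    linarith
  have hne2 : x ≠ b + θ := by
    rintro rfl
    have : k * (b + θ - b) ^ 2 = k * θ ^ 2 := by ring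
    linarith
  have hx1 : b - θ < x := lt_of_le_of_ne hxI.1 hne1.symm
  have hx2 : x < b + θ := lt_of_le_of_ne hxI.2 hne2
  have hxpos : 0 < ρ x := by linarith
  set p := k * (2 * (x - b)) with hp
  have A := sub_test (φ := fun q => k * (q - b) ^ 2) (p := p) h (hin x hxI).2 (by fun_prop) (by
    have := (((hasDerivAt_id x).sub_const b).pow 2).const_mul k
    exact this.congr_deriv (by simp [hp])) (by
    filter_upwards [Icc_mem_nhds hx1 hx2] with q hq using hxm q hq) hxpos
  have h1 := hl x
  have h2 := (hin x hxI).1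
  have : 0 ≤ (2 * d * p - x) ^ 2 := sq_nonneg _
  have h3 : 4 * d * (ρ x - x * p + d * p ^ 2 + m) ≤ 0 := by
    have : ρ x - x * p + d * p ^ 2 + m ≤ 0 := by linarith
    exact mul_nonpos_of_nonneg_of_nonpos (by positivity) this
  have h4 : 0 < 4 * d * ρ x := by positivity
  nlinarith

lemma Rmu_mono {r3 a31 a32 c1 c2 mu : ℝ} (hr3 : 0 < r3) (ha31 : 0 ≤ a31) (hc12 : c2 < c1)
    (hmu : 0 ≤ mu) (c : ℝ) (hc : 0 < c) :
    ∃ U : Set ℝ, IsOpen U ∧ c ∈ U ∧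
      (MonotoneOn (fun s => r3 * (1 - mu * a31 * (if c2 < s ∧ s ≤ c1 then 1 else 0)
        - a32 * (if 0 < s ∧ s ≤ c2 then 1 else 0))) U ∨
       AntitoneOn (fun s => r3 * (1 - mu * a31 * (if c2 < s ∧ s ≤ c1 then 1 else 0)
        - a32 * (if 0 < s ∧ s ≤ c2 then 1 else 0))) U) := by
  have hma : 0 ≤ mu * a31 := mul_nonneg hmu ha31
  by_cases h : c < c1
  · refine ⟨Ioo 0 c1, isOpen_Ioo, ⟨hc, h⟩, ?_⟩
    rcases le_total (mu * a31) a32 with h' | h'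
    · left
      intro x hx y hy hxy
      apply mul_le_mul_of_nonneg_left _ hr3.le
      obtain ⟨x1, x2⟩ := hx
      obtain ⟨y1, y2⟩ := hy
      simp only [mul_ite, mul_one, mul_zero]
      generalize mu * a31 = w at *
      grind
    · right
      intro x hx y hy hxy
      apply mul_le_mul_of_nonneg_left _ hr3.le
      obtain ⟨x1, x2⟩ := hx
      obtain ⟨y1, y2⟩ := hy
      simp only [mul_ite, mul_one, mul_zero]
      generalize mu * a31 = w at *
      grind
  · refine ⟨Ioi c2, isOpen_Ioi, lt_of_lt_of_le hc12 (not_lt.1 h), Or.inl ?_⟩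
    intro x hx y hy hxy
    apply mul_le_mul_of_nonneg_left _ hr3.le
    simp only [mem_Ioi] at hx hy
    simp only [mul_ite, mul_one, mul_zero]
    generalize mu * a31 = w at *
    grind

lemma Rmu_bounds {r3 a31 a32 c1 c2 mu : ℝ} (hr3 : 0 < r3) (ha31 : 0 ≤ a31) (ha32 : 0 ≤ a32)
    (hmu : 0 ≤ mu) (hmu1 : mu ≤ 1) (s : ℝ) :
    r3 * (1 - a31 - a32) ≤ r3 * (1 - mu * a31 * (if c2 < s ∧ s ≤ c1 then 1 else 0)
        - a32 * (if 0 < s ∧ s ≤ c2 then 1 else 0)) ∧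
    r3 * (1 - mu * a31 * (if c2 < s ∧ s ≤ c1 then 1 else 0)
        - a32 * (if 0 < s ∧ s ≤ c2 then 1 else 0)) ≤ r3 := by
  have hma : 0 ≤ mu * a31 := mul_nonneg hmu ha31
  have hma1 : mu * a31 ≤ a31 := by nlinarith
  constructor
  · apply mul_le_mul_of_nonneg_left _ hr3.le
    split_ifs <;> linarith
  · apply mul_le_of_le_one_right hr3.le
    split_ifs <;> linarith

theorem mu_problem_basic_properties (d3 r3 a31 a32 c1 c2 lam : ℝ)
    (hd3 : 0 < d3) (hr3 : 0 < r3) (ha31 : 0 ≤ a31) (ha32 : 0 ≤ a32)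
    (hsum : a31 + a32 < 1) (hc2 : 0 < c2) (hc12 : c2 < c1) (hlam : 0 < lam) :
    (∀ mu1 mu2 ρ1 ρ2, 0 ≤ mu1 → mu1 ≤ mu2 → mu2 ≤ 1 →
      MuSol d3 r3 a31 a32 c1 c2 lam mu1 ρ1 → MuSol d3 r3 a31 a32 c1 c2 lam mu2 ρ2 →
      ∀ s, 0 ≤ s → 0 ≤ ρ2 s - ρ1 s ∧ ρ2 s - ρ1 s ≤ r3 * a31 * (mu2 - mu1)) ∧
    (∀ mu ρ, 0 ≤ mu → mu ≤ 1 → MuSol d3 r3 a31 a32 c1 c2 lam mu ρ →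
      MonotoneOn ρ (Set.Ici 0)) ∧
    (∀ mu ρ, 0 ≤ mu → mu ≤ 1 → MuSol d3 r3 a31 a32 c1 c2 lam mu ρ →
      ∃ s0, 2 * Real.sqrt (d3 * r3 * (1 - a31 - a32)) ≤ s0 ∧
        {s : ℝ | 0 ≤ s ∧ ρ s = 0} = Set.Icc 0 s0) := by
  have hm0 : 0 < r3 * (1 - a31 - a32) := mul_pos hr3 (by linarith)
  have hmono : ∀ mu ρ, 0 ≤ mu → mu ≤ 1 → MuSol d3 r3 a31 a32 c1 c2 lam mu ρ →
      MonotoneOn ρ (Set.Ici 0) := by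
    intro mu ρ h0 h1 ⟨hc, hsol, hz, hl⟩
    refine mono_of_sub hm0 (fun s => le_lsc
      (fun s => (Rmu_bounds hr3 ha31 ha32 h0 h1 s).2)
      (fun s => (Rmu_bounds hr3 ha31 ha32 h0 h1 s).1) s) hsol.2 hc hz ?_
    intro s hs
    rcases hs.lt_or_eq with h | h
    · exact hsol.1.2.1 s h
    · rw [← h, hz]
  refine ⟨?_, hmono, ?_⟩
  · intro mu1 mu2 ρ1 ρ2 h0 h12 h2 ⟨hc1, hsol1, hz1, hl1⟩ ⟨hc2', hsol2, hz2, hl2⟩ s hs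
    have h1 : mu1 ≤ 1 := h12.trans h2
    have h02 : 0 ≤ mu2 := h0.trans h12
    have hle : mu1 * a31 ≤ mu2 * a31 := mul_le_mul_of_nonneg_right h12 ha31
    have hK : 0 ≤ r3 * a31 * (mu2 - mu1) :=
      mul_nonneg (mul_nonneg hr3.le ha31) (by linarith)
    have A := compare hd3 hr3.le le_rfl hlam hsol1.2 hsol2.1 hc1 hc2' hz1 hz2 hl1 hl2
      (fun s => usc_le (fun s => (Rmu_bounds hr3 ha31 ha32 h02 h2 s).2)
        (fun s => (Rmu_bounds hr3 ha31 ha32 h02 h2 s).1) s)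
      (compat_of_mono (fun s => (Rmu_bounds hr3 ha31 ha32 h0 h1 s).2)
        (fun s => (Rmu_bounds hr3 ha31 ha32 h02 h2 s).1) (fun s => by
          rw [add_zero]
          apply mul_le_mul_of_nonneg_left _ hr3.le
          split_ifs <;> linarith)
        (fun c hc => Rmu_mono hr3 ha31 hc12 h0 c hc)) s hs
    have B := compare hd3 hr3.le hK hlam hsol2.2 hsol1.1 hc2' hc1 hz2 hz1 hl2 hl1
      (fun s => usc_le (fun s => (Rmu_bounds hr3 ha31 ha32 h0 h1 s).2)
        (fun s => (Rmu_bounds hr3 ha31 ha32 h0 h1 s).1) s)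
      (compat_of_mono (fun s => (Rmu_bounds hr3 ha31 ha32 h02 h2 s).2)
        (fun s => (Rmu_bounds hr3 ha31 ha32 h0 h1 s).1) (fun s => by
          have e : r3 * a31 * (mu2 - mu1) = r3 * (mu2 * a31 - mu1 * a31) := by ring
          rw [e, ← mul_add]
          apply mul_le_mul_of_nonneg_left _ hr3.le
          split_ifs <;> linarith)
        (fun c hc => Rmu_mono hr3 ha31 hc12 h02 c hc)) s hs
    constructor <;> linarith
  · intro mu ρ h0 h1 hS
    have hM := hmono mu ρ h0 h1 hS
    obtain ⟨hc, hsol, hz, hl⟩ := hS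
    have hnn : ∀ s, 0 ≤ s → 0 ≤ ρ s := by
      intro s hs
      rcases hs.lt_or_eq with h | h
      · exact hsol.1.2.1 s h
      · rw [← h, hz]
    set Z := {s : ℝ | 0 ≤ s ∧ ρ s = 0} with hZ
    have hZ0 : (0 : ℝ) ∈ Z := ⟨le_rfl, hz⟩
    have hbdd : BddAbove Z := by
      obtain ⟨N, hN⟩ := eventually_atTop.1 (hl.eventually (Ioi_mem_nhds hlam))
      refine ⟨N, fun q hq => ?_⟩
      by_contra! hcon
      have := hN q hcon.le
      rw [hq.2] at this
      simp at this
    have hclosed : IsClosed Z := by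
      have := hc.preimage_isClosed_of_isClosed isClosed_Ici (isClosed_singleton (x := (0 : ℝ)))
      exact this
    have hsup : sSup Z ∈ Z := hclosed.csSup_mem ⟨0, hZ0⟩ hbdd
    refine ⟨sSup Z, ?_, ?_⟩
    · by_contra! hcon
      set w := 2 * Real.sqrt (d3 * r3 * (1 - a31 - a32)) with hw
      set b := (sSup Z + w) / 2 with hb
      have hb1 : sSup Z < b := by linarith
      have hb2 : b < w := by linarith
      have hb0 : 0 < b := lt_of_le_of_lt hsup.1 hb1
      have hw2 : w ^ 2 = 4 * d3 * (r3 * (1 - a31 - a32)) := by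
        rw [hw, mul_pow, Real.sq_sqrt]
        · ring
        · rw [mul_assoc]; positivity
      have := zero_of_sub hd3 (fun s => le_lsc
        (fun s => (Rmu_bounds hr3 ha31 ha32 h0 h1 s).2)
        (fun s => (Rmu_bounds hr3 ha31 ha32 h0 h1 s).1) s) hsol.2 hc b hb0 (by
          rw [← hw2]; gcongr)
      have hbZ : b ∈ Z := ⟨hb0.le, le_antisymm this (hnn b hb0.le)⟩
      exact absurd (le_csSup hbdd hbZ) (not_le.2 hb1)
    · ext q
      constructor
      · intro hq
        exact ⟨hq.1, le_csSup hbdd hq⟩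
      · intro hq
        refine ⟨hq.1, le_antisymm ?_ (hnn q hq.1)⟩
        have := hM hq.1 hsup.1 hq.2
        rw [hsup.2] at this
        exact this
end
end

section
/- In the setting of the μ-problem, define σ₃(λ) := d₃λ + r₃/λ if 0 < λ < √(r₃/d₃) and σ₃(λ) := 2√(d₃r₃) if λ ≥ √(r₃/d₃). Then for every μ ∈ [0,1] and every solution ρ^μ of the μ-problem, one has s^μ_nlp ≤ σ₃(λ). Consequently, for every real constant c with c ≤ 2√(d₃r₃), one has max{s^μ_nlp, c} ≤ σ₃(λ), and if moreover σ₃(λ) < c₂ then max{s^μ_nlp, c} < c₂. -/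
open Filter Set Topology

noncomputable section

theorem mu_lower (d3 r3 a31 a32 c1 c2 lam mu : ℝ)
    (hd3 : 0 < d3) (hr3 : 0 < r3) (ha31 : 0 ≤ a31) (ha32 : 0 ≤ a32)
    (hmu0 : 0 ≤ mu)
    (ρ : ℝ → ℝ) (hρ : MuSol d3 r3 a31 a32 c1 c2 lam mu ρ)
    (p : ℝ) (hp : p < lam) (s : ℝ) (hs : 0 ≤ s) : p * s - (d3 * p ^ 2 + r3) ≤ ρ s := by
  obtain ⟨hcont, ⟨⟨_, hnn, hsup⟩, _⟩, h0, hlim⟩ := hρ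
  have hev : ∀ᶠ x in atTop, p < ρ x / x := hlim.eventually (lt_mem_nhds hp)
  obtain ⟨N, hN⟩ := (hev.and (eventually_gt_atTop (0:ℝ))).exists_forall_of_atTop
  have hNpos : 0 < N := (hN N le_rfl).2
  have hc : ContinuousOn (fun x => ρ x - p * x) (Icc 0 N) :=
    (hcont.mono Icc_subset_Ici_self).sub (by fun_prop)
  obtain ⟨m, hm, hmin⟩ := isCompact_Icc.exists_isMinOn ⟨0, ⟨le_rfl, hNpos.le⟩⟩ hc
  have hglob : ∀ x, 0 ≤ x → ρ m - p * m ≤ ρ x - p * x := by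
    intro x hx
    rcases le_total x N with h | h
    · exact hmin ⟨hx, h⟩
    · have h1 : ρ m - p * m ≤ ρ 0 - p * 0 := hmin (⟨le_rfl, hNpos.le⟩ : (0:ℝ) ∈ Icc 0 N)
      have h2 := hN x h
      have h3 := (lt_div_iff₀ h2.2).1 h2.1
      rw [h0] at h1
      linarith
  have key : -(d3 * p ^ 2 + r3) ≤ ρ m - p * m := by
    rcases hm.1.eq_or_lt with h | h
    · rw [← h, h0]
      have : 0 ≤ d3 * p ^ 2 := by positivity
      linarith
    · have hder : deriv (fun x : ℝ => p * x - (x - m) ^ 2) m = p := by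
        have : HasDerivAt (fun x : ℝ => p * x - (x - m) ^ 2) (p * 1 - 2 * (m - m) ^ 1 * 1) m := by
          have := ((hasDerivAt_id m).const_mul p).sub ((((hasDerivAt_id m).sub_const m)).pow 2)
          exact this.congr_deriv (by simp)
        rw [this.deriv]; ring
      have := hsup (fun x : ℝ => p * x - (x - m) ^ 2) (by fun_prop) m h (by
        unfold StrictLocMin
        have hpos : ∀ᶠ x in 𝓝[≠] m, 0 < x := nhdsWithin_le_nhds (lt_mem_nhds h)
        filter_upwards [hpos, self_mem_nhdsWithin] with x hx hne
        have h1 := hglob x hx.le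
        have h2 : 0 < (x - m) ^ 2 := by
          have : x - m ≠ 0 := sub_ne_zero.2 hne
          positivity
        simp only [sub_self]
        nlinarith)
      rw [hder] at this
      have hle : uscEnv (fun s => r3 * (1 - mu * a31 * (if c2 < s ∧ s ≤ c1 then 1 else 0)
        - a32 * (if 0 < s ∧ s ≤ c2 then 1 else 0))) m ≤ r3 := by
        unfold uscEnv
        have hma : 0 ≤ mu * a31 := by positivity
        refine limsup_le_of_le ?_ ?_
        · apply IsBoundedUnder.isCoboundedUnder_le
          refine ⟨r3 * (1 - mu * a31 - a32), ?_⟩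
          rw [eventually_map]
          refine Eventually.of_forall fun x => ?_
          apply mul_le_mul_of_nonneg_left _ hr3.le
          split_ifs <;> linarith
        · refine Eventually.of_forall fun x => ?_
          apply mul_le_of_le_one_right hr3.le
          split_ifs <;> linarith
      nlinarith
  linarith [hglob s hs]

theorem snlp_mu_le_sigma3 (d3 r3 a31 a32 c1 c2 lam mu : ℝ)
    (hd3 : 0 < d3) (hr3 : 0 < r3) (ha31 : 0 ≤ a31) (ha32 : 0 ≤ a32)
    (hsum : a31 + a32 < 1) (hc2 : 0 < c2) (hc12 : c2 < c1) (hlam : 0 < lam)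
    (hmu0 : 0 ≤ mu) (hmu1 : mu ≤ 1)
    (ρ : ℝ → ℝ) (hρ : MuSol d3 r3 a31 a32 c1 c2 lam mu ρ)
    (σ : ℝ) (hσ : σ = if lam < Real.sqrt (r3 / d3) then d3 * lam + r3 / lam
      else 2 * Real.sqrt (d3 * r3)) :
    sSup {s : ℝ | 0 ≤ s ∧ ρ s = 0} ≤ σ ∧
    ∀ c : ℝ, c ≤ 2 * Real.sqrt (d3 * r3) →
      max (sSup {s : ℝ | 0 ≤ s ∧ ρ s = 0}) c ≤ σ ∧
      (σ < c2 → max (sSup {s : ℝ | 0 ≤ s ∧ ρ s = 0}) c < c2) := by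
  obtain ⟨q, hq⟩ : ∃ q, q = Real.sqrt (r3 / d3) := ⟨_, rfl⟩
  have hqpos : 0 < q := by rw [hq]; positivity
  have hq2 : d3 * q ^ 2 = r3 := by
    rw [hq, Real.sq_sqrt (by positivity)]; field_simp
  have hdq : Real.sqrt (d3 * r3) = d3 * q := by
    rw [← hq2, show d3 * (d3 * q ^ 2) = (d3 * q) ^ 2 by ring]
    exact Real.sqrt_sq (by positivity)
  have hlow : ∀ p ≤ lam, ∀ s, 0 ≤ s → p * s - (d3 * p ^ 2 + r3) ≤ ρ s := by
    intro p hp s hs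
    have hc : Continuous fun p : ℝ => p * s - (d3 * p ^ 2 + r3) := by fun_prop
    have ht : Tendsto (fun p : ℝ => p * s - (d3 * p ^ 2 + r3)) (𝓝[<] p)
        (𝓝 (p * s - (d3 * p ^ 2 + r3))) := (hc.tendsto p).mono_left nhdsWithin_le_nhds
    refine le_of_tendsto ht ?_
    filter_upwards [self_mem_nhdsWithin] with x hx
    exact mu_lower d3 r3 a31 a32 c1 c2 lam mu hd3 hr3 ha31 ha32 hmu0 ρ hρ x
      (lt_of_lt_of_le hx hp) s hs
  have hS : sSup {s : ℝ | 0 ≤ s ∧ ρ s = 0} ≤ σ := by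
    refine csSup_le ⟨0, le_rfl, hρ.2.2.1⟩ ?_
    rintro s ⟨hs, hs0⟩
    rw [hσ, ← hq, hdq]
    split_ifs with h
    · have := hlow lam le_rfl s hs
      rw [hs0] at this
      have h2 : d3 * lam + r3 / lam = (d3 * lam ^ 2 + r3) / lam := by field_simp
      rw [h2, le_div_iff₀ hlam]
      linarith
    · have := hlow q (not_lt.1 h) s hs
      rw [hs0] at this
      have h2 : q * s ≤ q * (2 * (d3 * q)) := by nlinarith
      exact le_of_mul_le_mul_left h2 hqpos
  have hσ2 : 2 * Real.sqrt (d3 * r3) ≤ σ := by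
    rw [hσ]
    split_ifs with h
    · have h2 : d3 * lam + r3 / lam = (d3 * lam ^ 2 + r3) / lam := by field_simp
      rw [h2, le_div_iff₀ hlam, hdq]
      nlinarith [mul_nonneg hd3.le (sq_nonneg (lam - q))]
    · exact le_rfl
  refine ⟨hS, fun c hc => ?_⟩
  have hm := max_le hS (hc.trans hσ2)
  exact ⟨hm, fun h => hm.trans_lt h⟩
end
end

section
/- In the setting of the μ-problem, assume σ₃(λ) < c₂, where σ₃(λ) := d₃λ + r₃/λ if 0 < λ < √(r₃/d₃) and σ₃(λ) := 2√(d₃r₃) if λ ≥ √(r₃/d₃). Let ρ^μ be a solution of the μ-problem and suppose s^μ_nlp > 2√(d₃r₃(1 − a₃₂)). Then ρ^μ(c₂) = λ^μ·(c₂ − s^μ_nlp), where λ^μ := [s^μ_nlp − √((s^μ_nlp)² − 4d₃r₃(1 − a₃₂))]/(2d₃). -/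
open Filter Set Topology

noncomputable section

theorem mv_aux (f : ℝ → ℝ) (u v : ℝ) (huv : u < v) (hf : ContinuousOn f (Icc u v))
    (hlt : f v < f u) : ∃ s₀ ∈ Ioo u v, ∃ p C : ℝ, p ≤ 0 ∧
      ∀ᶠ s in 𝓝 s₀, f s ≤ f s₀ + p * (s - s₀) + C * (s - s₀) ^ 2 := by
  obtain ⟨s', hs', hfs'⟩ : ∃ s' ∈ Ioo u v, f v < f s' := by
    have h1 : Tendsto f (𝓝[>] u) (𝓝 (f u)) := by
      have := (hf u (left_mem_Icc.2 huv.le))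
      have h2 : Tendsto f (𝓝[Ioo u v] u) (𝓝 (f u)) := this.mono_left (nhdsWithin_mono _ Ioo_subset_Icc_self)
      rwa [nhdsWithin_Ioo_eq_nhdsGT huv] at h2
    have h3 := (h1.eventually (lt_mem_nhds hlt)).and (Ioo_mem_nhdsGT huv)
    obtain ⟨x, hx1, hx2⟩ := h3.exists
    exact ⟨x, hx2, hx1⟩
  have hpos : 0 < (s' - u) ^ 2 := by have := hs'.1; have : 0 < s' - u := by linarith
                                     positivity
  obtain ⟨N, hN0, hN⟩ : ∃ N : ℝ, 0 ≤ N ∧ f u - N * (s' - u) ^ 2 < f s' := by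
    refine ⟨(|f u - f s'| + 1) / (s' - u) ^ 2, by positivity, ?_⟩
    rw [div_mul_cancel₀ _ hpos.ne']
    have := le_abs_self (f u - f s')
    linarith
  have hg : ContinuousOn (fun s => f s - N * (min (s - s') 0) ^ 2) (Icc u v) :=
    hf.sub (by fun_prop)
  obtain ⟨s₀, hs₀, hmax⟩ := isCompact_Icc.exists_isMaxOn (nonempty_Icc.2 huv.le) hg
  have hm : ∀ s ∈ Icc u v, f s - N * (min (s - s') 0) ^ 2 ≤ f s₀ - N * (min (s₀ - s') 0) ^ 2 := hmax
  have hms := hm s' (Ioo_subset_Icc_self hs')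
  simp only [sub_self, min_self] at hms
  have hu : s₀ ≠ u := by
    rintro rfl
    rw [min_eq_left (by linarith [hs'.1])] at hms
    nlinarith
  have hv : s₀ ≠ v := by
    rintro rfl
    nlinarith [mul_nonneg hN0 (sq_nonneg (min (s₀ - s') 0))]
  have hIoo : s₀ ∈ Ioo u v := ⟨lt_of_le_of_ne hs₀.1 hu.symm, lt_of_le_of_ne hs₀.2 hv⟩
  refine ⟨s₀, hIoo, 2 * N * min (s₀ - s') 0, N, ?_, ?_⟩
  · exact mul_nonpos_of_nonneg_of_nonpos (by positivity) (min_le_right _ _)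
  · filter_upwards [Icc_mem_nhds hIoo.1 hIoo.2] with s hs
    have h1 := hm s hs
    have key : (min (s - s') 0) ^ 2 ≤ (min (s₀ - s') 0) ^ 2 + 2 * min (s₀ - s') 0 * (s - s₀)
        + (s - s₀) ^ 2 := by
      rcases min_cases (s - s') 0 with ⟨h, h'⟩ | ⟨h, h'⟩ <;>
      rcases min_cases (s₀ - s') 0 with ⟨h2, h2'⟩ | ⟨h2, h2'⟩ <;> rw [h, h2] <;>
        nlinarith [sq_nonneg (s - s')]
    nlinarith [mul_le_mul_of_nonneg_left key hN0]

theorem test_aux (p C s₀ : ℝ) : ContDiff ℝ 1 (fun s : ℝ => p * (s - s₀) + C * (s - s₀) ^ 2) ∧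
    deriv (fun s : ℝ => p * (s - s₀) + C * (s - s₀) ^ 2) s₀ = p := by
  refine ⟨by fun_prop, ?_⟩
  have h0 : HasDerivAt (fun s : ℝ => s - s₀) 1 s₀ := (hasDerivAt_id s₀).sub_const s₀
  have := (h0.const_mul p).add ((h0.pow 2).const_mul C)
  refine HasDerivAt.deriv (this.congr_deriv ?_)
  simp

theorem sub_touch {d : ℝ} {R : ℝ → ℝ} {I : Set ℝ} {ρ : ℝ → ℝ} (h : IsViscSub d R I ρ)
    {s₀ p C : ℝ} (hs : s₀ ∈ I) (hpos : 0 < ρ s₀)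
    (ht : ∀ᶠ s in 𝓝 s₀, ρ s ≤ ρ s₀ + p * (s - s₀) + C * (s - s₀) ^ 2) :
    ρ s₀ - s₀ * p + d * p ^ 2 + lscEnv R s₀ ≤ 0 := by
  obtain ⟨hc, hd⟩ := test_aux p (C + 1) s₀
  have := h.2 _ hc s₀ hs ?_ hpos
  · rwa [hd] at this
  · unfold StrictLocMax
    filter_upwards [nhdsWithin_le_nhds ht, self_mem_nhdsWithin] with s h1 h2
    have : 0 < (s - s₀) ^ 2 := by
      have : s - s₀ ≠ 0 := sub_ne_zero.2 h2
      positivity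
    nlinarith

theorem super_touch {d : ℝ} {R : ℝ → ℝ} {I : Set ℝ} {ρ : ℝ → ℝ} (h : IsViscSuper d R I ρ)
    {s₀ p : ℝ} (hs : s₀ ∈ I)
    (ht : ∀ᶠ s in 𝓝 s₀, ρ s₀ + p * (s - s₀) ≤ ρ s) :
    0 ≤ ρ s₀ - s₀ * p + d * p ^ 2 + uscEnv R s₀ := by
  obtain ⟨hc, hd⟩ := test_aux p (-1) s₀
  have := h.2.2 _ hc s₀ hs ?_
  · rwa [hd] at this
  · unfold StrictLocMin
    filter_upwards [nhdsWithin_le_nhds ht, self_mem_nhdsWithin] with s h1 h2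
    have : 0 < (s - s₀) ^ 2 := by
      have : s - s₀ ≠ 0 := sub_ne_zero.2 h2
      positivity
    nlinarith

/-- Zeros of the solution are bounded by the free speed. -/
theorem zero_aux {d r lam : ℝ} {R : ℝ → ℝ} {ρ : ℝ → ℝ} (hd : 0 < d) (hr : 0 < r)
    (hlam : 0 < lam)
    (hc : ContinuousOn ρ (Ici 0)) (h : IsViscSuper d R (Ioi 0) ρ) (h0 : ρ 0 = 0)
    (hR : ∀ s, uscEnv R s ≤ r) (hinf : Tendsto (fun s => ρ s / s) atTop (𝓝 lam))
    (z : ℝ) (hz : 0 < z) (hρz : ρ z = 0) (p : ℝ) (hp0 : 0 ≤ p) (hp : p ≤ lam) :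
    p * z - d * p ^ 2 - r ≤ 0 := by
  have main : ∀ p ∈ Ioo 0 lam, p * z - d * p ^ 2 - r ≤ 0 := by
    intro p hp
    by_contra hcon
    push Not at hcon
    obtain ⟨M, hM1, hM2⟩ := ((hinf.eventually (lt_mem_nhds hp.2)).and (eventually_ge_atTop z)).exists
    have hM0 : 0 < M := by linarith
    rw [lt_div_iff₀ hM0] at hM1
    have hg : ContinuousOn (fun s => ρ s - p * s) (Icc 0 M) :=
      (hc.mono Icc_subset_Ici_self).sub (by fun_prop)
    obtain ⟨s₀, hs₀, hmin⟩ := isCompact_Icc.exists_isMinOn (nonempty_Icc.2 hM0.le) hg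
    have hm : ∀ s ∈ Icc 0 M, ρ s₀ - p * s₀ ≤ ρ s - p * s := hmin
    have hmz := hm z ⟨hz.le, hM2⟩
    rw [hρz] at hmz
    have hq : 0 < d * p ^ 2 := by have := hp.1; positivity
    have hu : s₀ ≠ 0 := by
      rintro rfl
      rw [h0] at hmz
      nlinarith
    have hv : s₀ ≠ M := by
      rintro rfl
      nlinarith
    have h1 : 0 < s₀ := lt_of_le_of_ne hs₀.1 hu.symm
    have h2 : s₀ < M := lt_of_le_of_ne hs₀.2 hv
    have := super_touch h (p := p) (s₀ := s₀) h1 (by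
      filter_upwards [Icc_mem_nhds h1 h2] with s hs
      have := hm s hs
      nlinarith)
    have := hR s₀
    nlinarith
  have hcl : IsClosed {p : ℝ | p * z - d * p ^ 2 - r ≤ 0} :=
    isClosed_le (by fun_prop) (by fun_prop)
  have : closure (Ioo 0 lam) ⊆ {p : ℝ | p * z - d * p ^ 2 - r ≤ 0} :=
    closure_minimal main hcl
  rw [closure_Ioo hlam.ne] at this
  exact this ⟨hp0, hp⟩

theorem core_aux {d r a c q : ℝ} {ρ : ℝ → ℝ} (hd : 0 < d)
    (ha : 0 < a) (hac : a < c)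
    (hc : ContinuousOn ρ (Ici 0)) (hρa : ρ a = 0) (hnn : ∀ s > 0, 0 ≤ ρ s)
    (hpos : ∀ s > a, 0 < ρ s)
    (hq0 : 0 < q) (hq : d * q ^ 2 - a * q + r = 0) (hq2 : 2 * d * q < a)
    (hsub : ∀ s₀ ∈ Ioo 0 c, 0 < ρ s₀ → ∀ p C : ℝ,
      (∀ᶠ s in 𝓝 s₀, ρ s ≤ ρ s₀ + p * (s - s₀) + C * (s - s₀) ^ 2) →
      ρ s₀ - s₀ * p + d * p ^ 2 + r ≤ 0)
    (hsup : ∀ s₀ ∈ Ioo 0 c, ∀ p : ℝ, (∀ᶠ s in 𝓝 s₀, ρ s₀ + p * (s - s₀) ≤ ρ s) →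
      0 ≤ ρ s₀ - s₀ * p + d * p ^ 2 + r) : ρ c = q * (c - a) := by
  have hcI : ∀ v, ContinuousOn ρ (Icc a v) := fun v =>
    hc.mono (fun x hx => ha.le.trans hx.1)
  have near : ∀ k, 0 < k → k < q → ∃ s2 ∈ Ioo a c, ∀ s ∈ Ioo a s2, k * (s - a) ≤ ρ s := by
    intro k hk0 hkq
    have hk : 0 < d * k ^ 2 - a * k + r := by
      have : 0 < (q - k) * (a - d * (k + q)) := mul_pos (by linarith) (by nlinarith)
      nlinarith
    have hcont : Tendsto (fun s : ℝ => d * k ^ 2 - s * k + r) (𝓝[>] a)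
        (𝓝 (d * k ^ 2 - a * k + r)) := by
      apply Tendsto.mono_left _ nhdsWithin_le_nhds
      exact (by fun_prop : Continuous (fun s : ℝ => d * k ^ 2 - s * k + r)).tendsto a
    obtain ⟨s2, h1, h2⟩ := ((hcont.eventually (lt_mem_nhds hk)).and (Ioo_mem_nhdsGT hac)).exists
    refine ⟨s2, h2, fun s hs => ?_⟩
    by_contra hcon
    push Not at hcon
    obtain ⟨s₀, hs₀, p, C, hp, ht⟩ := mv_aux (fun s => ρ s - k * (s - a)) a s hs.1
      ((hcI s).sub (by fun_prop)) (by simp only [hρa]; linarith)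
    have := hsub s₀ ⟨ha.trans hs₀.1, hs₀.2.trans (hs.2.trans h2.2)⟩ (hpos _ hs₀.1) (k + p) C (by
      filter_upwards [ht] with x hx
      nlinarith)
    have h3 : 0 < s₀ - 2 * d * k - d * p := by nlinarith [hs₀.1]
    have h4 : 0 ≤ (-p) * (s₀ - 2 * d * k - d * p) := mul_nonneg (by linarith) h3.le
    have h5 : s₀ * k ≤ s2 * k := mul_le_mul_of_nonneg_right (hs₀.2.trans hs.2).le hk0.le
    have := hpos _ hs₀.1
    nlinarith
  have lower : ∀ s ∈ Ioo a c, ∀ k ∈ Ioo 0 q, k * (s - a) ≤ ρ s := by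
    intro s1 hs1 k hk
    by_contra hcon
    push Not at hcon
    obtain ⟨k', hk'1, hk'2⟩ := exists_between hk.2
    obtain ⟨s2, hs2, hn⟩ := near k' (hk.1.trans hk'1) hk'2
    obtain ⟨t, ht1, ht2⟩ := exists_between (lt_min hs1.1 hs2.1)
    have hnt := hn t ⟨ht1, ht2.trans_le (min_le_right _ _)⟩
    have hts : t < s1 := ht2.trans_le (min_le_left _ _)
    obtain ⟨s₀, hs₀, hmax⟩ := isCompact_Icc.exists_isMaxOn (nonempty_Icc.2 hs1.1.le)
      (((hcI s1).sub (by fun_prop)) : ContinuousOn (fun s => ρ s - k * (s - a)) (Icc a s1))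
    have hm : ∀ s ∈ Icc a s1, ρ s - k * (s - a) ≤ ρ s₀ - k * (s₀ - a) := hmax
    have hmt := hm t ⟨ht1.le, hts.le⟩
    have hpp : 0 < (k' - k) * (t - a) := mul_pos (by linarith) (by linarith)
    have hp0 : 0 < ρ s₀ - k * (s₀ - a) := by nlinarith
    have hu : s₀ ≠ a := by
      rintro rfl
      rw [hρa] at hp0; simp at hp0
    have hv : s₀ ≠ s1 := by
      rintro rfl
      linarith
    have h1 : a < s₀ := lt_of_le_of_ne hs₀.1 hu.symm
    have h2 : s₀ < s1 := lt_of_le_of_ne hs₀.2 hv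
    have := hsub s₀ ⟨ha.trans h1, h2.trans hs1.2⟩ (hpos _ h1) k 0 (by
      filter_upwards [Icc_mem_nhds h1 h2] with x hx
      have := hm x hx
      nlinarith)
    have : 0 < (q - k) * (a - d * (k + q)) := mul_pos (by linarith [hk.2]) (by nlinarith [hk.2])
    nlinarith
  have upper : ∀ s ∈ Ioo a c, ∀ k ∈ Ioo q (a / (2 * d)), ρ s ≤ k * (s - a) := by
    intro s1 hs1 k hk
    have hk2 : 2 * d * k < a := by
      have := hk.2
      rw [lt_div_iff₀ (by positivity)] at this
      linarith
    have hkn : 0 < (k - q) * (a - d * (k + q)) := mul_pos (by linarith [hk.1]) (by nlinarith [hk.1])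
    have hk0 : 0 < k := hq0.trans hk.1
    by_contra hcon
    push Not at hcon
    obtain ⟨t, ht, htk⟩ : ∃ t ∈ Ioo a s1, ρ t < k * (t - a) := by
      by_contra hno
      push Not at hno
      have := hsup a ⟨ha, hac⟩ k (by
        filter_upwards [Ioo_mem_nhds ha hs1.1] with x hx
        rw [hρa, zero_add]
        rcases le_or_gt x a with h | h
        · exact (mul_nonpos_of_nonneg_of_nonpos hk0.le (by linarith)).trans (hnn x hx.1)
        · exact hno x ⟨h, hx.2⟩)
      rw [hρa] at this
      nlinarith
    obtain ⟨s₀, hs₀, hmin⟩ := isCompact_Icc.exists_isMinOn (nonempty_Icc.2 hs1.1.le)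
      (((hcI s1).sub (by fun_prop)) : ContinuousOn (fun s => ρ s - k * (s - a)) (Icc a s1))
    have hm : ∀ s ∈ Icc a s1, ρ s₀ - k * (s₀ - a) ≤ ρ s - k * (s - a) := hmin
    have hmt := hm t (Ioo_subset_Icc_self ht)
    have hu : s₀ ≠ a := by
      rintro rfl
      rw [hρa] at hmt; simp at hmt; linarith
    have hv : s₀ ≠ s1 := by
      rintro rfl
      linarith
    have h1 : a < s₀ := lt_of_le_of_ne hs₀.1 hu.symm
    have h2 : s₀ < s1 := lt_of_le_of_ne hs₀.2 hv
    have := hsup s₀ ⟨ha.trans h1, h2.trans hs1.2⟩ k (by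
      filter_upwards [Icc_mem_nhds h1 h2] with x hx
      have := hm x hx
      nlinarith)
    nlinarith
  have hqa : q < a / (2 * d) := by
    rw [lt_div_iff₀ (by positivity)]; linarith
  have eq : ∀ s ∈ Ioo a c, ρ s = q * (s - a) := by
    intro s hs
    apply le_antisymm
    · have hcl : IsClosed {k : ℝ | ρ s ≤ k * (s - a)} := isClosed_le (by fun_prop) (by fun_prop)
      have := closure_minimal (fun k hk => upper s hs k hk : Ioo q (a / (2 * d)) ⊆ {k : ℝ | ρ s ≤ k * (s - a)}) hcl
      rw [closure_Ioo hqa.ne] at this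
      exact this (left_mem_Icc.2 hqa.le)
    · have hcl : IsClosed {k : ℝ | k * (s - a) ≤ ρ s} := isClosed_le (by fun_prop) (by fun_prop)
      have := closure_minimal (fun k hk => lower s hs k hk : Ioo 0 q ⊆ {k : ℝ | k * (s - a) ≤ ρ s}) hcl
      rw [closure_Ioo hq0.ne] at this
      exact this (right_mem_Icc.2 hq0.le)
  have hc0 : 0 < c := ha.trans hac
  have t1 : Tendsto ρ (𝓝[<] c) (𝓝 (ρ c)) :=
    ((hc.continuousAt (Ici_mem_nhds hc0)).tendsto).mono_left nhdsWithin_le_nhds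
  have t2 : Tendsto (fun s => q * (s - a)) (𝓝[<] c) (𝓝 (q * (c - a))) :=
    ((by fun_prop : Continuous (fun s : ℝ => q * (s - a))).tendsto c).mono_left nhdsWithin_le_nhds
  refine tendsto_nhds_unique (t1.congr' ?_) t2
  filter_upwards [Ioo_mem_nhdsLT hac] with s hs using eq s hs

theorem mu_solution_value_at_c2 (d3 r3 a31 a32 c1 c2 lam mu : ℝ)
    (hd3 : 0 < d3) (hr3 : 0 < r3) (ha31 : 0 ≤ a31) (ha32 : 0 ≤ a32)
    (hsum : a31 + a32 < 1) (hc2 : 0 < c2) (hc12 : c2 < c1) (hlam : 0 < lam)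
    (hmu0 : 0 ≤ mu) (hmu1 : mu ≤ 1)
    (hσc2 : (if lam < Real.sqrt (r3 / d3) then d3 * lam + r3 / lam
      else 2 * Real.sqrt (d3 * r3)) < c2)
    (ρ : ℝ → ℝ) (hρ : MuSol d3 r3 a31 a32 c1 c2 lam mu ρ)
    (snlp : ℝ) (hsnlp : snlp = sSup {s : ℝ | 0 ≤ s ∧ ρ s = 0})
    (hbig : 2 * Real.sqrt (d3 * r3 * (1 - a32)) < snlp)
    (lamμ : ℝ)
    (hlamμ : lamμ = (snlp - Real.sqrt (snlp ^ 2 - 4 * d3 * r3 * (1 - a32))) / (2 * d3)) :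
    ρ c2 = lamμ * (c2 - snlp) := by
  obtain ⟨hc, ⟨hsup, hsub⟩, h0, hinf⟩ := hρ
  set R : ℝ → ℝ := fun s => r3 * (1 - mu * a31 * (if c2 < s ∧ s ≤ c1 then 1 else 0)
        - a32 * (if 0 < s ∧ s ≤ c2 then 1 else 0)) with hRdef
  have hma : 0 ≤ mu * a31 := mul_nonneg hmu0 ha31
  have hma1 : mu * a31 ≤ 1 := by nlinarith
  have hRle : ∀ s, R s ≤ r3 := by
    intro s
    simp only [hRdef]
    split_ifs <;> nlinarith
  have hRge : ∀ s, -r3 ≤ R s := by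
    intro s
    simp only [hRdef]
    split_ifs <;> nlinarith
  have husc : ∀ s, uscEnv R s ≤ r3 := by
    intro s
    unfold uscEnv
    apply limsup_le_of_le
    · exact (isBoundedUnder_of ⟨-r3, hRge⟩ : IsBoundedUnder (· ≥ ·) (𝓝 s) R).isCoboundedUnder_le
    · exact Eventually.of_forall hRle
  have hRev : ∀ s ∈ Ioo 0 c2, R =ᶠ[𝓝 s] fun _ => r3 * (1 - a32) := by
    intro s hs
    filter_upwards [Ioo_mem_nhds hs.1 hs.2] with x hx
    simp only [hRdef]
    rw [if_neg (by intro h; linarith [hx.2, h.1]), if_pos ⟨hx.1, hx.2.le⟩]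
    ring
  have hus : ∀ s ∈ Ioo 0 c2, uscEnv R s = r3 * (1 - a32) := by
    intro s hs
    unfold uscEnv
    rw [limsup_congr (hRev s hs), limsup_const]
  have hls : ∀ s ∈ Ioo 0 c2, lscEnv R s = r3 * (1 - a32) := by
    intro s hs
    unfold lscEnv
    rw [liminf_congr (hRev s hs), liminf_const]
  have hr : 0 < r3 * (1 - a32) := mul_pos hr3 (by linarith)
  have hzero := zero_aux hd3 hr3 hlam hc hsup h0 husc hinf
  have hub : ∀ z ∈ {s : ℝ | 0 ≤ s ∧ ρ s = 0}, z ≤ (if lam < Real.sqrt (r3 / d3)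
      then d3 * lam + r3 / lam else 2 * Real.sqrt (d3 * r3)) := by
    rintro z ⟨hz0, hz⟩
    rcases hz0.eq_or_lt with rfl | hz0
    · split_ifs <;> positivity
    split_ifs with hl
    · have := hzero z hz0 hz lam hlam.le le_rfl
      have e : d3 * lam + r3 / lam = (d3 * lam ^ 2 + r3) / lam := by field_simp
      rw [e, le_div_iff₀ hlam]
      linarith
    · push Not at hl
      have := hzero z hz0 hz _ (Real.sqrt_nonneg _) hl
      have hp : 0 < √(r3 / d3) := Real.sqrt_pos.2 (by positivity)
      have h1 : √(r3 / d3) ^ 2 = r3 / d3 := Real.sq_sqrt (by positivity)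
      have h2 : √(r3 / d3) * √(d3 * r3) = r3 := by
        rw [← Real.sqrt_mul (by positivity), show r3 / d3 * (d3 * r3) = r3 ^ 2 by field_simp,
          Real.sqrt_sq hr3.le]
      have h3 : d3 * (r3 / d3) = r3 := by field_simp
      rw [h1, h3] at this
      by_contra hcon
      push Not at hcon
      nlinarith [mul_lt_mul_of_pos_left hcon hp]
  have hne : ({s : ℝ | 0 ≤ s ∧ ρ s = 0}).Nonempty := ⟨0, le_rfl, h0⟩
  have hbdd : BddAbove {s : ℝ | 0 ≤ s ∧ ρ s = 0} := ⟨_, hub⟩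
  have hclosed : IsClosed {s : ℝ | 0 ≤ s ∧ ρ s = 0} :=
    hc.preimage_isClosed_of_isClosed isClosed_Ici isClosed_singleton
  have hmem := hclosed.csSup_mem hne hbdd
  rw [← hsnlp] at hmem
  have hac : snlp < c2 := lt_of_le_of_lt (hub _ hmem) hσc2
  have hA : 0 < snlp := lt_of_le_of_lt (by positivity) hbig
  have hdr : 0 < d3 * r3 * (1 - a32) := by nlinarith
  have hdisc : 0 < snlp ^ 2 - 4 * d3 * r3 * (1 - a32) := by
    have := Real.sq_sqrt hdr.le
    nlinarith [Real.sqrt_nonneg (d3 * r3 * (1 - a32))]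
  have hS := Real.sq_sqrt hdisc.le
  have hSp := Real.sqrt_pos.2 hdisc
  set S := √(snlp ^ 2 - 4 * d3 * r3 * (1 - a32))
  have h2dq : 2 * d3 * lamμ = snlp - S := by rw [hlamμ]; field_simp
  have hSa : S < snlp := by nlinarith
  apply core_aux (r := r3 * (1 - a32)) hd3 hA hac hc hmem.2 (fun s hs => hsup.2.1 s hs)
  · intro s hs
    refine lt_of_le_of_ne (hsup.2.1 s (hA.trans hs)) (fun h => ?_)
    have := le_csSup hbdd (⟨(hA.trans hs).le, h.symm⟩ : s ∈ {s : ℝ | 0 ≤ s ∧ ρ s = 0})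
    rw [← hsnlp] at this
    linarith
  · rw [hlamμ]; exact div_pos (by linarith) (by positivity)
  · have e : S = snlp - 2 * d3 * lamμ := by linarith
    rw [e] at hS
    have : 4 * d3 * (d3 * lamμ ^ 2 - snlp * lamμ + r3 * (1 - a32)) = 0 := by linarith
    exact (mul_eq_zero.1 this).resolve_left (by positivity)
  · linarith
  · intro s₀ hs hp p C ht
    rw [← hls s₀ hs]
    exact sub_touch hsub hs.1 hp ht
  · intro s₀ hs p ht
    rw [← hus s₀ hs]
    exact super_touch hsup hs.1 ht
end
end

section
/- Let d₃, r₃ > 0 and 0 ≤ a₃₂ < 1, and let ℓ, ℓ′ satisfy 2√(d₃r₃(1 − a₃₂)) ≤ ℓ < ℓ′. Set ν₁(ℓ) := [ℓ + √(ℓ² − 4d₃r₃(1 − a₃₂))]/(2d₃). Let ρ₀ be a nonnegative continuous viscosity solution of min{ρ − s·ρ′ + d₃·(ρ′)² + r₃(1 − a₃₂), ρ} = 0 on (ℓ, ℓ′), continuous on [ℓ, ℓ′]. Then ρ(s) := min{ρ₀(s), ν₁(ℓ)·(s − ℓ)} is a viscosity sub-solution of min{ρ − s·ρ′ + d₃·(ρ′)²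 + r₃(1 − a₃₂), ρ} = 0 on (ℓ, ℓ′). If moreover ν₁(ℓ)·(ℓ′ − ℓ) ≥ ρ₀(ℓ′), then ρ is a viscosity solution of this variational inequality on (ℓ, ℓ′). -/
open Filter Set Topology

noncomputable section

lemma touchA (u : ℝ → ℝ) (s₀ q : ℝ) (P : ℝ → Prop)
    (hc : ∀ᶠ s in 𝓝 s₀, ContinuousAt u s) (hP : ∀ᶠ s in 𝓝 s₀, P s)
    (hleft : ∀ᶠ s in 𝓝[<] s₀, u s - u s₀ < q * (s - s₀)) :
    ∃ t, ∃ φ : ℝ → ℝ, P t ∧ ContDiff ℝ 1 φ ∧ q ≤ deriv φ t ∧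
      StrictLocMax (fun s => u s - φ s) t := by
  rw [eventually_nhdsWithin_iff] at hleft
  obtain ⟨ε, hε, H⟩ := Metric.eventually_nhds_iff.1 (hc.and (hP.and hleft))
  obtain ⟨δ, hδ, hδε⟩ : ∃ δ, 0 < δ ∧ δ < ε := ⟨ε / 2, by linarith, by linarith⟩
  have H' : ∀ s ∈ Icc (s₀ - δ) (s₀ + δ), ContinuousAt u s ∧ P s ∧
      (s ∈ Iio s₀ → u s - u s₀ < q * (s - s₀)) := by
    intro s hs
    apply H
    rw [Real.dist_eq, abs_lt]
    constructor <;> linarith [hs.1, hs.2]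
  have hL := (H' (s₀ - δ) ⟨le_rfl, by linarith⟩).2.2 (by simpa using hδ)
  obtain ⟨m, hm⟩ : ∃ m, m = q * (s₀ - δ - s₀) - (u (s₀ - δ) - u s₀) := ⟨_, rfl⟩
  have hm0 : 0 < m := by linarith
  obtain ⟨M, hM⟩ : ∃ M, M = u (s₀ + δ) - u s₀ - q * δ := ⟨_, rfl⟩
  obtain ⟨N, hN⟩ : ∃ N, N = (|M| + 1) / (m / 2 * δ) := ⟨_, rfl⟩
  have hN0 : 0 < N := by rw [hN]; positivity
  have hNe : m / 2 * (N * δ) = |M| + 1 := by rw [hN]; field_simp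
  let ψ : ℝ → ℝ := fun s => q * s + m / 2 * Real.exp (N * (s - s₀))
  have hψd : ∀ s, HasDerivAt ψ (q + m / 2 * (Real.exp (N * (s - s₀)) * N)) s := by
    intro s
    have h1 : HasDerivAt (fun s => N * (s - s₀)) N s := by
      simpa using ((hasDerivAt_id s).sub_const s₀).const_mul N
    have h2 := (h1.exp).const_mul (m / 2)
    have h3 : HasDerivAt (fun s => q * s) q s := by simpa using (hasDerivAt_id s).const_mul q
    exact h3.add h2
  have hψc : ContDiff ℝ 1 ψ := by
    show ContDiff ℝ 1 (fun s => q * s + m / 2 * Real.exp (N * (s - s₀)))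
    fun_prop
  obtain ⟨t, ht, hmax⟩ := (isCompact_Icc (a := s₀ - δ) (b := s₀ + δ)).exists_isMaxOn
    ⟨s₀, by constructor <;> linarith⟩ (f := fun s => u s - ψ s)
    (fun s hs => (((H' s hs).1).sub (hψd s).continuousAt).continuousWithinAt)
  have h0 : u s₀ - ψ s₀ ≤ u t - ψ t :=
    hmax (show s₀ ∈ Icc (s₀ - δ) (s₀ + δ) by constructor <;> linarith)
  have hψ0 : ψ s₀ = q * s₀ + m / 2 := by simp [ψ]
  have ht1 : s₀ - δ < t := by
    rcases ht.1.lt_or_eq with h | h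
    · exact h
    · exfalso
      rw [← h] at h0
      have : ψ (s₀ - δ) = q * (s₀ - δ) + m / 2 * Real.exp (N * (s₀ - δ - s₀)) := rfl
      have : 0 < m / 2 * Real.exp (N * (s₀ - δ - s₀)) := by positivity
      linarith
  have ht2 : t < s₀ + δ := by
    rcases ht.2.lt_or_eq with h | h
    · exact h
    · exfalso
      rw [h] at h0
      have e : ψ (s₀ + δ) = q * (s₀ + δ) + m / 2 * Real.exp (N * δ) := by simp [ψ]
      have e2 : m / 2 * (N * δ + 1) ≤ m / 2 * Real.exp (N * δ) :=
        mul_le_mul_of_nonneg_left (Real.add_one_le_exp _) (by linarith)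
      have := le_abs_self M
      linarith
  refine ⟨t, fun s => ψ s + (s - t) ^ 2, (H' t ht).2.1, by fun_prop, ?_, ?_⟩
  · have h1 : HasDerivAt (fun s => (s - t) ^ 2) 0 t := by
      have h := ((hasDerivAt_id t).sub_const t).pow 2
      have e : ((2 : ℕ) : ℝ) * (id t - t) ^ (2 - 1) * 1 = 0 := by simp
      rw [e] at h
      exact h
    have h2 := ((hψd t).add h1).deriv
    have h3 : (ψ + fun s => (s - t) ^ 2) = fun s => ψ s + (s - t) ^ 2 := rfl
    rw [h3] at h2
    rw [h2]
    have : 0 < m / 2 * (Real.exp (N * (t - s₀)) * N) := by positivity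
    linarith
  · have hI : ∀ᶠ s in 𝓝 t, s ∈ Ioo (s₀ - δ) (s₀ + δ) := Ioo_mem_nhds ht1 ht2
    unfold StrictLocMax
    filter_upwards [hI.filter_mono nhdsWithin_le_nhds, self_mem_nhdsWithin] with s hs hne
    have h1 : u s - ψ s ≤ u t - ψ t := hmax (Ioo_subset_Icc_self hs)
    have h2 : 0 < (s - t) ^ 2 := by
      have : s - t ≠ 0 := sub_ne_zero.2 hne
      positivity
    simp only [sub_self]
    linarith

lemma touchB (u : ℝ → ℝ) (s₀ q : ℝ) (P : ℝ → Prop)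
    (hc : ∀ᶠ s in 𝓝 s₀, ContinuousAt u s) (hP : ∀ᶠ s in 𝓝 s₀, P s)
    (hright : ∀ᶠ s in 𝓝[>] s₀, u s - u s₀ < q * (s - s₀)) :
    ∃ t, ∃ φ : ℝ → ℝ, P t ∧ ContDiff ℝ 1 φ ∧ deriv φ t ≤ q ∧
      StrictLocMax (fun s => u s - φ s) t := by
  have T : Tendsto (fun s : ℝ => -s) (𝓝 (-s₀)) (𝓝 s₀) := by
    simpa using (continuous_neg (G := ℝ)).tendsto (-s₀)
  obtain ⟨t, φ, h1, h2, h3, h4⟩ := touchA (fun s => u (-s)) (-s₀) (-q) (fun s => P (-s))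
    (by
      filter_upwards [T.eventually hc] with s hs
      exact ContinuousAt.comp (f := fun s : ℝ => -s) hs continuous_neg.continuousAt)
    (T.eventually hP)
    (by
      rw [eventually_nhdsWithin_iff] at hright ⊢
      filter_upwards [T.eventually hright] with s hs hs2
      have := hs (by simp at hs2 ⊢; linarith)
      simp only [neg_neg]
      linarith)
  refine ⟨-t, fun s => φ (-s), h1, h2.comp contDiff_neg, ?_, ?_⟩
  · rw [deriv_comp_neg]; simp only [neg_neg]; linarith
  · unfold StrictLocMax at h4 ⊢
    rw [eventually_nhdsWithin_iff] at h4 ⊢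
    have T' : Tendsto (fun s : ℝ => -s) (𝓝 (-t)) (𝓝 t) := by
      simpa using (continuous_neg (G := ℝ)).tendsto (-t)
    filter_upwards [T'.eventually h4] with s hs hs2
    have := hs (fun h => hs2 (by
      have h : -s = t := h
      show s = -t
      linarith))
    simpa using this

lemma slopeL (φ : ℝ → ℝ) (s₀ q : ℝ) (h : DifferentiableAt ℝ φ s₀) (hq : q < deriv φ s₀) :
    ∀ᶠ s in 𝓝[<] s₀, φ s - φ s₀ < q * (s - s₀) := by
  have := (hasDerivAt_iff_tendsto_slope.1 h.hasDerivAt).eventually (lt_mem_nhds hq)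
  have := this.filter_mono (nhdsWithin_mono s₀ (fun s (hs : s < s₀) => hs.ne))
  filter_upwards [this, self_mem_nhdsWithin] with s hs hlt
  have hlt : s < s₀ := hlt
  rw [slope_def_field, lt_div_iff_of_neg (by linarith)] at hs
  exact hs

lemma slopeR (φ : ℝ → ℝ) (s₀ q : ℝ) (h : DifferentiableAt ℝ φ s₀) (hq : deriv φ s₀ < q) :
    ∀ᶠ s in 𝓝[>] s₀, φ s - φ s₀ < q * (s - s₀) := by
  have := (hasDerivAt_iff_tendsto_slope.1 h.hasDerivAt).eventually (gt_mem_nhds hq)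
  have := this.filter_mono (nhdsWithin_mono s₀ (fun s (hs : s₀ < s) => hs.ne'))
  filter_upwards [this, self_mem_nhdsWithin] with s hs hlt
  have hlt : s₀ < s := hlt
  rw [slope_def_field, div_lt_iff₀ (by linarith)] at hs
  exact hs

lemma coreSub (d c l l' ν : ℝ) (hd : 0 < d) (hν : d * ν ^ 2 - l * ν + c = 0)
    (u : ℝ → ℝ) (hc : ContinuousOn u (Icc l l'))
    (hs : IsViscSub d (fun _ => c) (Ioo l l') u) :
    IsViscSub d (fun _ => c) (Ioo l l') (fun s => min (u s) (ν * (s - l))) := by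
  have hcI : ContinuousOn u (Ioo l l') := hc.mono Ioo_subset_Icc_self
  have hmin : ContinuousOn (fun s => min (u s) (ν * (s - l))) (Ioo l l') :=
    ContinuousOn.inf hcI (by fun_prop)
  refine ⟨hmin.upperSemicontinuousOn, ?_⟩
  intro φ hφ s₀ hs₀ hmax hpos
  have hsub := hs.2
  simp only [lscEnv, liminf_const] at hsub ⊢
  have hφd : DifferentiableAt ℝ φ s₀ := hφ.differentiable (by norm_num) s₀
  have hI : ∀ᶠ s in 𝓝 s₀, s ∈ Ioo l l' := Ioo_mem_nhds hs₀.1 hs₀.2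
  have huc : ContinuousAt u s₀ := hcI.continuousAt hI
  have huc' : ∀ᶠ s in 𝓝 s₀, ContinuousAt u s := by
    filter_upwards [hI] with s hs
    exact hcI.continuousAt (Ioo_mem_nhds hs.1 hs.2)
  have hLc : ContinuousAt (fun s => ν * (s - l)) s₀ := by fun_prop
  unfold StrictLocMax at hmax
  beta_reduce at hmax hpos
  rcases lt_trichotomy (u s₀) (ν * (s₀ - l)) with hlt | heq | hgt
  · rw [min_eq_left hlt.le] at hpos ⊢
    refine hsub φ hφ s₀ hs₀ ?_ hpos
    unfold StrictLocMax
    filter_upwards [hmax, (huc.eventually_lt hLc hlt).filter_mono nhdsWithin_le_nhds] with s h1 h2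
    rw [min_eq_left hlt.le, min_eq_left h2.le] at h1
    exact h1
  · have hm : min (u s₀) (ν * (s₀ - l)) = u s₀ := min_eq_left heq.le
    rw [hm] at hpos hmax ⊢
    by_contra! hcon
    obtain ⟨p, hp⟩ : ∃ p, p = deriv φ s₀ := ⟨_, rfl⟩
    rw [← hp] at hcon
    have hfac : 0 < (p - ν) * (d * (p + ν) - s₀) := by nlinarith
    rcases pos_and_pos_or_neg_and_neg_of_mul_pos hfac with ⟨ha, hb⟩ | ⟨ha, hb⟩
    · obtain ⟨q, hq1, hq2⟩ : ∃ q, max ν (s₀ / d - ν) < q ∧ q < p := by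
        apply exists_between
        apply max_lt (by linarith)
        have : s₀ / d < p + ν := by rw [div_lt_iff₀ hd]; linarith
        linarith
      have hq3 := (le_max_left _ _).trans_lt hq1
      have hq4 : s₀ < (q + ν) * d := by
        rw [← div_lt_iff₀ hd]; linarith [(le_max_right _ _).trans_lt hq1]
      have hP : ∀ᶠ t in 𝓝 s₀, t ∈ Ioo l l' ∧ 0 < u t ∧ t < 2 * d * q ∧
          0 < u t - t * q + d * q ^ 2 + c := by
        refine hI.and ((huc.eventually (lt_mem_nhds hpos)).and ((gt_mem_nhds ?_).and ?_))
        · nlinarith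
        · have hk : ContinuousAt (fun t => u t - t * q + d * q ^ 2 + c) s₀ := by fun_prop
          refine hk.eventually (lt_mem_nhds ?_)
          have : 0 < (q - ν) * ((q + ν) * d - s₀) := mul_pos (by linarith) (by linarith)
          nlinarith
      obtain ⟨t, ψ, ⟨hP1, hP2, hP3, hP4⟩, h2, h3, h4⟩ := touchA u s₀ q _ huc' hP (by
        have hmax' := hmax.filter_mono (nhdsWithin_mono s₀ (fun s (hs : s < s₀) => hs.ne))
        filter_upwards [hmax', slopeL φ s₀ q hφd (by linarith), self_mem_nhdsWithin]
          with s h1 h2 h3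
        have h3 : s < s₀ := h3
        rcases min_choice (u s) (ν * (s - l)) with h | h
        · rw [h] at h1; linarith
        · rw [h] at h1; nlinarith)
      have := hsub ψ h2 t hP1 h4 hP2
      nlinarith [mul_nonneg (sub_nonneg.2 h3) (show 0 ≤ d * (deriv ψ t + q) - t by nlinarith)]
    · obtain ⟨q, hq1, hq2⟩ : ∃ q, p < q ∧ q < min ν (s₀ / d - ν) := by
        apply exists_between
        apply lt_min (by linarith)
        have : p + ν < s₀ / d := by rw [lt_div_iff₀ hd]; linarith
        linarith
      have hq3 := hq2.trans_le (min_le_left _ _)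
      have hq4 : (q + ν) * d < s₀ := by
        rw [← lt_div_iff₀ hd]; linarith [hq2.trans_le (min_le_right _ _)]
      have hP : ∀ᶠ t in 𝓝 s₀, t ∈ Ioo l l' ∧ 0 < u t ∧ 2 * d * q < t ∧
          0 < u t - t * q + d * q ^ 2 + c := by
        refine hI.and ((huc.eventually (lt_mem_nhds hpos)).and ((lt_mem_nhds ?_).and ?_))
        · nlinarith
        · have hk : ContinuousAt (fun t => u t - t * q + d * q ^ 2 + c) s₀ := by fun_prop
          refine hk.eventually (lt_mem_nhds ?_)
          have : 0 < (ν - q) * (s₀ - (q + ν) * d) := mul_pos (by linarith) (by linarith)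
          nlinarith
      obtain ⟨t, ψ, ⟨hP1, hP2, hP3, hP4⟩, h2, h3, h4⟩ := touchB u s₀ q _ huc' hP (by
        have hmax' := hmax.filter_mono (nhdsWithin_mono s₀ (fun s (hs : s₀ < s) => hs.ne'))
        filter_upwards [hmax', slopeR φ s₀ q hφd (by linarith), self_mem_nhdsWithin]
          with s h1 h2 h3
        have h3 : s₀ < s := h3
        rcases min_choice (u s) (ν * (s - l)) with h | h
        · rw [h] at h1; linarith
        · rw [h] at h1; nlinarith)
      have := hsub ψ h2 t hP1 h4 hP2
      nlinarith [mul_nonneg (sub_nonneg.2 h3) (show 0 ≤ t - d * (deriv ψ t + q) by nlinarith)]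
  · rw [min_eq_right hgt.le] at hpos ⊢
    have hlm : IsLocalMax (fun s => ν * (s - l) - φ s) s₀ := by
      rw [eventually_nhdsWithin_iff] at hmax
      filter_upwards [hmax, hLc.eventually_lt huc hgt] with s h1 h2
      by_cases h : s = s₀
      · rw [h]
      · have := h1 h
        rw [min_eq_right hgt.le, min_eq_right h2.le] at this
        exact this.le
    have hd1 : HasDerivAt (fun s => ν * (s - l)) ν s₀ := by
      simpa using ((hasDerivAt_id s₀).sub_const l).const_mul ν
    have := hlm.hasDerivAt_eq_zero (hd1.sub hφd.hasDerivAt)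
    have : deriv φ s₀ = ν := by linarith
    rw [this]
    nlinarith

lemma coreSuper (d c l l' ν : ℝ) (hν0 : 0 ≤ ν) (hν : d * ν ^ 2 - l * ν + c = 0)
    (u : ℝ → ℝ) (hc : ContinuousOn u (Icc l l'))
    (hs : IsViscSuper d (fun _ => c) (Ioo l l') u) :
    IsViscSuper d (fun _ => c) (Ioo l l') (fun s => min (u s) (ν * (s - l))) := by
  have hcI : ContinuousOn u (Ioo l l') := hc.mono Ioo_subset_Icc_self
  have hmin : ContinuousOn (fun s => min (u s) (ν * (s - l))) (Ioo l l') :=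
    ContinuousOn.inf hcI (by fun_prop)
  refine ⟨hmin.lowerSemicontinuousOn, fun s h => le_min (hs.2.1 s h)
    (mul_nonneg hν0 (by linarith [h.1])), ?_⟩
  intro φ hφ s₀ hs₀ hm
  have hsup := hs.2.2
  simp only [uscEnv, limsup_const] at hsup ⊢
  have hφd : DifferentiableAt ℝ φ s₀ := hφ.differentiable (by norm_num) s₀
  unfold StrictLocMin at hm
  beta_reduce at hm
  rcases le_total (u s₀) (ν * (s₀ - l)) with h | h
  · rw [min_eq_left h] at hm ⊢
    refine hsup φ hφ s₀ hs₀ ?_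
    unfold StrictLocMin
    filter_upwards [hm] with s h1
    linarith [min_le_left (u s) (ν * (s - l))]
  · rw [min_eq_right h] at hm ⊢
    have hlm : IsLocalMin (fun s => ν * (s - l) - φ s) s₀ := by
      rw [eventually_nhdsWithin_iff] at hm
      filter_upwards [hm] with s h1
      by_cases h : s = s₀
      · rw [h]
      · have := h1 h
        linarith [min_le_right (u s) (ν * (s - l))]
    have hd1 : HasDerivAt (fun s => ν * (s - l)) ν s₀ := by
      simpa using ((hasDerivAt_id s₀).sub_const l).const_mul ν
    have := hlm.hasDerivAt_eq_zero (hd1.sub hφd.hasDerivAt)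
    have : deriv φ s₀ = ν := by linarith
    rw [this]
    nlinarith

theorem min_with_linear_is_subsolution (d3 r3 a32 : ℝ)
    (hd3 : 0 < d3) (hr3 : 0 < r3) (ha32 : 0 ≤ a32) (ha32' : a32 < 1)
    (l l' : ℝ) (hl : 2 * Real.sqrt (d3 * r3 * (1 - a32)) ≤ l) (hll : l < l')
    (ν1 : ℝ) (hν1 : ν1 = (l + Real.sqrt (l ^ 2 - 4 * d3 * r3 * (1 - a32))) / (2 * d3))
    (ρ0 : ℝ → ℝ)
    (hρ0nn : ∀ s ∈ Set.Icc l l', 0 ≤ ρ0 s)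
    (hρ0c : ContinuousOn ρ0 (Set.Icc l l'))
    (hρ0sol : IsViscSol d3 (fun _ => r3 * (1 - a32)) (Set.Ioo l l') ρ0) :
    IsViscSub d3 (fun _ => r3 * (1 - a32)) (Set.Ioo l l')
      (fun s => min (ρ0 s) (ν1 * (s - l))) ∧
    (ρ0 l' ≤ ν1 * (l' - l) →
      IsViscSol d3 (fun _ => r3 * (1 - a32)) (Set.Ioo l l')
        (fun s => min (ρ0 s) (ν1 * (s - l)))) := by
  have hl0 : 0 ≤ l := le_trans (by positivity) hl
  have hc0 : 0 ≤ d3 * r3 * (1 - a32) := by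
    have : 0 ≤ 1 - a32 := by linarith
    positivity
  have hD : 0 ≤ l ^ 2 - 4 * d3 * r3 * (1 - a32) := by
    have h1 := Real.sq_sqrt hc0
    have h2 := Real.sqrt_nonneg (d3 * r3 * (1 - a32))
    nlinarith
  have hsq := Real.sq_sqrt hD
  have hν0 : 0 ≤ ν1 := by rw [hν1]; positivity
  have hν : d3 * ν1 ^ 2 - l * ν1 + r3 * (1 - a32) = 0 := by
    have e : Real.sqrt (l ^ 2 - 4 * d3 * r3 * (1 - a32)) = 2 * d3 * ν1 - l := by
      rw [hν1]; field_simp; ring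
    rw [e] at hsq
    have : 4 * d3 * (d3 * ν1 ^ 2 - l * ν1 + r3 * (1 - a32)) = 0 := by linarith
    rcases mul_eq_zero.1 this with h | h
    · linarith
    · exact h
  have hsub := coreSub d3 _ l l' ν1 hd3 hν ρ0 hρ0c hρ0sol.2
  exact ⟨hsub, fun _ => ⟨coreSuper d3 _ l l' ν1 hν0 hν ρ0 hρ0c hρ0sol.1, hsub⟩⟩
end
end

section
/- Let d₃, r₃ > 0 and a ∈ [0,1), and let β, ĉ, ρ̂ be real numbers with 2√(d₃r₃(1 − a)) ≤ β < ĉ and ρ̂ > 0. Define ν₃ := [β + √(β² − 4d₃r₃(1 − a))]/(2d₃), and define s(ĉ) as follows: if ĉ² ≥ 4d₃(r₃(1 − a) + ρ̂), set ν₂ := [ĉ − √(ĉ² − 4d₃(r₃(1 − a) + ρ̂))]/(2d₃) and put s(ĉ) := d₃ν₂ + r₃(1 − a)/ν₂ when both ν₂ ≤ ν₃ and d₃ν₂ν₃ ≤ r₃(1 − a) hold, and s(ĉ) := β otherwise; if ĉ² < 4d₃(r₃(1 − a) + ρ̂), put s(ĉ) := β. Then β ≤ s(ĉ) < ĉ.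 -/
open Filter Set Topology

noncomputable section

theorem algebraic_bounds_on_s_hat_c (d3 r3 a β c ρ0 : ℝ)
    (hd3 : 0 < d3) (hr3 : 0 < r3) (ha0 : 0 ≤ a) (ha1 : a < 1)
    (hβ : 2 * Real.sqrt (d3 * r3 * (1 - a)) ≤ β) (hβc : β < c) (hρ0 : 0 < ρ0)
    (ν3 : ℝ) (hν3 : ν3 = (β + Real.sqrt (β ^ 2 - 4 * d3 * r3 * (1 - a))) / (2 * d3))
    (ν2 : ℝ) (hν2 : ν2 = (c - Real.sqrt (c ^ 2 - 4 * d3 * (r3 * (1 - a) + ρ0))) / (2 * d3))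
    (sc : ℝ)
    (hsc : sc = if 4 * d3 * (r3 * (1 - a) + ρ0) ≤ c ^ 2 then
        (if ν2 ≤ ν3 ∧ d3 * ν2 * ν3 ≤ r3 * (1 - a) then d3 * ν2 + r3 * (1 - a) / ν2 else β)
      else β) :
    β ≤ sc ∧ sc < c := by
  have hK : 0 < r3 * (1 - a) := mul_pos hr3 (by linarith)
  have hdK : 0 < d3 * r3 * (1 - a) := by
    rw [mul_assoc]; exact mul_pos hd3 hK
  have hβ0 : 0 < β := by
    have := Real.sqrt_pos.2 hdK
    linarith
  have hc0 : 0 < c := hβ0.trans hβc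
  split_ifs at hsc with h1 h2
  · obtain ⟨h2, h3⟩ := h2
    have hD : 0 ≤ β ^ 2 - 4 * d3 * r3 * (1 - a) := by
      have e := Real.sq_sqrt hdK.le
      have p := Real.sqrt_nonneg (d3 * r3 * (1 - a))
      nlinarith
    have e3 := Real.sq_sqrt hD
    have p3 := Real.sqrt_nonneg (β ^ 2 - 4 * d3 * r3 * (1 - a))
    have e2 := Real.sq_sqrt (sub_nonneg.2 h1)
    have l2 : Real.sqrt (c ^ 2 - 4 * d3 * (r3 * (1 - a) + ρ0)) < c := by
      rw [Real.sqrt_lt' hc0]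
      have : 0 < d3 * (r3 * (1 - a) + ρ0) := by positivity
      linarith
    generalize Real.sqrt (β ^ 2 - 4 * d3 * r3 * (1 - a)) = t3 at *
    generalize Real.sqrt (c ^ 2 - 4 * d3 * (r3 * (1 - a) + ρ0)) = t2 at *
    have hν3p : 0 < ν3 := by rw [hν3]; positivity
    have hν2p : 0 < ν2 := by rw [hν2]; exact div_pos (by linarith) (by linarith)
    have q3 : d3 * ν3 ^ 2 + r3 * (1 - a) = β * ν3 := by
      rw [hν3]; field_simp; linear_combination e3
    have q2 : d3 * ν2 ^ 2 + r3 * (1 - a) = c * ν2 - ρ0 := by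
      rw [hν2]; field_simp; linear_combination e2
    have hs : sc * ν2 = d3 * ν2 ^ 2 + r3 * (1 - a) := by
      rw [hsc]; field_simp
    constructor
    · have hm := mul_nonneg (sub_nonneg.2 h2) (sub_nonneg.2 h3)
      have : β * (ν2 * ν3) ≤ sc * (ν2 * ν3) := by
        have a1 : β * (ν2 * ν3) = (d3 * ν3 ^ 2 + r3 * (1 - a)) * ν2 := by rw [q3]; ring
        have a2 : sc * (ν2 * ν3) = (d3 * ν2 ^ 2 + r3 * (1 - a)) * ν3 := by rw [← hs]; ring
        rw [a1, a2]
        linarith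
      exact le_of_mul_le_mul_right this (mul_pos hν2p hν3p)
    · refine lt_of_mul_lt_mul_right (a := ν2) ?_ hν2p.le
      linarith
  · exact ⟨hsc.ge, hsc ▸ hβc⟩
  · exact ⟨hsc.ge, hsc ▸ hβc⟩
end
end

section
/- In the setting of the nlp-problem with c₂ > σ₃(λ), one has s_nlp ≥ 2√(d₃r₃(1 − a₃₂)). If moreover a₃₁ < a₃₂ and 2√(d₃r₃) < c₂ < c₁ < 2√(d₃r₃)·(√a₃₂ + √(1 − a₃₂)), then s_nlp > 2√(d₃r₃(1 − a₃₂)). -/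
open Filter Set Topology

noncomputable section

/-- A solution of the nlp-problem: continuous viscosity solution on `(0,∞)` of the
variational inequality with `R(s) = r₃(1 - a₃₁·1_{[c₂,c₁]}(s) - a₃₂·1_{(0,c₂]}(s))`,
vanishing at `0` with linear growth rate `lam` at infinity. -/
def NlpSol (d3 r3 a31 a32 c1 c2 lam : ℝ) (ρ : ℝ → ℝ) : Prop :=
  ContinuousOn ρ (Set.Ici 0) ∧
    IsViscSol d3
      (fun s => r3 * (1 - a31 * (if c2 ≤ s ∧ s ≤ c1 then 1 else 0)
        - a32 * (if 0 < s ∧ s ≤ c2 then 1 else 0))) (Set.Ioi 0) ρ ∧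
    ρ 0 = 0 ∧ Filter.Tendsto (fun s => ρ s / s) Filter.atTop (𝓝 lam)


lemma touch_aux (ρ : ℝ → ℝ) (a b k : ℝ) (hab : a < b) (hc : ContinuousOn ρ (Icc a b))
    (h : ρ b - ρ a < k * (b - a)) :
    ∃ c ∈ Ioo a b, ∃ φ : ℝ → ℝ, ContDiff ℝ 1 φ ∧ StrictLocMax (fun s => ρ s - φ s) c ∧
      deriv φ c < k ∧ ρ b + k * (c - b) < ρ c := by
  set g : ℝ → ℝ := fun s => ρ s - k * s with hg
  have hgc : ContinuousOn g (Icc a b) := hc.sub (by fun_prop)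
  have hgab : g b < g a := by simp only [hg]; linarith
  -- a point near `a`
  obtain ⟨e, heab, hge⟩ : ∃ e ∈ Ioo a b, (g a + g b) / 2 < g e := by
    have h1 : ContinuousWithinAt g (Icc a b) a := hgc a (left_mem_Icc.2 hab.le)
    have h2 : ContinuousWithinAt g (Ioo a b) a := h1.mono Ioo_subset_Icc_self
    have h3 : ∀ᶠ s in 𝓝[Ioo a b] a, (g a + g b) / 2 < g s :=
      h2.eventually (lt_mem_nhds (by linarith))
    have : (𝓝[Ioo a b] a).NeBot := by
      rw [← mem_closure_iff_nhdsWithin_neBot, closure_Ioo hab.ne]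
      exact left_mem_Icc.2 hab.le
    obtain ⟨e, he1, he2⟩ := (h3.and self_mem_nhdsWithin).exists
    exact ⟨e, he2, he1⟩
  set M : ℝ := g a - g b + 1 with hM
  have hMpos : 0 < M := by linarith
  have hba : 0 < b - a := by linarith
  set x : ℝ := (b - e) / (b - a) with hx
  have hx0 : 0 ≤ x := div_nonneg (by linarith [heab.2]) hba.le
  have hx1 : x < 1 := by rw [hx, div_lt_one hba]; linarith [heab.1]
  obtain ⟨n, hn⟩ := exists_pow_lt_of_lt_one (show 0 < (g a - g b) / 2 / M by
    apply div_pos _ hMpos; linarith) hx1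
  rw [lt_div_iff₀ hMpos] at hn
  set m := n + 1 with hm
  have hxm : M * x ^ m < (g a - g b) / 2 := by
    have : x ^ m ≤ x ^ n := pow_le_pow_of_le_one hx0 hx1.le (by omega)
    nlinarith
  set ψ : ℝ → ℝ := fun s => M * ((b - s) / (b - a)) ^ m with hψ
  have hψc : ContDiff ℝ 1 ψ := by
    simp only [hψ]; fun_prop
  obtain ⟨c, hcm, hcmax⟩ := isCompact_Icc.exists_isMaxOn (nonempty_Icc.2 hab.le)
    (hgc.sub hψc.continuous.continuousOn)
  have hmax : ∀ s ∈ Icc a b, g s - ψ s ≤ g c - ψ c := fun s hs => hcmax hs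
  have hψa : ψ a = M := by simp [hψ, hba.ne']
  have hψb : ψ b = 0 := by simp [hψ, hm]
  have hee := hmax e ⟨heab.1.le, heab.2.le⟩
  have hψe : ψ e < (g a - g b) / 2 := hxm
  have hca : c ≠ a := by
    rintro rfl
    linarith
  have hcb : c ≠ b := by
    rintro rfl
    linarith
  have hcI : c ∈ Ioo a b := ⟨lt_of_le_of_ne hcm.1 (Ne.symm hca), lt_of_le_of_ne hcm.2 hcb⟩
  have hy : 0 < (b - c) / (b - a) := div_pos (by linarith [hcI.2]) hba
  have hψcpos : 0 < ψ c := mul_pos hMpos (pow_pos hy _)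
  refine ⟨c, hcI, fun s => ψ s + k * s + (s - c) ^ 2, ?_, ?_, ?_, ?_⟩
  · fun_prop
  · have h1 : ∀ᶠ s in 𝓝[≠] c, s ∈ Ioo a b :=
      nhdsWithin_le_nhds (Ioo_mem_nhds hcI.1 hcI.2)
    filter_upwards [h1, self_mem_nhdsWithin] with s hs hsc
    have h2 := hmax s ⟨hs.1.le, hs.2.le⟩
    have h3 : 0 < (s - c) ^ 2 := by
      have : s - c ≠ 0 := sub_ne_zero.2 hsc
      positivity
    simp only [hg] at h2
    simp only [sub_self]
    linarith [h2]
  · have hd : HasDerivAt (fun s => ψ s + k * s + (s - c) ^ 2)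
        (M * (m * ((b - c) / (b - a)) ^ (m - 1) * (-1 / (b - a))) + k * 1
          + (2 * (c - c) ^ (2 - 1) * 1)) c := by
      refine ((HasDerivAt.const_mul M ?_).add ((hasDerivAt_id c).const_mul k)).add ?_
      · have := (((hasDerivAt_id c).const_sub b).div_const (b - a)).pow m
        exact this
      · have := (((hasDerivAt_id c).sub_const c)).pow 2
        refine HasDerivAt.congr_deriv (f := fun s => (s - c) ^ 2) this ?_
        simp
    rw [hd.deriv]
    have : 0 < M * (m * ((b - c) / (b - a)) ^ (m - 1) * (1 / (b - a))) := by
      have : (0:ℝ) < m := by simp [hm]; positivity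
      positivity
    rw [neg_div]
    simp
    simp at this
    linarith
  · have := hmax b (right_mem_Icc.2 hab.le)
    simp only [hg] at this
    linarith

lemma key_aux (d : ℝ) (R ρ : ℝ → ℝ) (B R0 a b k : ℝ) (hB : ∀ s, R s ≤ B) (ha : 0 ≤ a)
    (hab : a < b) (hc : ContinuousOn ρ (Ici 0)) (hsub : IsViscSub d R (Ioi 0) ρ)
    (hpos : ∀ s ∈ Ioo a b, 0 < ρ s) (hR : ∀ s ∈ Ioo a b, R0 ≤ R s)
    (h : ρ b - ρ a < k * (b - a)) :
    ∃ c ∈ Ioo a b, ∃ p < k, ρ b + k * (c - b) < ρ c ∧ ρ c - c * p + d * p ^ 2 + R0 ≤ 0 := by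
  obtain ⟨c, hcI, φ, h1, h2, h3, h4⟩ := touch_aux ρ a b k hab
    (hc.mono fun s hs => ha.trans hs.1) h
  refine ⟨c, hcI, deriv φ c, h3, h4, ?_⟩
  have h5 := hsub.2 φ h1 c (lt_of_le_of_lt ha hcI.1) h2 (hpos c hcI)
  have h6 : R0 ≤ lscEnv R c := by
    unfold lscEnv
    refine le_liminf_of_le ?_ ?_
    · exact (isBoundedUnder_of ⟨B, hB⟩ : IsBoundedUnder (· ≤ ·) (𝓝 c) R).isCoboundedUnder_ge
    · filter_upwards [Ioo_mem_nhds hcI.1 hcI.2] with s hs using hR s hs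
  linarith

set_option maxHeartbeats 1000000 in
theorem snlp_lower_bounds (d3 r3 a31 a32 c1 c2 lam : ℝ)
    (hd3 : 0 < d3) (hr3 : 0 < r3) (ha31 : 0 ≤ a31) (ha32 : 0 ≤ a32)
    (hsum : a31 + a32 < 1) (hc2 : 0 < c2) (hc12 : c2 < c1) (hlam : 0 < lam)
    (hσc2 : (if lam < Real.sqrt (r3 / d3) then d3 * lam + r3 / lam
      else 2 * Real.sqrt (d3 * r3)) < c2)
    (ρ : ℝ → ℝ) (hρ : NlpSol d3 r3 a31 a32 c1 c2 lam ρ)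
    (snlp : ℝ) (hsnlp : snlp = sSup {s : ℝ | 0 ≤ s ∧ ρ s = 0}) :
    2 * Real.sqrt (d3 * r3 * (1 - a32)) ≤ snlp ∧
    (a31 < a32 → 2 * Real.sqrt (d3 * r3) < c2 →
      c1 < 2 * Real.sqrt (d3 * r3) * (Real.sqrt a32 + Real.sqrt (1 - a32)) →
      2 * Real.sqrt (d3 * r3 * (1 - a32)) < snlp) := by
  obtain ⟨hcont, ⟨hsuper, hsub⟩, hρ0, hlim⟩ := hρ
  set R : ℝ → ℝ := (fun s => r3 * (1 - a31 * (if c2 ≤ s ∧ s ≤ c1 then 1 else 0)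
        - a32 * (if 0 < s ∧ s ≤ c2 then 1 else 0))) with hRdef
  have hRB : ∀ s, R s ≤ r3 := by
    intro s
    simp only [hRdef]
    split_ifs <;> nlinarith [mul_nonneg hr3.le ha31, mul_nonneg hr3.le ha32]
  have hRlow : ∀ s, 0 < s → s < c2 → r3 * (1 - a32) ≤ R s := by
    intro s h1 h2
    have e1 : ¬ (c2 ≤ s ∧ s ≤ c1) := fun h => absurd h.1 (not_le.2 h2)
    have e2 : 0 < s ∧ s ≤ c2 := ⟨h1, h2.le⟩
    simp only [hRdef, if_neg e1, if_pos e2]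
    linarith
  have hRmid : a31 < a32 → ∀ s, c2 < s → r3 * (1 - a32) ≤ R s := by
    intro h s h1
    have e2 : ¬ (0 < s ∧ s ≤ c2) := fun h => absurd h.2 (not_le.2 h1)
    simp only [hRdef, if_neg e2]
    split_ifs <;> nlinarith
  have hRhigh : ∀ s, c1 < s → r3 ≤ R s := by
    intro s h1
    have e1 : ¬ (c2 ≤ s ∧ s ≤ c1) := fun h => absurd h.2 (not_le.2 h1)
    have e2 : ¬ (0 < s ∧ s ≤ c2) := fun h => absurd h.2 (not_le.2 (hc12.trans h1))
    simp only [hRdef, if_neg e1, if_neg e2]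
    linarith
  have hR2 : 0 < r3 * (1 - a32) := mul_pos hr3 (by linarith)
  set sb : ℝ := 2 * Real.sqrt (d3 * r3 * (1 - a32)) with hsb
  have hsb0 : 0 < sb := by
    have : 0 < d3 * r3 * (1 - a32) := by rw [mul_assoc]; exact mul_pos hd3 hR2
    positivity
  have hsbsq : sb ^ 2 = 4 * d3 * (r3 * (1 - a32)) := by
    rw [hsb, mul_pow, Real.sq_sqrt (by rw [mul_assoc]; exact (mul_pos hd3 hR2).le)]
    ring
  have hσ : 2 * Real.sqrt (d3 * r3) < c2 := by
    refine lt_of_le_of_lt ?_ hσc2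
    split_ifs
    · have e : (2 * Real.sqrt (d3 * r3)) ^ 2 ≤ (d3 * lam + r3 / lam) ^ 2 := by
        rw [mul_pow, Real.sq_sqrt (by positivity)]
        have : d3 * lam * (r3 / lam) = d3 * r3 := by field_simp
        nlinarith [sq_nonneg (d3 * lam - r3 / lam)]
      exact le_of_sq_le_sq e (by positivity)
    · exact le_rfl
  have hsbc2 : sb < c2 := by
    refine lt_of_le_of_lt ?_ hσ
    rw [hsb]
    have : Real.sqrt (d3 * r3 * (1 - a32)) ≤ Real.sqrt (d3 * r3) := by
      apply Real.sqrt_le_sqrt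
      nlinarith [mul_pos hd3 hr3]
    linarith
  -- the zero set
  have hbdd : BddAbove {s : ℝ | 0 ≤ s ∧ ρ s = 0} := by
    obtain ⟨N, hN⟩ := eventually_atTop.1 (hlim.eventually (lt_mem_nhds hlam))
    refine ⟨N, fun s hs => ?_⟩
    by_contra hlt
    have := hN s (not_le.1 hlt).le
    rw [hs.2] at this
    simp at this
  have hs0 : 0 ≤ snlp := by
    rw [hsnlp]; exact le_csSup hbdd ⟨le_rfl, hρ0⟩
  have hpos : ∀ s, snlp < s → 0 < ρ s := by
    intro s hs
    have h0 : 0 < s := lt_of_le_of_lt hs0 hs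
    refine lt_of_le_of_ne (hsuper.2.1 s h0) fun he => ?_
    have : s ≤ snlp := by rw [hsnlp]; exact le_csSup hbdd ⟨h0.le, he.symm⟩
    linarith
  have hsteep : ∀ a b : ℝ, a < b → ∃ k, ρ b - ρ a < k * (b - a) := by
    intro a b hab
    refine ⟨(ρ b - ρ a + 1) / (b - a), ?_⟩
    rw [div_mul_cancel₀ _ (by linarith : b - a ≠ 0)]
    linarith
  refine ⟨?_, ?_⟩
  · by_contra hlt
    push Not at hlt
    obtain ⟨k, hk⟩ := hsteep snlp sb hlt
    obtain ⟨c, hcI, p, -, -, h2⟩ := key_aux d3 R ρ r3 (r3 * (1 - a32)) snlp sb k hRB hs0 hlt hcont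
      hsub (fun s hs => hpos s hs.1)
      (fun s hs => hRlow s (lt_of_le_of_lt hs0 hs.1) (hs.2.trans hsbc2)) hk
    have h3 := hpos c hcI.1
    have h4 : c ^ 2 < sb ^ 2 := pow_lt_pow_left₀ hcI.2 (hs0.trans hcI.1.le) two_ne_zero
    nlinarith [sq_nonneg (2 * d3 * p - c), mul_pos hd3 h3]
  · intro haa _ hc1
    by_contra hle
    push Not at hle
    have hpos' : ∀ s, sb < s → 0 < ρ s := fun s hs => hpos s (hle.trans_lt hs)
    -- upper bound at c1
    have hup : 4 * d3 * (ρ c1 + r3) ≤ c1 ^ 2 := by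
      by_contra hlt
      push Not at hlt
      have hca : ContinuousAt ρ c1 := hcont.continuousAt (Ici_mem_nhds (hc2.trans hc12))
      have hev : ∀ᶠ s in 𝓝 c1, s ^ 2 < 4 * d3 * (ρ s + r3) :=
        ContinuousAt.eventually_lt (f := fun s : ℝ => s ^ 2)
          (g := fun s => 4 * d3 * (ρ s + r3)) (by fun_prop)
          (continuousAt_const.mul (hca.add continuousAt_const)) hlt
      obtain ⟨δ, hδ, hball⟩ := Metric.eventually_nhds_iff.1 hev
      obtain ⟨k, hk⟩ := hsteep c1 (c1 + δ) (by linarith)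
      obtain ⟨c, hcI, p, -, -, h2⟩ := key_aux d3 R ρ r3 r3 c1 (c1 + δ) k hRB
        (hc2.trans hc12).le (by linarith) hcont hsub
        (fun s hs => hpos' s ((hsbc2.trans hc12).trans hs.1))
        (fun s hs => hRhigh s hs.1) hk
      have h5 : c ^ 2 < 4 * d3 * (ρ c + r3) := by
        apply hball
        rw [Real.dist_eq, abs_lt]
        constructor <;> linarith [hcI.1, hcI.2]
      nlinarith [sq_nonneg (2 * d3 * p - c)]
    -- the tangent line at sb
    set q : ℝ := sb / (2 * d3) with hq
    have hqd : 2 * d3 * q = sb := by rw [hq]; field_simp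
    have hq0 : 0 < q := by positivity
    have hR2q : r3 * (1 - a32) = d3 * q ^ 2 := by
      have : 4 * d3 * (r3 * (1 - a32)) = 4 * d3 * (d3 * q ^ 2) := by rw [← hsbsq, ← hqd]; ring
      exact mul_left_cancel₀ (by positivity) this
    have hlt : ρ c1 < q * c1 - d3 * q ^ 2 - r3 * (1 - a32) := by
      have hx : c1 - sb < 2 * Real.sqrt (d3 * r3 * a32) := by
        have e1 : sb = 2 * (Real.sqrt (d3 * r3) * Real.sqrt (1 - a32)) := by
          rw [hsb, Real.sqrt_mul (by positivity)]
        have e2 := Real.sqrt_mul (mul_pos hd3 hr3).le a32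
        rw [e1, e2]
        linarith
      have hx2 : (c1 - sb) ^ 2 < 4 * (d3 * r3 * a32) := by
        have := pow_lt_pow_left₀ hx (by linarith) two_ne_zero
        rw [mul_pow, Real.sq_sqrt (by positivity)] at this
        linarith
      have : 4 * d3 * ρ c1 < 4 * d3 * (q * c1 - d3 * q ^ 2 - r3 * (1 - a32)) := by
        have e : 4 * d3 * (q * c1 - d3 * q ^ 2 - r3 * (1 - a32))
          = 2 * sb * c1 - sb ^ 2 - 4 * d3 * (r3 * (1 - a32)) := by rw [← hqd]; ring
        rw [e]
        nlinarith
      exact lt_of_mul_lt_mul_left this (by positivity)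
    have hρc1 : 0 < ρ c1 := hpos' c1 (hsbc2.trans hc12)
    obtain ⟨p, hpI, hp⟩ : ∃ p ∈ Ioo 0 q, p * c1 - d3 * p ^ 2 - r3 * (1 - a32) = ρ c1 := by
      have hcn : ContinuousOn (fun p : ℝ => p * c1 - d3 * p ^ 2 - r3 * (1 - a32)) (Icc 0 q) := by
        fun_prop
      have := intermediate_value_Ioo hq0.le hcn
      obtain ⟨p, hpI, hp⟩ := this (show ρ c1 ∈ _ from ⟨by simp; linarith, hlt⟩)
      exact ⟨p, hpI, hp⟩
    have hp0 := hpI.1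
    have hpq := hpI.2
    set z : ℝ := d3 * p + r3 * (1 - a32) / p with hz
    have hpz : p * z - d3 * p ^ 2 - r3 * (1 - a32) = 0 := by rw [hz]; field_simp; ring
    have hzsb : sb < z := by
      have : p * sb < p * z := by
        have e : p * z = d3 * p ^ 2 + d3 * q ^ 2 := by linarith
        rw [e, ← hqd]
        nlinarith [mul_pos hd3 (pow_pos (sub_pos.2 hpq) 2)]
      exact lt_of_mul_lt_mul_left this hp0.le
    have hzc1 : z < c1 := by
      have : p * z < p * c1 := by linarith
      exact lt_of_mul_lt_mul_left this hp0.le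
    set g : ℝ → ℝ := fun s => ρ s - (p * s - d3 * p ^ 2 - r3 * (1 - a32)) with hg
    have hgz : 0 < g z := by
      simp only [hg]; rw [hpz]; linarith [hpos' z hzsb]
    have hgc1 : g c1 = 0 := by simp only [hg]; linarith
    have hz0 : 0 < z := hsb0.trans hzsb
    -- contradiction on an interval on which R is at least its low value
    have main : ∀ a b : ℝ, z ≤ a → a < b → 0 < g a → g b = 0 →
        (∀ s ∈ Ioo a b, r3 * (1 - a32) ≤ R s) → False := by
      intro a b hza hab hga hgb hRab
      simp only [hg] at hga hgb
      obtain ⟨c, hcI, p', hp', h1, h2⟩ := key_aux d3 R ρ r3 (r3 * (1 - a32)) a b p hRB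
        (by linarith) hab hcont hsub
        (fun s hs => hpos' s (by linarith [hs.1])) hRab (by linarith)
      have hcs : sb < c := by linarith [hcI.1]
      have h3 : 0 < (p - p') * (c - d3 * (p + p')) := by
        apply mul_pos (by linarith)
        have e1 := mul_pos hd3 (sub_pos.2 hpq)
        have e2 := mul_pos hd3 (sub_pos.2 hp')
        linarith
      linarith
    by_cases hz2 : c2 ≤ z
    · exact main z c1 le_rfl hzc1 hgz hgc1 (fun s hs => hRmid haa s (by linarith [hs.1]))
    · push Not at hz2
      by_cases hg2 : 0 < g c2
      · exact main c2 c1 hz2.le hc12 hg2 hgc1 (fun s hs => hRmid haa s hs.1)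
      · push Not at hg2
        have hgc : ContinuousOn g (Icc z c2) :=
          (hcont.mono fun s hs => hz0.le.trans hs.1).sub (by fun_prop)
        obtain ⟨t, ht, hgt⟩ := intermediate_value_Icc' hz2.le hgc ⟨hg2, hgz.le⟩
        have hzt : z < t := by
          refine lt_of_le_of_ne ht.1 ?_
          rintro e
          rw [← e] at hgt
          linarith
        exact main z t le_rfl hzt hgz hgt
          (fun s hs => hRlow s (hz0.trans hs.1) (lt_of_lt_of_le hs.2 ht.2))
end
end

section
/- Fix d₃, r₃ > 0, a₃₁, a₃₂ ≥ 0 with a₃₁ + a₃₂ < 1 and 0 < c₂ < c₁, and let R(s) := r₃·(1 − a₃₁·1_{[c₂,c₁]}(s) − a₃₂·1_{(0,c₂]}(s)). Let 0 < λ₁ ≤ λ₂ < ∞ and for i = 1, 2 let ρ^{λᵢ} be a continuous viscosity solution of min{ρ − s·ρ′ + d₃·(ρ′)² + R(s), ρ} = 0 on (0,∞) with ρ^{λᵢ}(0) = 0 and ρ^{λᵢ}(s)/s → λᵢ as s → ∞. Then ρ^{λ₁}(s) ≤ ρ^{λ₂}(s) for all s ≥ 0, and consequently sup{s ≥ 0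 : ρ^{λ₂}(s) = 0} ≤ sup{s ≥ 0 : ρ^{λ₁}(s) = 0}; that is, the free boundary point s_nlp(c₁, c₂, λ) is non-increasing in λ. -/
open Filter Set Topology

noncomputable section

theorem quad_deriv (a b c x : ℝ) :
    HasDerivAt (fun s => a * (s - c) + b * (s - c) ^ 2) (a + 2 * b * (x - c)) x := by
  have h1 := ((hasDerivAt_id x).sub_const c)
  have h2 := (h1.const_mul a).add ((h1.pow 2).const_mul b)
  refine h2.congr_deriv ?_
  simp; ring

theorem aux_left (f φ : ℝ → ℝ) (c : ℝ) (hf : ∀ᶠ s in 𝓝 c, ContinuousAt f s)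
    (hφ : ContDiff ℝ 1 φ) (hmax : IsLocalMax (fun s => f s - φ s) c) :
    (∀ M, 0 ≤ M → ∃ ψ : ℝ → ℝ, ContDiff ℝ 1 ψ ∧ deriv ψ c = deriv φ c + M ∧
      IsLocalMax (fun s => f s - ψ s) c) ∨
    (∃ l, 0 ≤ l ∧ ∀ κ, 0 < κ → ∃ x, c - κ < x ∧ x < c ∧ ∃ ψ : ℝ → ℝ, ContDiff ℝ 1 ψ ∧
      IsLocalMax (fun s => f s - ψ s) x ∧ |deriv ψ x - (deriv φ c + l)| ≤ κ) := by
  have hφd : ∀ x, HasDerivAt φ (deriv φ x) x := fun x =>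
    (hφ.differentiable (by norm_num) x).hasDerivAt
  have hφc : Continuous (deriv φ) := hφ.continuous_deriv (by norm_num)
  set g : ℝ → ℝ := fun s => f s - φ s - (f c - φ c) with hg
  have hgle : ∀ᶠ s in 𝓝 c, g s ≤ 0 := by
    filter_upwards [hmax] with s hs
    simp only [hg]; linarith
  set S : Set ℝ := {μ | 0 ≤ μ ∧ ∀ᶠ s in 𝓝[<] c, g s ≤ μ * (s - c)} with hS
  have h0 : (0:ℝ) ∈ S := by
    refine ⟨le_rfl, ?_⟩
    filter_upwards [hgle.filter_mono nhdsWithin_le_nhds] with s hs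
    simpa using hs
  have hdown : ∀ μ ∈ S, ∀ ν, ν ≤ μ → ∀ᶠ s in 𝓝[<] c, g s ≤ ν * (s - c) := by
    intro μ hμ ν hν
    filter_upwards [hμ.2, self_mem_nhdsWithin] with s hs hsc
    have : s < c := hsc
    nlinarith
  by_cases hb : BddAbove S
  · right
    refine ⟨sSup S, le_csSup hb h0, ?_⟩
    set l := sSup S with hl
    intro κ hκ
    set ι := κ / 20 with hι
    have hιp : 0 < ι := by positivity
    obtain ⟨μ, hμS, hμ⟩ := exists_lt_of_lt_csSup ⟨0, h0⟩ (show l - ι < sSup S by linarith)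
    have e1 := hdown μ hμS (l - ι) hμ.le
    have e2 : ∃ᶠ s in 𝓝[<] c, (l + ι / 2) * (s - c) < g s := by
      intro hcon
      have : l + ι / 2 ∈ S := by
        refine ⟨by have := le_csSup hb h0; linarith, ?_⟩
        filter_upwards [hcon] with s hs
        exact not_lt.mp hs
      have := le_csSup hb this
      linarith
    have e3 : ∀ᶠ s in 𝓝 c, |deriv φ s - deriv φ c| < κ / 2 := by
      have := Metric.continuousAt_iff'.mp (hφc.continuousAt (x := c)) (κ/2) (by positivity)
      simpa [Real.dist_eq] using this
    rw [eventually_nhdsWithin_iff] at e1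
    obtain ⟨h, hh, hball⟩ := Metric.eventually_nhds_iff.mp (hf.and (e1.and e3))
    set h' := min (h / 2) (κ / 2) with hh'
    have hh'p : 0 < h' := by positivity
    have hh1 : h' < h := lt_of_le_of_lt (min_le_left _ _) (by linarith)
    have hh2 : h' < κ := lt_of_le_of_lt (min_le_right _ _) (by linarith)
    have hP : ∀ s, c - h' ≤ s → s ≤ c → ContinuousAt f s ∧ (s < c → g s ≤ (l - ι) * (s - c)) ∧
        |deriv φ s - deriv φ c| < κ / 2 := by
      intro s h1 h2
      have := hball (y := s) (by rw [Real.dist_eq, abs_lt]; constructor <;> linarith)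
      exact ⟨this.1, this.2.1, this.2.2⟩
    set B := 4 * ι / h' with hB
    have hBh : B * h' = 4 * ι := by rw [hB]; field_simp
    have hBp : 0 < B := by positivity
    set ψ : ℝ → ℝ := fun s => φ s + ((l + ι) * (s - c) + B * (s - c) ^ 2) with hψ
    have hψC : ContDiff ℝ 1 ψ := by
      apply hφ.add; fun_prop
    have hψd : ∀ x, deriv ψ x = deriv φ x + ((l + ι) + 2 * B * (x - c)) := by
      intro x
      apply HasDerivAt.deriv
      apply (hφd x).add
      exact quad_deriv (l + ι) B c x
    have hcont : ContinuousOn (fun s => f s - ψ s) (Icc (c - h') c) := by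
      intro s hs
      exact ((hP s hs.1 hs.2).1.sub hψC.continuous.continuousAt).continuousWithinAt
    obtain ⟨x, hx, hxm⟩ := isCompact_Icc.exists_isMaxOn (nonempty_Icc.mpr (by linarith)) hcont
    have e4 : ∀ᶠ s in 𝓝[<] c, c - h' / 8 < s ∧ s < c :=
      Ioo_mem_nhdsLT (by linarith)
    obtain ⟨z, hz1, hz2, hz3⟩ := (e2.and_eventually e4).exists
    have hzx : f z - ψ z ≤ f x - ψ x := hxm (⟨by linarith, hz3.le⟩ : z ∈ Icc (c - h') c)
    have hpos : f c - φ c < f z - ψ z := by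
      simp only [hψ]
      simp only [hg] at hz1
      have : 0 < (c - z) * (ι / 2 - B * (c - z)) := by
        apply mul_pos (by linarith)
        nlinarith
      nlinarith
    have hxc : x < c := by
      rcases hx.2.lt_or_eq with h1 | h1
      · exact h1
      · exfalso
        rw [h1] at hzx
        simp only [hψ] at hzx hpos
        simp at hzx
        linarith
    have hxh : c - h' < x := by
      rcases hx.1.lt_or_eq with h1 | h1
      · exact h1
      · exfalso
        have h2 := (hP x hx.1 hx.2).2.1 hxc
        simp only [hψ, hg] at h2 hzx hpos
        rw [← h1] at h2 hzx
        have : B * (c - h' - c)^2 = 4 * ι * h' := by rw [← hBh]; ring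
        rw [this] at hzx
        nlinarith
    refine ⟨x, by linarith, hxc, ψ, hψC, hxm.isLocalMax (Icc_mem_nhds hxh hxc), ?_⟩
    have h3 := (hP x hx.1 hx.2).2.2
    rw [hψd, abs_le]
    rw [abs_lt] at h3
    have : B * (c - x) ≤ 4 * ι := by rw [← hBh]; apply mul_le_mul_of_nonneg_left _ hBp.le; linarith
    have : 0 ≤ B * (c - x) := mul_nonneg hBp.le (by linarith)
    constructor <;> nlinarith
  · left
    intro M hM
    obtain ⟨μ, hμ, hMμ⟩ := not_bddAbove_iff.mp hb M
    have e1 := hdown μ hμ M hMμ.le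
    rw [eventually_nhdsWithin_iff] at e1
    refine ⟨fun s => φ s + M * (s - c), hφ.add (by fun_prop), ?_, ?_⟩
    · apply HasDerivAt.deriv
      apply (hφd c).add
      simpa using ((hasDerivAt_id c).sub_const c).const_mul M
    · filter_upwards [e1, hgle] with s h1 h2
      simp only [hg] at h1 h2
      rcases lt_or_ge s c with h | h
      · have := h1 h
        simp only [sub_self, mul_zero]; linarith
      · have : 0 ≤ M * (s - c) := mul_nonneg hM (by linarith)
        simp only [sub_self, mul_zero]; linarith

theorem aux_refl (f φ : ℝ → ℝ) (c : ℝ)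
    (hmax : IsLocalMax (fun s => f s - φ s) c) :
    IsLocalMax (fun s => f (-s) - φ (-s)) (-c) := by
  have : Tendsto (fun s : ℝ => -s) (𝓝 (-c)) (𝓝 c) := by
    simpa using (continuous_neg (G := ℝ)).tendsto (-c)
  have h := this.eventually hmax
  filter_upwards [h] with s hs
  simpa using hs

theorem aux_right (f φ : ℝ → ℝ) (c : ℝ) (hf : ∀ᶠ s in 𝓝 c, ContinuousAt f s)
    (hφ : ContDiff ℝ 1 φ) (hmax : IsLocalMax (fun s => f s - φ s) c) :
    (∀ M, 0 ≤ M → ∃ ψ : ℝ → ℝ, ContDiff ℝ 1 ψ ∧ deriv ψ c = deriv φ c - M ∧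
      IsLocalMax (fun s => f s - ψ s) c) ∨
    (∃ l, 0 ≤ l ∧ ∀ κ, 0 < κ → ∃ x, c < x ∧ x < c + κ ∧ ∃ ψ : ℝ → ℝ, ContDiff ℝ 1 ψ ∧
      IsLocalMax (fun s => f s - ψ s) x ∧ |deriv ψ x - (deriv φ c - l)| ≤ κ) := by
  have ht : Tendsto (fun s : ℝ => -s) (𝓝 (-c)) (𝓝 c) := by
    simpa using (continuous_neg (G := ℝ)).tendsto (-c)
  have key := aux_left (fun s => f (-s)) (fun s => φ (-s)) (-c) (by
    filter_upwards [ht.eventually hf] with s hs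
    exact ContinuousAt.comp (f := fun s : ℝ => -s) hs continuous_neg.continuousAt)
    (hφ.comp contDiff_neg) (aux_refl f φ c hmax)
  rcases key with key | ⟨l, hl, key⟩
  · left
    intro M hM
    obtain ⟨ψ, h1, h2, h3⟩ := key M hM
    refine ⟨fun s => ψ (-s), h1.comp contDiff_neg, ?_, ?_⟩
    · rw [deriv_comp_neg] at h2 ⊢
      rw [h2]; simp; ring
    · have := aux_refl _ _ _ h3
      simpa using this
  · right
    refine ⟨l, hl, fun κ hκ => ?_⟩
    obtain ⟨x, hx1, hx2, ψ, h1, h2, h3⟩ := key κ hκ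
    refine ⟨-x, by linarith, by linarith, fun s => ψ (-s), h1.comp contDiff_neg, ?_, ?_⟩
    · have := aux_refl _ _ _ h2
      simpa using this
    · rw [deriv_comp_neg] at h3 ⊢
      rw [← abs_neg]
      convert h3 using 2
      simp; ring

theorem sub_nonstrict {d : ℝ} {R : ℝ → ℝ} {ρ : ℝ → ℝ} (hs : IsViscSub d R (Ioi 0) ρ)
    {U : ℝ} (hRU : ∀ s, R s ≤ U)
    {φ : ℝ → ℝ} (hφ : ContDiff ℝ 1 φ) {x : ℝ} (hx : 0 < x)
    (hmax : IsLocalMax (fun s => ρ s - φ s) x) (hρ : 0 < ρ x) {m : ℝ}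
    (hm : ∀ᶠ s in 𝓝 x, m ≤ R s) :
    ρ x - x * deriv φ x + d * deriv φ x ^ 2 + m ≤ 0 := by
  have hd : deriv (fun s => φ s + (s - x) ^ 2) x = deriv φ x := by
    apply HasDerivAt.deriv
    have h2 := (hφ.differentiable (by norm_num) x).hasDerivAt.add
      (quad_deriv 0 1 x x)
    convert h2 using 1
    · funext s; simp
    · simp
  have h := hs.2 (fun s => φ s + (s - x) ^ 2) (hφ.add (by fun_prop)) x hx (by
    unfold StrictLocMax
    filter_upwards [hmax.filter_mono nhdsWithin_le_nhds, self_mem_nhdsWithin] with s h1 h2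
    have : 0 < (s - x) ^ 2 := by
      have : s - x ≠ 0 := sub_ne_zero.mpr h2
      positivity
    simp; linarith) hρ
  rw [hd] at h
  have : m ≤ lscEnv R x := by
    unfold lscEnv
    exact le_liminf_of_le
      (IsCoboundedUnder.of_frequently_le (a := U) (Frequently.of_forall hRU)) hm
  linarith

theorem super_nonstrict {d : ℝ} {R : ℝ → ℝ} {ρ : ℝ → ℝ} (hs : IsViscSuper d R (Ioi 0) ρ)
    (hRU : ∀ s, 0 ≤ R s)
    {φ : ℝ → ℝ} (hφ : ContDiff ℝ 1 φ) {x : ℝ} (hx : 0 < x)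
    (hmin : IsLocalMin (fun s => ρ s - φ s) x) {m : ℝ}
    (hm : ∀ᶠ s in 𝓝 x, R s ≤ m) :
    0 ≤ ρ x - x * deriv φ x + d * deriv φ x ^ 2 + m := by
  have hd : deriv (fun s => φ s - (s - x) ^ 2) x = deriv φ x := by
    apply HasDerivAt.deriv
    have h2 := (hφ.differentiable (by norm_num) x).hasDerivAt.sub
      (quad_deriv 0 1 x x)
    convert h2 using 1
    · funext s; simp
    · simp
  have h := hs.2.2 (fun s => φ s - (s - x) ^ 2) (hφ.sub (by fun_prop)) x hx (by
    unfold StrictLocMin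
    filter_upwards [hmin.filter_mono nhdsWithin_le_nhds, self_mem_nhdsWithin] with s h1 h2
    have : 0 < (s - x) ^ 2 := by
      have : s - x ≠ 0 := sub_ne_zero.mpr h2
      positivity
    simp; linarith)
  rw [hd] at h
  have : uscEnv R x ≤ m := by
    unfold uscEnv
    exact limsup_le_of_le
      (IsCoboundedUnder.of_frequently_ge (a := 0) (Frequently.of_forall hRU)) hm
  linarith

theorem sub_improved {d : ℝ} (hd : 0 < d) {R : ℝ → ℝ} {ρ : ℝ → ℝ}
    (hs : IsViscSub d R (Ioi 0) ρ) (hc : ContinuousOn ρ (Ioi 0))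
    {U : ℝ} (hRU : ∀ s, R s ≤ U) (hR0 : ∀ s, 0 ≤ R s)
    {φ : ℝ → ℝ} (hφ : ContDiff ℝ 1 φ) {x : ℝ} (hx : 0 < x)
    (hmax : IsLocalMax (fun s => ρ s - φ s) x) (hρ : 0 < ρ x) {m : ℝ}
    (hm : ∀ᶠ s in 𝓝[≠] x, m ≤ R s) :
    ρ x - x * deriv φ x + d * deriv φ x ^ 2 + m ≤ 0 := by
  by_contra! hF
  set p := deriv φ x with hp
  have hca : ∀ y, 0 < y → ContinuousAt ρ y := fun y hy => hc.continuousAt (Ioi_mem_nhds hy)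
  have hfc : ∀ᶠ s in 𝓝 x, ContinuousAt ρ s := by
    filter_upwards [Ioi_mem_nhds hx] with s hs using hca s hs
  -- no large test slopes
  have hA : ∀ ψ : ℝ → ℝ, ContDiff ℝ 1 ψ → IsLocalMax (fun s => ρ s - ψ s) x →
      d * deriv ψ x ^ 2 < x * deriv ψ x := by
    intro ψ h1 h2
    have := sub_nonstrict hs hRU h1 hx h2 hρ (m := 0) (Eventually.of_forall hR0)
    linarith
  -- no nearby test slopes
  have hB : ∀ q, 0 < ρ x - x * q + d * q ^ 2 + m → ∃ κ, 0 < κ ∧ ∀ y, y ≠ x → |y - x| < κ →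
      ∀ ψ : ℝ → ℝ, ContDiff ℝ 1 ψ → IsLocalMax (fun s => ρ s - ψ s) y →
      |deriv ψ y - q| ≤ κ → False := by
    intro q hq
    have hcont : ContinuousAt (fun z : ℝ × ℝ => ρ z.1 - z.1 * z.2 + d * z.2 ^ 2 + m) (x, q) := by
      have : ContinuousAt (fun z : ℝ × ℝ => ρ z.1) (x, q) :=
        ContinuousAt.comp (f := Prod.fst) (hca x hx) continuousAt_fst
      fun_prop
    have e1 := hcont.eventually (lt_mem_nhds hq)
    have e2 : ∀ᶠ y in 𝓝 x, 0 < ρ y := (hca x hx).eventually (lt_mem_nhds hρ)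
    have e3 := eventually_nhdsWithin_iff.mp (eventually_eventually_nhdsWithin.mpr hm)
    obtain ⟨k1, hk1, H1⟩ := Metric.eventually_nhds_iff.mp e1
    obtain ⟨k2, hk2, H2⟩ := Metric.eventually_nhds_iff.mp (e2.and (e3.and (lt_mem_nhds hx)))
    refine ⟨min (k1 / 2) k2, by positivity, ?_⟩
    intro y hyx hy ψ h1 h2 h3
    have hyk2 : |y - x| < k2 := lt_of_lt_of_le hy (min_le_right _ _)
    have hyk1 : |y - x| < k1 := lt_of_lt_of_le hy ((min_le_left _ _).trans (by linarith))
    have hqk1 : |deriv ψ y - q| < k1 := lt_of_le_of_lt (h3.trans (min_le_left _ _)) (by linarith)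
    have g1 := H1 (y := (y, deriv ψ y)) (by
      rw [Prod.dist_eq, max_lt_iff, Real.dist_eq, Real.dist_eq]; exact ⟨hyk1, hqk1⟩)
    obtain ⟨g2, g3, g4⟩ := H2 (y := y) (by rwa [Real.dist_eq])
    have g5 := g3 hyx
    rw [IsOpen.nhdsWithin_eq isOpen_compl_singleton hyx] at g5
    have := sub_nonstrict hs hRU h1 g4 h2 g2 g5
    simp only at g1
    linarith
  rcases le_total x (2 * d * p) with hcase | hcase
  · rcases aux_left ρ φ x hfc hφ hmax with h | ⟨l, hl, h⟩
    · obtain ⟨ψ, h1, h2, h3⟩ := h (x / d) (by positivity)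
      have := hA ψ h1 h3
      rw [h2, ← hp] at this
      have hxd : d * (x / d) = x := by field_simp
      have hp0 : 0 < p := by
        by_contra! hh
        nlinarith
      have : 0 < x / d := by positivity
      nlinarith
    · obtain ⟨κ, hκ, h'⟩ := hB (p + l) (by nlinarith [mul_nonneg hl (sub_nonneg.mpr hcase), mul_nonneg hd.le (sq_nonneg l)])
      obtain ⟨y, hy1, hy2, ψ, h1, h2, h3⟩ := h κ hκ
      exact h' y hy2.ne (by rw [abs_lt]; constructor <;> linarith) ψ h1 h2 h3
  · rcases aux_right ρ φ x hfc hφ hmax with h | ⟨l, hl, h⟩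
    · obtain ⟨ψ, h1, h2, h3⟩ := h (x / d) (by positivity)
      have := hA ψ h1 h3
      rw [h2, ← hp] at this
      have hxd : d * (x / d) = x := by field_simp
      have : p - x / d < 0 := by
        have : 0 < d * (x / d - p) := by nlinarith
        have := pos_of_mul_pos_right this hd.le
        linarith
      nlinarith [mul_nonneg hd.le (sq_nonneg (p - x / d)), mul_pos hx (neg_pos.mpr this)]
    · obtain ⟨κ, hκ, h'⟩ := hB (p - l) (by nlinarith [mul_nonneg hl (sub_nonneg.mpr hcase), mul_nonneg hd.le (sq_nonneg l)])
      obtain ⟨y, hy1, hy2, ψ, h1, h2, h3⟩ := h κ hκ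
      exact h' y hy1.ne' (by rw [abs_lt]; constructor <;> linarith) ψ h1 h2 h3


set_option maxHeartbeats 1000000 in
theorem local_contra {d : ℝ} (hd : 0 < d) {R : ℝ → ℝ} (hR0 : ∀ s, 0 ≤ R s)
    (f g : ℝ → ℝ) (s0 : ℝ) (hs0 : 0 < s0) (hf : ContinuousOn f (Ioi 0))
    (hg : ContinuousOn g (Ioi 0)) (hmax : ∀ s, 0 < s → f s - g s ≤ f s0 - g s0)
    (hpos : 0 < f s0 - g s0) (hg0 : 0 ≤ g s0)
    (hsub : ∀ φ : ℝ → ℝ, ContDiff ℝ 1 φ → ∀ x, 0 < x → IsLocalMax (fun s => f s - φ s) x →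
      0 < f x → ∀ m, (∀ᶠ s in 𝓝[≠] x, m ≤ R s) → f x - x * deriv φ x + d * deriv φ x ^ 2 + m ≤ 0)
    (hsup : ∀ φ : ℝ → ℝ, ContDiff ℝ 1 φ → ∀ x, 0 < x → IsLocalMin (fun s => g s - φ s) x →
      ∀ m, (∀ᶠ s in 𝓝 x, R s ≤ m) → 0 ≤ g x - x * deriv φ x + d * deriv φ x ^ 2 + m)
    (hmono : ∃ σ : ℝ, (σ = 1 ∨ σ = -1) ∧ ∃ r, 0 < r ∧ ∀ x y, |x - s0| < r → |y - s0| < r →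
      0 < σ * (x - y) → ∃ m, (∀ᶠ s in 𝓝[≠] x, m ≤ R s) ∧ ∀ᶠ s in 𝓝 y, R s ≤ m) : False := by
  obtain ⟨σ, hσ, r0, hr0, hmono⟩ := hmono
  set r := min (r0 / 2) (s0 / 2) with hr
  have hrp : 0 < r := by positivity
  have hr1 : r < r0 := lt_of_le_of_lt (min_le_left _ _) (by linarith)
  have hr2 : r < s0 := lt_of_le_of_lt (min_le_right _ _) (by linarith)
  set J := Icc (s0 - r) (s0 + r) with hJ
  have hJ0 : J ⊆ Ioi 0 := fun s hs => by
    have := hs.1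
    simp only [mem_Ioi]; linarith
  have hfJ := hf.mono hJ0
  have hgJ := hg.mono hJ0
  have hs0J : s0 ∈ J := ⟨by linarith, by linarith⟩
  have hex : ∀ δ : ℝ, ∃ z : ℝ × ℝ, z ∈ J ×ˢ J ∧ ∀ w ∈ J ×ˢ J,
      f w.1 - g w.2 - (w.1 - s0) ^ 2 - 1 / (2 * δ ^ 2) * (w.1 - w.2 - σ * δ) ^ 2 ≤
      f z.1 - g z.2 - (z.1 - s0) ^ 2 - 1 / (2 * δ ^ 2) * (z.1 - z.2 - σ * δ) ^ 2 := by
    intro δ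
    have hc : ContinuousOn (fun w : ℝ × ℝ => f w.1 - g w.2 - (w.1 - s0) ^ 2 -
        1 / (2 * δ ^ 2) * (w.1 - w.2 - σ * δ) ^ 2) (J ×ˢ J) := by
      have h1 : ContinuousOn (fun w : ℝ × ℝ => f w.1) (J ×ˢ J) :=
        hfJ.comp continuousOn_fst (fun w hw => hw.1)
      have h2 : ContinuousOn (fun w : ℝ × ℝ => g w.2) (J ×ˢ J) :=
        hgJ.comp continuousOn_snd (fun w hw => hw.2)
      have h3 : Continuous (fun w : ℝ × ℝ => (w.1 - s0) ^ 2) := by fun_prop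
      have h4 : Continuous (fun w : ℝ × ℝ => 1 / (2 * δ ^ 2) * (w.1 - w.2 - σ * δ) ^ 2) := by
        fun_prop
      exact ((h1.sub h2).sub h3.continuousOn).sub h4.continuousOn
    obtain ⟨z, hz, hm⟩ := (isCompact_Icc.prod isCompact_Icc).exists_isMaxOn
      ⟨(s0, s0), hs0J, hs0J⟩ hc
    exact ⟨z, hz, fun w hw => hm hw⟩
  choose Z hZ hZm using hex
  set δ0 : ℕ → ℝ := fun n => 1 / ((n : ℝ) + 1) with hδ0
  obtain ⟨ab, hab, ν, hν, hlim⟩ := (isCompact_Icc.prod isCompact_Icc).tendsto_subseq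
    (fun n => hZ (δ0 n))
  set δ : ℕ → ℝ := fun n => δ0 (ν n) with hδ
  have hδlim : Tendsto δ atTop (𝓝 0) :=
    tendsto_one_div_add_atTop_nhds_zero_nat.comp hν.tendsto_atTop
  have hδp : ∀ n, 0 < δ n := fun n => by simp only [hδ, hδ0]; positivity
  set X : ℕ → ℝ := fun n => (Z (δ n)).1 with hX
  set Y : ℕ → ℝ := fun n => (Z (δ n)).2 with hY
  have hXJ : ∀ n, X n ∈ J := fun n => (hZ (δ n)).1
  have hYJ : ∀ n, Y n ∈ J := fun n => (hZ (δ n)).2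
  have hm : ∀ n, ∀ x ∈ J, ∀ y ∈ J,
      f x - g y - (x - s0) ^ 2 - 1 / (2 * δ n ^ 2) * (x - y - σ * δ n) ^ 2 ≤
      f (X n) - g (Y n) - (X n - s0) ^ 2 - 1 / (2 * δ n ^ 2) * (X n - Y n - σ * δ n) ^ 2 :=
    fun n x hx y hy => hZm (δ n) (x, y) ⟨hx, hy⟩
  obtain ⟨a, b⟩ := ab
  have haJ : a ∈ J := hab.1
  have hbJ : b ∈ J := hab.2
  have hXa : Tendsto X atTop (𝓝 a) := (continuous_fst.tendsto _).comp hlim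
  have hYb : Tendsto Y atTop (𝓝 b) := (continuous_snd.tendsto _).comp hlim
  clear_value X Y δ
  have hfat : ∀ s, 0 < s → ContinuousAt f s := fun s hs => hf.continuousAt (Ioi_mem_nhds hs)
  have hgat : ∀ s, 0 < s → ContinuousAt g s := fun s hs => hg.continuousAt (Ioi_mem_nhds hs)
  have hfX : Tendsto (fun n => f (X n)) atTop (𝓝 (f a)) := (hfat a (hJ0 haJ)).tendsto.comp hXa
  have hgY : Tendsto (fun n => g (Y n)) atTop (𝓝 (g b)) := (hgat b (hJ0 hbJ)).tendsto.comp hYb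
  have hσδ : Tendsto (fun n => s0 - σ * δ n) atTop (𝓝 s0) := by
    simpa using (hδlim.const_mul σ).const_sub s0
  have hgσ : Tendsto (fun n => g (s0 - σ * δ n)) atTop (𝓝 (g s0)) :=
    (hgat s0 hs0).tendsto.comp hσδ
  have hbase : ∀ᶠ n in atTop, f s0 - g (s0 - σ * δ n) ≤
      f (X n) - g (Y n) - (X n - s0) ^ 2 - 1 / (2 * δ n ^ 2) * (X n - Y n - σ * δ n) ^ 2 := by
    filter_upwards [hσδ.eventually (Icc_mem_nhds (show s0 - r < s0 by linarith)
      (show s0 < s0 + r by linarith))] with n hn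
    have := hm n s0 hs0J _ hn
    simpa using this
  have hba : a = b := by
    have h1 : Tendsto (fun n => (X n - Y n - σ * δ n) ^ 2) atTop (𝓝 ((a - b - σ * 0) ^ 2)) :=
      ((hXa.sub hYb).sub (hδlim.const_mul σ)).pow 2
    have h2 : Tendsto (fun n => 2 * δ n ^ 2 * (f (X n) - g (Y n) - (f s0 - g (s0 - σ * δ n))))
        atTop (𝓝 (2 * 0 ^ 2 * (f a - g b - (f s0 - g s0)))) :=
      ((hδlim.pow 2).const_mul 2).mul ((hfX.sub hgY).sub (hgσ.const_sub (f s0)))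
    have h3 := le_of_tendsto_of_tendsto h1 h2 (by
      filter_upwards [hbase] with n hn
      have hk : 0 < 2 * δ n ^ 2 := by have := hδp n; positivity
      have h4 : 1 / (2 * δ n ^ 2) * (X n - Y n - σ * δ n) ^ 2 ≤
        f (X n) - g (Y n) - (f s0 - g (s0 - σ * δ n)) := by nlinarith [sq_nonneg (X n - s0)]
      calc (X n - Y n - σ * δ n) ^ 2
          = 2 * δ n ^ 2 * (1 / (2 * δ n ^ 2) * (X n - Y n - σ * δ n) ^ 2) := by
            rw [← mul_assoc, mul_one_div_cancel hk.ne', one_mul]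
        _ ≤ _ := mul_le_mul_of_nonneg_left h4 hk.le)
    have h4 : (a - b) ^ 2 ≤ 0 := by simpa using h3
    have : a - b = 0 := by nlinarith
    linarith
  subst hba
  have has : a = s0 := by
    have h1 : Tendsto (fun n => f (X n) - g (Y n) - (X n - s0) ^ 2) atTop
        (𝓝 (f a - g a - (a - s0) ^ 2)) := (hfX.sub hgY).sub ((hXa.sub_const s0).pow 2)
    have h3 := le_of_tendsto_of_tendsto (hgσ.const_sub (f s0)) h1 (by
      filter_upwards [hbase] with n hn
      have hk : 0 ≤ 1 / (2 * δ n ^ 2) * (X n - Y n - σ * δ n) ^ 2 := by positivity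
      linarith)
    have h4 := hmax a (hJ0 haJ)
    have : a - s0 = 0 := by nlinarith
    linarith
  subst has
  set Q := (a + r) / d with hQ
  have hQp : 0 < Q := by positivity
  have hQd : d * Q = a + r := by rw [hQ]; field_simp
  have hnear : ∀ᶠ s in 𝓝 a, a - r < s ∧ s < a + r := Ioo_mem_nhds (by linarith) (by linarith)
  have hfin : ∀ᶠ n in atTop, f (X n) - g (Y n) ≤
      |X n - Y n| * Q + Y n * |2 * (X n - a)| + 2 * d * Q * |2 * (X n - a)|
        + d * (2 * (X n - a)) ^ 2 := by
    filter_upwards [hXa.eventually hnear, hYb.eventually hnear,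
      hfX.eventually (lt_mem_nhds (show 0 < f a by linarith)),
      hδlim.eventually (gt_mem_nhds (show 0 < 1 / (Q + 2 * r) by positivity))] with n hx hy hfp hdn
    have hδn := hδp n
    set k := 1 / (2 * δ n ^ 2) with hk
    have hkp : 0 < k := by positivity
    have hkd : 2 * k * δ n ^ 2 = 1 := by rw [hk]; field_simp
    set P := 2 * k * (X n - Y n - σ * δ n) with hP
    have hX0 : 0 < X n := hJ0 (hXJ n)
    have hY0 : 0 < Y n := hJ0 (hYJ n)
    set q := P + 2 * (X n - a) with hq
    -- test function for f
    set φ : ℝ → ℝ := fun s => (0 * (s - a) + 1 * (s - a) ^ 2) +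
      (0 * (s - (Y n + σ * δ n)) + k * (s - (Y n + σ * δ n)) ^ 2) with hφ
    have hφd : deriv φ (X n) = q := by
      have hh := (quad_deriv 0 1 a (X n)).add (quad_deriv 0 k (Y n + σ * δ n) (X n))
      refine Eq.trans (HasDerivAt.deriv hh) ?_
      simp only [hq, hP]; ring
    have hφC : ContDiff ℝ 1 φ := by fun_prop
    have hφm : IsLocalMax (fun s => f s - φ s) (X n) := by
      filter_upwards [Icc_mem_nhds hx.1 hx.2] with s hs
      have := hm n s hs (Y n) (hYJ n)
      simp only [hφ]
      have e1 : ∀ s, s - (Y n + σ * δ n) = s - Y n - σ * δ n := fun s => by ring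
      rw [e1, e1]
      linarith
    set χ : ℝ → ℝ := fun s => 0 * (s - (X n - σ * δ n)) + (-k) * (s - (X n - σ * δ n)) ^ 2 with hχ
    have hχd : deriv χ (Y n) = P := by
      rw [(quad_deriv 0 (-k) (X n - σ * δ n) (Y n)).deriv]
      simp only [hP]; ring
    have hχC : ContDiff ℝ 1 χ := by fun_prop
    have hχm : IsLocalMin (fun s => g s - χ s) (Y n) := by
      filter_upwards [Icc_mem_nhds hy.1 hy.2] with s hs
      have := hm n (X n) (hXJ n) s hs
      simp only [hχ]
      have e1 : ∀ s, (s - (X n - σ * δ n)) ^ 2 = (X n - s - σ * δ n) ^ 2 := fun s => by ring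
      rw [e1, e1]
      linarith
    have hb := hsub φ hφC (X n) hX0 hφm hfp 0 (Eventually.of_forall hR0)
    rw [hφd] at hb
    have hq0 : 0 ≤ q := by
      by_contra! hh
      have h1 := mul_pos hX0 (neg_pos.mpr hh)
      have h2 := mul_nonneg hd.le (sq_nonneg q)
      linarith
    have hqQ : q ≤ Q := by
      by_contra! hh
      have h1 : 0 < q := by linarith
      have h2 : d * Q < d * q := mul_lt_mul_of_pos_left hh hd
      have h3 : X n < d * q := by linarith [hx.2]
      have h4 := mul_lt_mul_of_pos_right h3 h1
      have h5 : d * q ^ 2 = d * q * q := by ring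
      linarith
    have hPb : |P| ≤ Q + 2 * r := by
      have : P = q - 2 * (X n - a) := by rw [hq]; ring
      rw [this, abs_le]
      constructor <;> linarith [hx.1, hx.2]
    have hdiff : |X n - Y n - σ * δ n| < δ n := by
      have h1 : X n - Y n - σ * δ n = P * δ n ^ 2 := by
        rw [hP]; linear_combination (-(X n - Y n - σ * δ n)) * hkd
      rw [h1, abs_mul, abs_of_nonneg (sq_nonneg (δ n))]
      have h2 : δ n * (Q + 2 * r) < 1 := by
        rwa [lt_div_iff₀ (by positivity)] at hdn
      have h3 : δ n * |P| < 1 := lt_of_le_of_lt (mul_le_mul_of_nonneg_left hPb hδn.le) h2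
      calc |P| * δ n ^ 2 = δ n * (δ n * |P|) := by ring
        _ < δ n * 1 := mul_lt_mul_of_pos_left h3 hδn
        _ = δ n := mul_one _
    have hsign : 0 < σ * (X n - Y n) := by
      rw [abs_lt] at hdiff
      rcases hσ with h | h <;> rw [h] at hdiff ⊢ <;> linarith [hdiff.1, hdiff.2]
    obtain ⟨m, hm1, hm2⟩ := hmono (X n) (Y n)
      (by rw [abs_lt]; constructor <;> linarith [hx.1, hx.2])
      (by rw [abs_lt]; constructor <;> linarith [hy.1, hy.2]) hsign
    have i1 := hsub φ hφC (X n) hX0 hφm hfp m hm1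
    have i2 := hsup χ hχC (Y n) hY0 hχm m hm2
    rw [hφd] at i1
    rw [hχd] at i2
    set e := 2 * (X n - a) with he
    have hPq : P = q - e := by rw [hq]; ring
    rw [hPq] at i2
    have j1 : (X n - Y n) * q ≤ |X n - Y n| * Q :=
      (mul_le_mul_of_nonneg_right (le_abs_self _) hq0).trans
        (mul_le_mul_of_nonneg_left hqQ (abs_nonneg _))
    have j2 : Y n * e ≤ Y n * |e| := mul_le_mul_of_nonneg_left (le_abs_self _) hY0.le
    have j3 : 2 * d * (q * (-e)) ≤ 2 * d * (Q * |e|) := by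
      apply mul_le_mul_of_nonneg_left _ (by positivity)
      exact (mul_le_mul_of_nonneg_left (neg_le_abs e) hq0).trans
        (mul_le_mul_of_nonneg_right hqQ (abs_nonneg _))
    have j4 : d * (q - e) ^ 2 = d * q ^ 2 + 2 * d * (q * (-e)) + d * e ^ 2 := by ring
    have j5 : X n * q - Y n * (q - e) = (X n - Y n) * q + Y n * e := by ring
    have j6 : 2 * d * (Q * |e|) = 2 * d * Q * |e| := by ring
    linarith
  have hlimR : Tendsto (fun n => |X n - Y n| * Q + Y n * |2 * (X n - a)|
      + 2 * d * Q * |2 * (X n - a)| + d * (2 * (X n - a)) ^ 2) atTop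
      (𝓝 (|a - a| * Q + a * |2 * (a - a)| + 2 * d * Q * |2 * (a - a)| + d * (2 * (a - a)) ^ 2)) := by
    have e1 := (hXa.sub_const a).const_mul 2
    exact ((((hXa.sub hYb).abs.mul_const Q).add (hYb.mul e1.abs)).add
      (e1.abs.const_mul (2 * d * Q))).add ((e1.pow 2).const_mul d)
  have := le_of_tendsto_of_tendsto (hfX.sub hgY) hlimR hfin
  simp at this
  linarith

theorem comparison {d : ℝ} (hd : 0 < d) {R : ℝ → ℝ} (hR0 : ∀ s, 0 ≤ R s) {U : ℝ} (hU : 0 < U)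
    (hRU : ∀ s, R s ≤ U)
    (hmono : ∀ s0, 0 < s0 → ∃ σ : ℝ, (σ = 1 ∨ σ = -1) ∧ ∃ r, 0 < r ∧ ∀ x y, |x - s0| < r →
      |y - s0| < r →
      0 < σ * (x - y) → ∃ m, (∀ᶠ s in 𝓝[≠] x, m ≤ R s) ∧ ∀ᶠ s in 𝓝 y, R s ≤ m)
    {ρ1 ρ2 : ℝ → ℝ} (h1c : ContinuousOn ρ1 (Ici 0)) (h2c : ContinuousOn ρ2 (Ici 0))
    (h1 : IsViscSub d R (Ioi 0) ρ1) (h2 : IsViscSuper d R (Ioi 0) ρ2)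
    (h10 : ρ1 0 = 0) (h20 : ρ2 0 = 0) {l1 l2 : ℝ} (hl1 : 0 < l1) (hl12 : l1 ≤ l2)
    (ht1 : Tendsto (fun s => ρ1 s / s) atTop (𝓝 l1))
    (ht2 : Tendsto (fun s => ρ2 s / s) atTop (𝓝 l2)) {θ : ℝ} (hθ0 : 0 < θ) (hθ1 : θ < 1)
    {s : ℝ} (hs : 0 ≤ s) : θ * ρ1 s - (1 - θ) * U ≤ ρ2 s := by
  by_contra! hcon
  set f : ℝ → ℝ := fun s => θ * ρ1 s - (1 - θ) * U with hf
  have hKp : 0 < (1 - θ) * U := mul_pos (by linarith) hU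
  have hfc : ContinuousOn f (Ici 0) := (h1c.const_smul θ).sub continuousOn_const
  have hlt : ∀ᶠ t in atTop, f t - ρ2 t < 0 := by
    have h3 : Tendsto (fun s => θ * (ρ1 s / s) - ρ2 s / s) atTop (𝓝 (θ * l1 - l2)) :=
      (ht1.const_mul θ).sub ht2
    filter_upwards [h3.eventually (gt_mem_nhds (show θ * l1 - l2 < 0 by nlinarith)),
      eventually_gt_atTop 0] with t ht htp
    have h4 : t * (θ * (ρ1 t / t) - ρ2 t / t) = θ * ρ1 t - ρ2 t := by field_simp
    have h5 := mul_neg_of_pos_of_neg htp ht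
    simp only [hf]
    linarith
  obtain ⟨L, hL⟩ := eventually_atTop.mp hlt
  have hsL : s < L := by
    by_contra! h
    have := hL s h
    simp only [hf] at this
    linarith
  obtain ⟨s0, hs0, hm⟩ := isCompact_Icc.exists_isMaxOn (nonempty_Icc.mpr (hs.trans hsL.le))
    ((hfc.sub h2c).mono (fun t ht => ht.1 : Icc (0:ℝ) L ⊆ Ici 0))
  have hms : f s - ρ2 s ≤ f s0 - ρ2 s0 := hm (⟨hs, hsL.le⟩ : s ∈ Icc 0 L)
  have hp : 0 < f s0 - ρ2 s0 := by
    have : 0 < f s - ρ2 s := by simp only [hf]; linarith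
    linarith
  have hs0p : 0 < s0 := by
    rcases hs0.1.lt_or_eq with h | h
    · exact h
    · rw [← h] at hp
      simp only [hf, h10, h20] at hp
      linarith
  refine local_contra hd hR0 f ρ2 s0 hs0p (hfc.mono Ioi_subset_Ici_self)
    (h2c.mono Ioi_subset_Ici_self) ?_ hp (h2.2.1 s0 hs0p) ?_ ?_ (hmono s0 hs0p)
  · intro t ht
    rcases le_or_gt t L with h | h
    · exact hm (⟨ht.le, h⟩ : t ∈ Icc 0 L)
    · exact (hL t h.le).le.trans hp.le
  · intro φ hφ x hx hmx hfx m hmR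
    have hmU : m ≤ U := by
      obtain ⟨t, ht⟩ := hmR.exists
      exact ht.trans (hRU t)
    have hd' : deriv (fun s => (φ s + (1 - θ) * U) / θ) x = deriv φ x / θ := by
      simp
    have key := sub_improved hd h1 (h1c.mono Ioi_subset_Ici_self) hRU hR0
      (φ := fun s => (φ s + (1 - θ) * U) / θ) ((hφ.add contDiff_const).div_const θ) hx (by
        filter_upwards [hmx] with t ht
        simp only [hf] at ht
        have e : ∀ t, ρ1 t - (φ t + (1 - θ) * U) / θ
            = (θ * ρ1 t - (1 - θ) * U - φ t) / θ := by
          intro t; field_simp; ring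
        rw [e, e]
        exact div_le_div_of_nonneg_right ht hθ0.le) (by
        simp only [hf] at hfx
        exact pos_of_mul_pos_right (show 0 < θ * ρ1 x by linarith) hθ0.le) hmR
    rw [hd'] at key
    set p := deriv φ x with hpdef
    have k1 : θ * (ρ1 x - x * (p / θ) + d * (p / θ) ^ 2 + m) ≤ 0 :=
      mul_nonpos_of_nonneg_of_nonpos hθ0.le key
    have k2 : θ * (ρ1 x - x * (p / θ) + d * (p / θ) ^ 2 + m)
        = θ * ρ1 x - x * p + d * p ^ 2 / θ + θ * m := by field_simp
    have k3 : d * p ^ 2 ≤ d * p ^ 2 / θ := by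
      rw [le_div_iff₀ hθ0]
      have : 0 ≤ d * p ^ 2 := by positivity
      nlinarith
    have k4 : (1 - θ) * m ≤ (1 - θ) * U := mul_le_mul_of_nonneg_left hmU (by linarith)
    simp only [hf]
    linarith
  · intro φ hφ x hx hmn m hmR
    exact super_nonstrict h2 hR0 hφ hx hmn hmR


theorem mono_cond (r3 a31 a32 c1 c2 : ℝ)
    (hr3 : 0 < r3) (ha31 : 0 ≤ a31) (ha32 : 0 ≤ a32)
    (hc2 : 0 < c2) (hc12 : c2 < c1) (R : ℝ → ℝ)
    (hR : R = (fun s => r3 * (1 - a31 * (if c2 ≤ s ∧ s ≤ c1 then 1 else 0)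
        - a32 * (if 0 < s ∧ s ≤ c2 then 1 else 0)))) (s0 : ℝ) (hs0 : 0 < s0) :
    ∃ σ : ℝ, (σ = 1 ∨ σ = -1) ∧ ∃ r, 0 < r ∧ ∀ x y, |x - s0| < r →
      |y - s0| < r →
      0 < σ * (x - y) → ∃ m, (∀ᶠ s in 𝓝[≠] x, m ≤ R s) ∧ ∀ᶠ s in 𝓝 y, R s ≤ m := by
  have p1 : 0 ≤ r3 * a31 := by positivity
  have p2 : 0 ≤ r3 * a32 := by positivity
  have v1 : ∀ s, 0 < s → s < c2 → R s = r3 * (1 - a32) := by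
    intro s h1 h2
    rw [hR]; simp only
    rw [if_neg (by rintro ⟨h, -⟩; linarith), if_pos ⟨h1, h2.le⟩]; ring
  have v2 : R c2 = r3 * (1 - a31 - a32) := by
    rw [hR]; simp only
    rw [if_pos ⟨le_rfl, hc12.le⟩, if_pos ⟨hc2, le_rfl⟩]; ring
  have v3 : ∀ s, c2 < s → s ≤ c1 → R s = r3 * (1 - a31) := by
    intro s h1 h2
    rw [hR]; simp only
    rw [if_pos ⟨h1.le, h2⟩, if_neg (by rintro ⟨-, h⟩; linarith)]; ring
  have v4 : ∀ s, c1 < s → R s = r3 := by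
    intro s h1
    rw [hR]; simp only
    rw [if_neg (by rintro ⟨-, h⟩; linarith), if_neg (by rintro ⟨-, h⟩; linarith)]; ring
  have vU : ∀ s, R s ≤ r3 := by
    intro s
    rw [hR]; simp only
    split_ifs <;> nlinarith
  have ev : ∀ {a x b : ℝ}, a < x → x < b → ∀ᶠ s in 𝓝 x, a < s ∧ s < b :=
    fun h1 h2 => Ioo_mem_nhds h1 h2
  -- lower bounds at punctured points, upper bounds
  have L1 : ∀ x, 0 < x → x < c2 → ∀ᶠ s in 𝓝[≠] x, r3 * (1 - a32) ≤ R s := by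
    intro x h1 h2
    filter_upwards [(ev h1 h2).filter_mono nhdsWithin_le_nhds] with s hs
    exact (v1 s hs.1 hs.2).ge
  have L2 : ∀ x, c2 < x → x ≤ c1 → ∀ᶠ s in 𝓝[≠] x, r3 * (1 - a31) ≤ R s := by
    intro x h1 h2
    filter_upwards [(lt_mem_nhds h1).filter_mono nhdsWithin_le_nhds] with s hs
    rcases le_or_gt s c1 with h | h
    · exact (v3 s hs h).ge
    · rw [v4 s h]; linarith
  have L2' : ∀ x, c2 < x → ∀ᶠ s in 𝓝[≠] x, r3 * (1 - a31) ≤ R s := by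
    intro x h1
    filter_upwards [(lt_mem_nhds h1).filter_mono nhdsWithin_le_nhds] with s hs
    rcases le_or_gt s c1 with h | h
    · exact (v3 s hs h).ge
    · rw [v4 s h]; linarith
  have L3 : ∀ x, c1 < x → ∀ᶠ s in 𝓝[≠] x, r3 ≤ R s := by
    intro x h1
    filter_upwards [(lt_mem_nhds h1).filter_mono nhdsWithin_le_nhds] with s hs
    exact (v4 s hs).ge
  have Lc : ∀ x, 0 < x → x < c1 → ∀ m, m ≤ r3 * (1 - a31) → m ≤ r3 * (1 - a32) →
      ∀ᶠ s in 𝓝[≠] x, m ≤ R s := by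
    intro x h1 h2 m m1 m2
    rcases lt_trichotomy x c2 with h | h | h
    · filter_upwards [L1 x h1 h] with s hs using m2.trans hs
    · filter_upwards [(ev h1 h2).filter_mono nhdsWithin_le_nhds, self_mem_nhdsWithin] with s hs hne
      have hne' : s ≠ c2 := by rw [← h]; exact hne
      rcases lt_or_gt_of_ne hne' with h' | h'
      · rw [v1 s hs.1 h']; exact m2
      · rw [v3 s h' hs.2.le]; exact m1
    · filter_upwards [L2 x h h2.le] with s hs using m1.trans hs
  have U1 : ∀ x, 0 < x → x < c2 → ∀ᶠ s in 𝓝 x, R s ≤ r3 * (1 - a32) := by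
    intro x h1 h2
    filter_upwards [ev h1 h2] with s hs
    exact (v1 s hs.1 hs.2).le
  have U2 : ∀ x, c2 < x → x < c1 → ∀ᶠ s in 𝓝 x, R s ≤ r3 * (1 - a31) := by
    intro x h1 h2
    filter_upwards [ev h1 h2] with s hs
    exact (v3 s hs.1 hs.2.le).le
  have Uc : ∀ x, 0 < x → x < c1 → ∀ m, r3 * (1 - a31) ≤ m → r3 * (1 - a32) ≤ m →
      ∀ᶠ s in 𝓝 x, R s ≤ m := by
    intro x h1 h2 m m1 m2
    filter_upwards [ev h1 h2] with s hs
    rcases lt_trichotomy s c2 with h | h | h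
    · rw [v1 s hs.1 h]; exact m2
    · rw [h, v2]; linarith
    · rw [v3 s h hs.2.le]; exact m1
  have U3 : ∀ x, ∀ᶠ s in 𝓝 x, R s ≤ r3 := fun x => Eventually.of_forall vU
  rcases lt_trichotomy s0 c2 with h | h | h
  · refine ⟨1, Or.inl rfl, min s0 (c2 - s0), lt_min hs0 (by linarith), ?_⟩
    intro x y hx hy _
    rw [lt_min_iff, abs_lt, abs_lt] at hx hy
    exact ⟨_, L1 x (by linarith) (by linarith), U1 y (by linarith) (by linarith)⟩
  · subst h
    rcases le_total (r3 * (1 - a32)) (r3 * (1 - a31)) with hAB | hAB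
    · refine ⟨1, Or.inl rfl, min s0 (c1 - s0), lt_min hs0 (by linarith), ?_⟩
      intro x y hx hy hxy
      rw [lt_min_iff, abs_lt, abs_lt] at hx hy
      rcases lt_or_ge y s0 with h | h
      · exact ⟨_, Lc x (by linarith) (by linarith) _ hAB le_rfl, U1 y (by linarith) h⟩
      · exact ⟨_, L2 x (by linarith) (by linarith), Uc y (by linarith) (by linarith) _ le_rfl hAB⟩
    · refine ⟨-1, Or.inr rfl, min s0 (c1 - s0), lt_min hs0 (by linarith), ?_⟩
      intro x y hx hy hxy
      rw [lt_min_iff, abs_lt, abs_lt] at hx hy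
      rcases lt_or_ge s0 y with h | h
      · exact ⟨_, Lc x (by linarith) (by linarith) _ le_rfl hAB, U2 y h (by linarith)⟩
      · exact ⟨_, L1 x (by linarith) (by linarith), Uc y (by linarith) (by linarith) _ hAB le_rfl⟩
  · rcases lt_or_ge c1 s0 with h' | h'
    · refine ⟨1, Or.inl rfl, s0 - c1, by linarith, ?_⟩
      intro x y hx hy _
      rw [abs_lt] at hx hy
      exact ⟨_, L3 x (by linarith), U3 y⟩
    · refine ⟨1, Or.inl rfl, s0 - c2, by linarith, ?_⟩
      intro x y hx hy hxy
      rw [abs_lt] at hx hy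
      rcases lt_or_ge y c1 with h2 | h2
      · exact ⟨_, L2' x (by linarith), U2 y (by linarith) h2⟩
      · exact ⟨_, L3 x (by linarith), U3 y⟩

theorem snlp_monotone_in_lambda (d3 r3 a31 a32 c1 c2 : ℝ)
    (hd3 : 0 < d3) (hr3 : 0 < r3) (ha31 : 0 ≤ a31) (ha32 : 0 ≤ a32)
    (hsum : a31 + a32 < 1) (hc2 : 0 < c2) (hc12 : c2 < c1)
    (lam1 lam2 : ℝ) (hlam1 : 0 < lam1) (hlam12 : lam1 ≤ lam2)
    (ρ1 ρ2 : ℝ → ℝ)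
    (hρ1 : NlpSol d3 r3 a31 a32 c1 c2 lam1 ρ1)
    (hρ2 : NlpSol d3 r3 a31 a32 c1 c2 lam2 ρ2) :
    (∀ s, 0 ≤ s → ρ1 s ≤ ρ2 s) ∧
    sSup {s : ℝ | 0 ≤ s ∧ ρ2 s = 0} ≤ sSup {s : ℝ | 0 ≤ s ∧ ρ1 s = 0} := by
  set R : ℝ → ℝ := (fun s => r3 * (1 - a31 * (if c2 ≤ s ∧ s ≤ c1 then 1 else 0)
        - a32 * (if 0 < s ∧ s ≤ c2 then 1 else 0))) with hR
  obtain ⟨h1c, h1v, h10, h1t⟩ := hρ1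
  obtain ⟨h2c, h2v, h20, h2t⟩ := hρ2
  have hR0 : ∀ s, 0 ≤ R s := by
    intro s
    simp only [hR]
    apply mul_nonneg hr3.le
    split_ifs <;> linarith
  have hRU : ∀ s, R s ≤ r3 := by
    intro s
    simp only [hR]
    have p1 : 0 ≤ r3 * a31 := by positivity
    have p2 : 0 ≤ r3 * a32 := by positivity
    split_ifs <;> linarith
  have main : ∀ s, 0 ≤ s → ρ1 s ≤ ρ2 s := by
    intro s hs
    have hθ : ∀ θ ∈ Ioo (0:ℝ) 1, θ * ρ1 s - (1 - θ) * r3 ≤ ρ2 s := fun θ hθ =>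
      comparison hd3 hR0 hr3 hRU
        (mono_cond r3 a31 a32 c1 c2 hr3 ha31 ha32 hc2 hc12 R hR) h1c h2c h1v.2 h2v.1
        h10 h20 hlam1 hlam12 h1t h2t hθ.1 hθ.2 hs
    have hc : Tendsto (fun θ : ℝ => θ * ρ1 s - (1 - θ) * r3) (𝓝[<] 1)
        (𝓝 (1 * ρ1 s - (1 - 1) * r3)) := by
      apply Tendsto.mono_left _ nhdsWithin_le_nhds
      exact Continuous.tendsto (by fun_prop) 1
    have := le_of_tendsto hc (by
      filter_upwards [Ioo_mem_nhdsLT (show (0:ℝ) < 1 by norm_num)] with θ h using hθ θ h)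
    simpa using this
  refine ⟨main, ?_⟩
  have hnn : ∀ s, 0 ≤ s → 0 ≤ ρ1 s := by
    intro s hs
    rcases hs.lt_or_eq with h | h
    · exact h1v.1.2.1 s h
    · rw [← h, h10]
  apply csSup_le_csSup
  · obtain ⟨L, hL⟩ := eventually_atTop.mp (h1t.eventually (lt_mem_nhds hlam1))
    refine ⟨L, ?_⟩
    rintro s ⟨hs, hs'⟩
    by_contra! h
    have := hL s h.le
    rw [hs'] at this
    simp at this
  · exact ⟨0, le_rfl, h20⟩
  · rintro s ⟨hs, hs'⟩
    exact ⟨hs, le_antisymm (hs' ▸ main s hs) (hnn s hs)⟩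
end
end
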